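/- There is an absolute constant C > 0 such that for all real x ≥ 2, |T(x) − (H₄ + H₆)·x/√(log x)| ≤ C·x/(log x)^{3/4}, where H₄ = (3/2^{5/2})·∏_{p prime, p ≡ 3 (mod 4)} (1 − 1/p²)^{1/2} and H₆ = (7/(2^{5/2}·3^{3/4}))·∏_{p prime, p ≡ 5 (mod 6)} (1 − 1/p²)^{1/2}. -/

import Mathlib

noncomputable section

def logPlus (y : ℝ) : ℝ := max 0 (Real.log y)

def sdRegion (c₀ : ℝ) : Set ℂ := {s : ℂ | 1 - c₀ / (1 + logPlus |s.im|) ≤ s.re}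

def IsInvFactorDecomp (G : Type*) [CommGroup G] {k : ℕ} (d : Fin k → ℕ) : Prop :=
  (∀ i, 1 < d i) ∧ (∀ i j : Fin k, i ≤ j → d i ∣ d j) ∧
    Nonempty (G ≃* ((i : Fin k) → Multiplicative (ZMod (d i))))

def leastInvFactor (G : Type*) [CommGroup G] : ℕ :=
  sInf {m | ∃ (k : ℕ) (d : Fin (k + 1) → ℕ), IsInvFactorDecomp G d ∧ d 0 = m}

def lambda1 (n : ℕ) : ℕ := if n ≤ 2 then 1 else leastInvFactor (ZMod n)ˣ

def Tcount (x : ℝ) : ℕ := {n : ℕ | 0 < n ∧ (n : ℝ) ≤ x ∧ lambda1 n ≠ 2}.ncard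

def H4 : ℝ :=
  3 / 2 ^ ((5 : ℝ) / 2) *
    ∏' p : {p : Nat.Primes // (p : ℕ) % 4 = 3}, ((1 - 1 / ((p : ℕ) : ℝ) ^ 2) ^ ((1 : ℝ) / 2))

def H6 : ℝ :=
  7 / (2 ^ ((5 : ℝ) / 2) * 3 ^ ((3 : ℝ) / 4)) *
    ∏' p : {p : Nat.Primes // (p : ℕ) % 6 = 5}, ((1 - 1 / ((p : ℕ) : ℝ) ^ 2) ^ ((1 : ℝ) / 2))

section

theorem exists_coprime_splitting {a b : ℕ} (ha : a ≠ 0) (hb : b ≠ 0) :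
    ∃ L a' R b' : ℕ, a = L * a' ∧ b = R * b' ∧ L.Coprime a' ∧ R.Coprime b' ∧ L.Coprime R ∧
      a'.Coprime b' ∧ b' ∣ L ∧ a' ∣ R := by
  classical
  set S := (a * b).primeFactors with hS
  set P : ℕ → Prop := fun p => b.factorization p ≤ a.factorization p with hP
  have hSa : ∏ p ∈ S, p ^ a.factorization p = a := by
    conv_rhs => rw [← Nat.prod_factorization_pow_eq_self ha]
    rw [Finsupp.prod]
    symm
    apply Finset.prod_subset
    · rw [Nat.support_factorization]
      exact Nat.primeFactors_mono (Dvd.intro _ rfl) (mul_ne_zero ha hb)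
    · intro x _ hx
      rw [Finsupp.notMem_support_iff.mp hx, pow_zero]
  have hSb : ∏ p ∈ S, p ^ b.factorization p = b := by
    conv_rhs => rw [← Nat.prod_factorization_pow_eq_self hb]
    rw [Finsupp.prod]
    symm
    apply Finset.prod_subset
    · rw [Nat.support_factorization]
      exact Nat.primeFactors_mono (Dvd.intro_left _ rfl) (mul_ne_zero ha hb)
    · intro x _ hx
      rw [Finsupp.notMem_support_iff.mp hx, pow_zero]
  have hco : ∀ f g : ℕ → ℕ, Nat.Coprime (∏ p ∈ S with P p, p ^ f p) (∏ p ∈ S with ¬ P p, p ^ g p) := by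
    intro f g
    refine Nat.Coprime.prod_left fun p hp => Nat.Coprime.prod_right fun r hr => ?_
    rw [Finset.mem_filter] at hp hr
    apply Nat.coprime_pow_primes
    · exact Nat.prime_of_mem_primeFactors hp.1
    · exact Nat.prime_of_mem_primeFactors hr.1
    · rintro rfl
      exact hr.2 hp.2
  refine ⟨∏ p ∈ S with P p, p ^ a.factorization p, ∏ p ∈ S with ¬ P p, p ^ a.factorization p,
    ∏ p ∈ S with ¬ P p, p ^ b.factorization p, ∏ p ∈ S with P p, p ^ b.factorization p,
    ?_, ?_, hco _ _, (hco _ _).symm, hco _ _, (hco _ _).symm, ?_, ?_⟩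
  · rw [Finset.prod_filter_mul_prod_filter_not, hSa]
  · rw [mul_comm, Finset.prod_filter_mul_prod_filter_not, hSb]
  · apply Finset.prod_dvd_prod_of_dvd
    intro p hp
    exact pow_dvd_pow _ (Finset.mem_filter.mp hp).2
  · apply Finset.prod_dvd_prod_of_dvd
    intro p hp
    exact pow_dvd_pow _ (not_le.mp (Finset.mem_filter.mp hp).2).le

/-- The cyclic group of order `m * n` splits for coprime `m, n`. -/
def multZModMulEquiv {m n : ℕ} (h : m.Coprime n) :
    Multiplicative (ZMod (m * n)) ≃* Multiplicative (ZMod m) × Multiplicative (ZMod n) :=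
  (AddEquiv.toMultiplicative (ZMod.chineseRemainder h).toAddEquiv).trans
    (MulEquiv.prodMultiplicative _ _)

theorem exists_gcd_lcm_equiv {a b : ℕ} (ha : a ≠ 0) (hb : b ≠ 0) :
    ∃ g l : ℕ, g ≠ 0 ∧ l ≠ 0 ∧ g ∣ l ∧ g ∣ b ∧ (∀ c, c ∣ a → c ∣ b → c ∣ g) ∧ a ∣ l ∧
      Nonempty (Multiplicative (ZMod a) × Multiplicative (ZMod b) ≃*
        Multiplicative (ZMod g) × Multiplicative (ZMod l)) := by
  obtain ⟨L, a', R, b', rfl, rfl, h1, h2, h3, h4, h5, h6⟩ := exists_coprime_splitting ha hb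
  have hL : L ≠ 0 := left_ne_zero_of_mul ha
  have ha' : a' ≠ 0 := right_ne_zero_of_mul ha
  have hR : R ≠ 0 := left_ne_zero_of_mul hb
  have hb' : b' ≠ 0 := right_ne_zero_of_mul hb
  have hla : L * a' ∣ L * R := Nat.mul_dvd_mul_left _ h6
  have hlb : R * b' ∣ L * R := by rw [mul_comm R]; exact Nat.mul_dvd_mul_right h5 _
  refine ⟨a' * b', L * R, mul_ne_zero ha' hb', mul_ne_zero hL hR, ?_, ?_, ?_, hla, ⟨?_⟩⟩
  · rw [mul_comm]; exact mul_dvd_mul h5 h6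
  · exact Nat.mul_dvd_mul_right h6 _
  · intro c hc1 hc2
    refine (Nat.dvd_gcd hc1 hc2).trans ?_
    have hl : L * R ∣ Nat.lcm (L * a') (R * b') := h3.mul_dvd_of_dvd_of_dvd
      ((Dvd.intro _ rfl).trans (Nat.dvd_lcm_left _ _)) ((Dvd.intro _ rfl).trans (Nat.dvd_lcm_right _ _))
    have h := Nat.gcd_mul_lcm (L * a') (R * b')
    obtain ⟨k, hk⟩ := hl
    refine Dvd.intro k ?_
    apply Nat.eq_of_mul_eq_mul_right (Nat.pos_of_ne_zero (mul_ne_zero hL hR))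
    rw [hk] at h
    calc (L * a').gcd (R * b') * k * (L * R) = (L * a').gcd (R * b') * (L * R * k) := by ring
      _ = _ := by rw [h]; ring
  · exact ((multZModMulEquiv h1).prodCongr (multZModMulEquiv h2)).trans
      ((((MulEquiv.prodComm).prodCongr (MulEquiv.prodComm)).trans
        ((MulEquiv.prodProdProdComm _ _ _ _).trans
        ((multZModMulEquiv h4).symm.prodCongr (multZModMulEquiv h3).symm))))

/-- Splitting off the first factor of a product indexed by `Fin (k + 1)`. -/
def piFinSuccMulEquiv {k : ℕ} (M : Fin (k + 1) → Type*) [∀ i, Mul (M i)] :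
    ((i : Fin (k + 1)) → M i) ≃* M 0 × ((i : Fin k) → M i.succ) where
  toFun f := (f 0, fun i => f i.succ)
  invFun p := Fin.cons p.1 p.2
  left_inv f := by
    funext i
    refine Fin.cases ?_ (fun j => ?_) i <;> simp
  right_inv p := by simp
  map_mul' f g := rfl

theorem exists_chain_insert {k : ℕ} (d : Fin k → ℕ) (hd0 : ∀ i, d i ≠ 0)
    (hd : ∀ i j : Fin k, i ≤ j → d i ∣ d j) (a : ℕ) (ha : a ≠ 0) :
    ∃ e : Fin (k + 1) → ℕ, (∀ i, e i ≠ 0) ∧ (∀ i j : Fin (k + 1), i ≤ j → e i ∣ e j) ∧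
      (∀ c, c ∣ a → (∀ i, c ∣ d i) → ∀ i, c ∣ e i) ∧
      Nonempty (Multiplicative (ZMod a) × ((i : Fin k) → Multiplicative (ZMod (d i))) ≃*
        ((i : Fin (k + 1)) → Multiplicative (ZMod (e i)))) := by
  induction k generalizing a with
  | zero =>
    refine ⟨fun _ => a, fun _ => ha, fun _ _ _ => dvd_rfl, fun c hc _ _ => hc, ⟨?_⟩⟩
    refine (MulEquiv.prodCongr (MulEquiv.refl _) ?_).trans (piFinSuccMulEquiv (fun _ : Fin 1 => Multiplicative (ZMod a))).symm
    exact MulEquiv.ofUnique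
  | succ k ih =>
    obtain ⟨g, l, hg, hl, hgl, hgb, hc, hal, ⟨φ⟩⟩ := exists_gcd_lcm_equiv ha (hd0 0)
    obtain ⟨e, he0, he, hec, ⟨ψ⟩⟩ := ih (fun i => d i.succ) (fun i => hd0 _)
      (fun i j hij => hd _ _ (Fin.succ_le_succ_iff.mpr hij)) l hl
    have hge : ∀ i, g ∣ e i := hec g hgl fun i => hgb.trans (hd 0 i.succ (Fin.zero_le _))
    refine ⟨Fin.cons g e, ?_, ?_, ?_, ⟨?_⟩⟩
    · intro i
      refine Fin.cases ?_ (fun j => ?_) i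
      · simpa using hg
      · simpa using he0 j
    · intro i j hij
      induction i using Fin.cases with
      | zero =>
        induction j using Fin.cases with
        | zero => simp
        | succ j => simpa using hge j
      | succ i =>
        induction j using Fin.cases with
        | zero => exact absurd hij (by simp)
        | succ j => simpa using he i j (Fin.succ_le_succ_iff.mp hij)
    · intro c hca hcd i
      have hcg := hc c hca (hcd 0)
      refine Fin.cases ?_ (fun j => ?_) i
      · simpa using hcg
      · simpa using hcg.trans (hge j)
    · refine (MulEquiv.prodCongr (MulEquiv.refl _) (piFinSuccMulEquiv _)).trans ?_
      refine MulEquiv.prodAssoc.symm.trans ?_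
      refine (MulEquiv.prodCongr φ (MulEquiv.refl _)).trans ?_
      refine MulEquiv.prodAssoc.trans ?_
      refine (MulEquiv.prodCongr (MulEquiv.refl _) ψ).trans ?_
      exact (piFinSuccMulEquiv (fun i : Fin (k + 1 + 1) =>
        Multiplicative (ZMod ((Fin.cons g e : Fin (k + 1 + 1) → ℕ) i)))).symm

theorem exists_chain {k : ℕ} (d : Fin k → ℕ) (hd0 : ∀ i, d i ≠ 0) :
    ∃ e : Fin k → ℕ, (∀ i, e i ≠ 0) ∧ (∀ i j : Fin k, i ≤ j → e i ∣ e j) ∧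
      Nonempty (((i : Fin k) → Multiplicative (ZMod (d i))) ≃*
        ((i : Fin k) → Multiplicative (ZMod (e i)))) := by
  induction k with
  | zero => exact ⟨d, hd0, fun i => i.elim0, ⟨MulEquiv.refl _⟩⟩
  | succ k ih =>
    obtain ⟨e, he0, he, ⟨φ⟩⟩ := ih (fun i => d i.succ) fun i => hd0 _
    obtain ⟨e', he0', he', -, ⟨ψ⟩⟩ := exists_chain_insert e he0 he (d 0) (hd0 0)
    exact ⟨e', he0', he', ⟨(piFinSuccMulEquiv _).trans
      ((MulEquiv.prodCongr (MulEquiv.refl _) φ).trans ψ)⟩⟩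

theorem exists_invFactorDecomp_of_chain {G : Type*} [CommGroup G] {k : ℕ} (d : Fin k → ℕ)
    (hd0 : ∀ i, d i ≠ 0) (hd : ∀ i j : Fin k, i ≤ j → d i ∣ d j)
    (φ : G ≃* ((i : Fin k) → Multiplicative (ZMod (d i)))) :
    ∃ (m : ℕ) (e : Fin m → ℕ), IsInvFactorDecomp G e := by
  induction k with
  | zero => exact ⟨0, d, fun i => i.elim0, hd, ⟨φ⟩⟩
  | succ k ih =>
    by_cases h : d 0 = 1
    · refine ih (fun i => d i.succ) (fun i => hd0 _)
        (fun i j hij => hd _ _ (Fin.succ_le_succ_iff.mpr hij)) ?_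
      refine (φ.trans (piFinSuccMulEquiv _)).trans ?_
      haveI : Unique (Multiplicative (ZMod (d 0))) := by
        rw [h]
        exact Unique.mk' _
      exact MulEquiv.uniqueProd
    · refine ⟨k + 1, d, fun i => ?_, hd, ⟨φ⟩⟩
      have h0 : 1 < d 0 := by have := hd0 0; omega
      exact h0.trans_le (Nat.le_of_dvd (Nat.pos_of_ne_zero (hd0 i)) (hd 0 i (Fin.zero_le _)))

theorem exists_invFactorDecomp (G : Type*) [CommGroup G] [Finite G] :
    ∃ (m : ℕ) (e : Fin m → ℕ), IsInvFactorDecomp G e := by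
  obtain ⟨ι, hι, n, hn, ⟨φ⟩⟩ := CommGroup.equiv_prod_multiplicative_zmod_of_finite G
  let σ := Fintype.equivFin ι
  let φ' : G ≃* ((i : Fin (Fintype.card ι)) → Multiplicative (ZMod (n (σ.symm i)))) :=
    φ.trans { Equiv.piCongrLeft' (fun i => Multiplicative (ZMod (n i))) σ with
      map_mul' := fun _ _ => rfl }
  obtain ⟨e, he0, he, ⟨ψ⟩⟩ := exists_chain (fun i => n (σ.symm i))
    fun i => by have := hn (σ.symm i); omega
  exact exists_invFactorDecomp_of_chain e he0 he (φ'.trans ψ)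

end

section

/-- The number of solutions of `x ^ m = 1` in a group. -/
def torsionCard (G : Type*) [CommGroup G] (m : ℕ) : ℕ := Nat.card {x : G // x ^ m = 1}

theorem torsionCard_congr {G H : Type*} [CommGroup G] [CommGroup H] (φ : G ≃* H) (m : ℕ) :
    torsionCard G m = torsionCard H m := by
  apply Nat.card_congr
  refine φ.toEquiv.subtypeEquiv fun x => ?_
  simp [← map_pow]

theorem torsionCard_prod (G H : Type*) [CommGroup G] [CommGroup H] (m : ℕ) :
    torsionCard (G × H) m = torsionCard G m * torsionCard H m := by
  rw [torsionCard, torsionCard, torsionCard, ← Nat.card_prod]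
  apply Nat.card_congr
  refine Equiv.trans (Equiv.subtypeEquivRight fun x => ?_) (Equiv.subtypeProdEquivProd)
  simp [Prod.ext_iff]

theorem torsionCard_pi {ι : Type*} [Fintype ι] (G : ι → Type*) [∀ i, CommGroup (G i)] (m : ℕ) :
    torsionCard (∀ i, G i) m = ∏ i, torsionCard (G i) m := by
  simp only [torsionCard]
  rw [← Nat.card_pi]
  apply Nat.card_congr
  refine Equiv.trans (Equiv.subtypeEquivRight fun x => ?_)
    (Equiv.subtypePiEquivPi (p := fun i (y : G i) => y ^ m = 1))
  simp [funext_iff]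

theorem torsionCard_of_isCyclic (G : Type*) [CommGroup G] [IsCyclic G] [Finite G] (m : ℕ) :
    torsionCard G m = (Nat.card G).gcd m := by
  rw [← IsCyclic.card_powMonoidHom_ker]
  apply Nat.card_congr
  exact Equiv.subtypeEquivRight fun x => by simp [MonoidHom.mem_ker]

theorem torsionCard_multZMod {d : ℕ} (hd : d ≠ 0) (m : ℕ) :
    torsionCard (Multiplicative (ZMod d)) m = d.gcd m := by
  have : NeZero d := ⟨hd⟩
  rw [torsionCard_of_isCyclic]
  simp

theorem exists_torsionCard_eq_pow (G : Type*) [CommGroup G] [Finite G] {q : ℕ} (hq : q.Prime) :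
    ∃ a, torsionCard G q = q ^ a := by
  have := Fact.mk hq
  have h : torsionCard G q = Nat.card (powMonoidHom q : G →* G).ker :=
    Nat.card_congr (Equiv.subtypeEquivRight fun x => by simp [MonoidHom.mem_ker])
  rw [h]
  apply IsPGroup.iff_card.mp
  rintro ⟨x, hx⟩
  exact ⟨1, by ext; simpa [MonoidHom.mem_ker] using hx⟩

/-- Every solution of `x ^ 2 = 1` is a square. -/
def InvolutionsAreSquares (G : Type*) [CommGroup G] : Prop := ∀ x : G, x ^ 2 = 1 → ∃ y, x = y ^ 2

theorem InvolutionsAreSquares.congr {G H : Type*} [CommGroup G] [CommGroup H] (φ : G ≃* H)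
    (h : InvolutionsAreSquares G) : InvolutionsAreSquares H := by
  intro x hx
  obtain ⟨y, hy⟩ := h (φ.symm x) (by rw [← map_pow, hx, map_one])
  exact ⟨φ y, by rw [← map_pow, ← hy, φ.apply_symm_apply]⟩

theorem InvolutionsAreSquares.prod {G H : Type*} [CommGroup G] [CommGroup H]
    (h : InvolutionsAreSquares G) (h' : InvolutionsAreSquares H) : InvolutionsAreSquares (G × H) := by
  rintro ⟨x, x'⟩ hx
  rw [Prod.pow_mk, Prod.mk_eq_one] at hx
  obtain ⟨y, hy⟩ := h x hx.1
  obtain ⟨y', hy'⟩ := h' x' hx.2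
  exact ⟨(y, y'), by rw [hy, hy', Prod.pow_mk]⟩

theorem InvolutionsAreSquares.of_isCyclic {G : Type*} [CommGroup G] [IsCyclic G] [Finite G]
    (h : 4 ∣ Nat.card G) : InvolutionsAreSquares G := by
  intro x hx
  obtain ⟨g, hg⟩ := IsCyclic.exists_generator (α := G)
  obtain ⟨j, rfl⟩ := (mem_powers_iff_mem_zpowers.mpr (hg x))
  have ho : orderOf g = Nat.card G := orderOf_eq_card_of_forall_mem_zpowers hg
  simp only at hx ⊢
  rw [← pow_mul] at hx
  have := h.trans (ho ▸ orderOf_dvd_of_pow_eq_one hx)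
  obtain ⟨i, rfl⟩ : 2 ∣ j := by omega
  exact ⟨g ^ i, by rw [← pow_mul, mul_comm]⟩

theorem InvolutionsAreSquares.pi {ι : Type*} {G : ι → Type*} [∀ i, CommGroup (G i)]
    (h : ∀ i, InvolutionsAreSquares (G i)) : InvolutionsAreSquares (∀ i, G i) := by
  intro x hx
  choose y hy using fun i => h i (x i) (congrFun hx i)
  exact ⟨y, funext hy⟩

theorem not_involutionsAreSquares_of_head_eq_two {k : ℕ} {d : Fin (k + 1) → ℕ} (hd : d 0 = 2) :
    ¬ InvolutionsAreSquares ((i : Fin (k + 1)) → Multiplicative (ZMod (d i))) := by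
  intro h
  obtain ⟨y, hy⟩ := h (Pi.mulSingle 0 (Multiplicative.ofAdd 1)) (by
    rw [← Pi.mulSingle_pow, ← ofAdd_nsmul]
    have : (2 • (1 : ZMod (d 0))) = 0 := by
      rw [nsmul_eq_mul, mul_one, ← hd]; simp
    rw [this]; simp)
  have h0 := congrFun hy 0
  rw [Pi.mulSingle_eq_same, Pi.pow_apply] at h0
  have h1 : (1 : ZMod (d 0)) = 2 • Multiplicative.toAdd (y 0) := by
    rw [← toAdd_pow, ← h0]; rfl
  rw [nsmul_eq_mul, ← hd, ZMod.natCast_self, zero_mul] at h1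
  have : Fact (1 < d 0) := ⟨by omega⟩
  exact one_ne_zero h1

/-- `¬ 4 ∣ n` and all odd prime factors of `n` are `1` modulo `4`. -/
def InA (n : ℕ) : Prop := ¬ 4 ∣ n ∧ ∀ p, p.Prime → p ∣ n → p ≠ 2 → p % 4 = 1

/-- `¬ 4 ∣ n` and every odd prime factor of `n` is either `1` modulo `q`, or equal to `q` and
occurs at least twice. -/
def InB (q n : ℕ) : Prop :=
  ¬ 4 ∣ n ∧ ∀ p, p.Prime → p ∣ n → p ≠ 2 → p % q = 1 ∨ (p = q ∧ q ^ 2 ∣ n)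

theorem sq_dvd_mul_iff_of_coprime {a b p : ℕ} (hp : p.Prime) (h : a.Coprime b) :
    p ^ 2 ∣ a * b ↔ p ^ 2 ∣ a ∨ p ^ 2 ∣ b :=
  Nat.Coprime.isPrimePow_dvd_mul h (hp.isPrimePow.pow two_ne_zero)

theorem inA_mul {a b : ℕ} (h : a.Coprime b) : InA (a * b) ↔ InA a ∧ InA b := by
  have h4 : 4 ∣ a * b ↔ 4 ∣ a ∨ 4 ∣ b := sq_dvd_mul_iff_of_coprime Nat.prime_two h
  unfold InA
  rw [h4]
  constructor
  · rintro ⟨h1, h2⟩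
    exact ⟨⟨by tauto, fun p hp hpa => h2 p hp (hpa.mul_right _)⟩,
      ⟨by tauto, fun p hp hpa => h2 p hp (hpa.mul_left _)⟩⟩
  · rintro ⟨⟨h1, h2⟩, h3, h5⟩
    refine ⟨by tauto, fun p hp hpab => ?_⟩
    rcases (hp.dvd_mul).mp hpab with h | h
    exacts [h2 p hp h, h5 p hp h]

theorem inB_mul {a b q : ℕ} (hq : q.Prime) (h : a.Coprime b) :
    InB q (a * b) ↔ InB q a ∧ InB q b := by
  have h4 : 4 ∣ a * b ↔ 4 ∣ a ∨ 4 ∣ b := sq_dvd_mul_iff_of_coprime Nat.prime_two h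
  have hq2 := sq_dvd_mul_iff_of_coprime hq h
  have key : ∀ a b : ℕ, a.Coprime b → q ∣ a → ¬ q ^ 2 ∣ b := fun a b hab hqa hb =>
    hq.one_lt.ne' (Nat.eq_one_of_dvd_coprimes hab hqa ((dvd_pow_self q two_ne_zero).trans hb))
  unfold InB
  rw [h4, hq2]
  constructor
  · rintro ⟨h1, h2⟩
    refine ⟨⟨by tauto, fun p hp hpa h2' => ?_⟩, ⟨by tauto, fun p hp hpa h2' => ?_⟩⟩
    · rcases h2 p hp (hpa.mul_right _) h2' with h | ⟨rfl, h | h'⟩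
      · exact Or.inl h
      · exact Or.inr ⟨rfl, h⟩
      · exact absurd h' (key _ _ h hpa)
    · rcases h2 p hp (hpa.mul_left _) h2' with h | ⟨rfl, h' | h'⟩
      · exact Or.inl h
      · exact absurd h' (key _ _ h.symm hpa)
      · exact Or.inr ⟨rfl, h'⟩
  · rintro ⟨⟨h1, h2⟩, h3, h5⟩
    refine ⟨by tauto, fun p hp hpab h2' => ?_⟩
    rcases (hp.dvd_mul).mp hpab with h | h
    · have := h2 p hp h h2'; tauto
    · have := h5 p hp h h2'; tauto

theorem unitsMulEquiv {a b : ℕ} (h : a.Coprime b) :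
    Nonempty ((ZMod (a * b))ˣ ≃* (ZMod a)ˣ × (ZMod b)ˣ) :=
  ⟨(Units.mapEquiv (ZMod.chineseRemainder h).toMulEquiv).trans MulEquiv.prodUnits⟩

theorem involutionsAreSquares_of_inA (n : ℕ) (hn : n ≠ 0) (h : InA n) :
    InvolutionsAreSquares (ZMod n)ˣ := by
  induction n using Nat.recOnPosPrimePosCoprime with
  | zero => exact absurd rfl hn
  | one => exact fun x _ => ⟨1, Subsingleton.elim _ _⟩
  | prime_pow p k hp hk =>
    have : NeZero (p ^ k) := ⟨hn⟩
    rcases eq_or_ne p 2 with rfl | h2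
    · have hk1 : k = 1 := by
        by_contra hk1
        exact h.1 (pow_dvd_pow 2 (show 2 ≤ k by omega))
      subst hk1
      exact fun x _ => ⟨1, Subsingleton.elim (α := (ZMod 2)ˣ) _ _⟩
    · have h4 := h.2 p hp (dvd_pow_self p hk.ne') h2
      have := ZMod.isCyclic_units_of_prime_pow p hp h2 k
      apply InvolutionsAreSquares.of_isCyclic
      rw [Nat.card_eq_fintype_card, ZMod.card_units_eq_totient, Nat.totient_prime_pow hp hk]
      exact Dvd.dvd.mul_left (by have := hp.one_lt; omega) _
  | coprime a b ha hb hab iha ihb =>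
    obtain ⟨φ⟩ := unitsMulEquiv hab
    obtain ⟨h1, h2⟩ := (inA_mul hab).mp h
    exact ((iha (by omega) h1).prod (ihb (by omega) h2)).congr φ.symm

theorem inA_of_involutionsAreSquares (n : ℕ) (h : InvolutionsAreSquares (ZMod n)ˣ) : InA n := by
  obtain ⟨y, hy⟩ := h (-1) (by simp)
  have hy' : (-1 : ZMod n) = (y : ZMod n) ^ 2 := by
    rw [← Units.val_pow_eq_pow_val, ← hy]; simp
  constructor
  · intro h4
    have := congrArg (ZMod.castHom h4 (ZMod 4)) hy'
    rw [map_neg, map_one, map_pow] at this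
    revert this
    generalize (ZMod.castHom h4 (ZMod 4)) (y : ZMod n) = z
    revert z
    decide
  · intro p hp hpn h2
    have := Fact.mk hp
    have := congrArg (ZMod.castHom hpn (ZMod p)) hy'
    rw [map_neg, map_one, map_pow] at this
    have h3 : p % 4 ≠ 3 := ZMod.exists_sq_eq_neg_one_iff.mp ⟨_, by rw [this, sq]⟩
    have := hp.eq_two_or_odd
    omega

theorem torsionCard_units_comparison {q : ℕ} (hq : q.Prime) (hq2 : q ≠ 2) (n : ℕ) (hn : n ≠ 0) :
    ∃ a b, torsionCard (ZMod n)ˣ q = q ^ a ∧ torsionCard (ZMod n)ˣ 2 = 2 ^ b ∧ a ≤ b ∧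
      (a = b ↔ InB q n) := by
  induction n using Nat.recOnPosPrimePosCoprime with
  | zero => exact absurd rfl hn
  | one =>
    refine ⟨0, 0, ?_, ?_, le_rfl, ?_⟩
    · rw [torsionCard_of_isCyclic]; simp
    · rw [torsionCard_of_isCyclic]; simp
    · simp only [true_iff]
      exact ⟨by decide, fun p hp h => absurd h (by simpa using hp.ne_one)⟩
  | prime_pow p k hp hk =>
    have : NeZero (p ^ k) := ⟨hn⟩
    obtain ⟨a, ha⟩ := exists_torsionCard_eq_pow (ZMod (p ^ k))ˣ hq
    obtain ⟨b, hb⟩ := exists_torsionCard_eq_pow (ZMod (p ^ k))ˣ Nat.prime_two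
    refine ⟨a, b, ha, hb, ?_⟩
    have hodd : Odd q := hq.odd_of_ne_two hq2
    rcases eq_or_ne p 2 with rfl | h2
    · have hq1 : torsionCard (ZMod (2 ^ k))ˣ q = 1 := by
        rw [torsionCard, Nat.card_eq_one_iff_unique]
        refine ⟨⟨fun x y => ?_⟩, ⟨1, by simp⟩⟩
        have key : ∀ x : (ZMod (2 ^ k))ˣ, x ^ q = 1 → x = 1 := by
          intro x hx
          have h1 := orderOf_dvd_of_pow_eq_one hx
          have h2 : orderOf x ∣ 2 ^ (k - 1) * (2 - 1) := by
            rw [← Nat.totient_prime_pow hp hk, ← ZMod.card_units_eq_totient]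
            exact orderOf_dvd_card
          rw [show 2 - 1 = 1 by rfl, mul_one] at h2
          have hc : Nat.Coprime q (2 ^ (k - 1)) :=
            Nat.Coprime.pow_right _ ((Nat.coprime_primes hq Nat.prime_two).mpr hq2)
          exact orderOf_eq_one_iff.mp (Nat.eq_one_of_dvd_coprimes hc h1 h2)
        ext1
        rw [key _ x.2, key _ y.2]
      have ha0 : a = 0 := by
        rw [hq1] at ha
        by_contra h0
        exact (Nat.one_lt_pow h0 hq.one_lt).ne ha
      subst ha0
      refine ⟨Nat.zero_le _, ?_⟩
      rcases Nat.lt_or_ge k 2 with h | h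
      · have : k = 1 := by omega
        subst this
        have : torsionCard (ZMod (2 ^ 1))ˣ 2 = 1 := by
          rw [torsionCard, Nat.card_eq_one_iff_unique]
          refine ⟨⟨fun x y => Subtype.ext (Subsingleton.elim (α := (ZMod 2)ˣ) _ _)⟩, ⟨1, by simp⟩⟩
        have hb0 : b = 0 := by
          rw [this] at hb
          by_contra h0
          exact (Nat.one_lt_pow h0 one_lt_two).ne hb
        subst hb0
        simp only [true_iff]
        refine ⟨by decide, fun p hp hp2 hp2' => ?_⟩
        exact absurd ((Nat.prime_dvd_prime_iff_eq hp Nat.prime_two).mp (by simpa using hp2)) hp2'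
      · have h4 : 4 ∣ 2 ^ k := pow_dvd_pow 2 h
        have hnb : b ≠ 0 := by
          rintro rfl
          rw [pow_zero, torsionCard, Nat.card_eq_one_iff_unique] at hb
          have := hb.1.elim ⟨1, by simp⟩ ⟨-1, by simp⟩
          rw [Subtype.mk.injEq] at this
          have h1 : (1 : ZMod (2 ^ k)) = -1 := by
            have := congrArg Units.val this
            simpa using this
          have := congrArg (ZMod.castHom h4 (ZMod 4)) h1
          rw [map_neg, map_one] at this
          revert this
          decide
        constructor
        · intro h; exact absurd h.symm hnb
        · intro h; exact absurd h4 h.1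
    · have := ZMod.isCyclic_units_of_prime_pow p hp h2 k
      have hcard : Nat.card (ZMod (p ^ k))ˣ = p ^ (k - 1) * (p - 1) := by
        rw [Nat.card_eq_fintype_card, ZMod.card_units_eq_totient, Nat.totient_prime_pow hp hk]
      rw [torsionCard_of_isCyclic, hcard] at ha hb
      have hpodd := hp.eq_two_or_odd
      have hb1 : b = 1 := by
        rw [Nat.gcd_eq_right (Dvd.dvd.mul_left (by omega) _)] at hb
        exact (Nat.pow_right_injective le_rfl (by simpa using hb)).symm
      subst hb1
      have ha1 : a ≤ 1 := by
        have : q ^ a ∣ q ^ 1 := by rw [← ha, pow_one]; exact Nat.gcd_dvd_right _ _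
        exact (Nat.pow_dvd_pow_iff_le_right hq.one_lt).mp this
      refine ⟨ha1, ?_⟩
      have h1 : a = 1 ↔ q ∣ p ^ (k - 1) * (p - 1) := by
        constructor
        · rintro rfl
          rw [pow_one] at ha
          rw [← ha]
          exact Nat.gcd_dvd_left _ _
        · intro h
          rw [Nat.gcd_eq_right h] at ha
          exact (Nat.pow_right_injective hq.two_le (by simpa using ha)).symm
      have hmod : q ∣ p - 1 ↔ p % q = 1 := by
        rw [← (Nat.modEq_iff_dvd' hp.one_lt.le), Nat.ModEq, Nat.mod_eq_of_lt hq.one_lt]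
        exact eq_comm
      have hpk : ∀ r, r.Prime → r ∣ p ^ k → r = p := fun r hr h =>
        (Nat.prime_dvd_prime_iff_eq hr hp).mp (hr.dvd_of_dvd_pow h)
      rw [h1, hq.dvd_mul, hmod]
      constructor
      · intro h
        refine ⟨fun h4 => h2 (hpk 2 Nat.prime_two ((by decide : 2 ∣ 4).trans h4)).symm, ?_⟩
        intro r hr hrp _
        rw [hpk r hr hrp]
        rcases h with h | h
        · right
          have hqp := (Nat.prime_dvd_prime_iff_eq hq hp).mp (hq.dvd_of_dvd_pow h)
          subst hqp
          refine ⟨rfl, pow_dvd_pow _ ?_⟩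
          by_contra hk2
          have : k = 1 := by omega
          subst this
          exact hq.ne_one (by simpa using h)
        · exact Or.inl h
      · intro h
        rcases h.2 p hp (dvd_pow_self p hk.ne') h2 with h | ⟨rfl, h⟩
        · exact Or.inr h
        · left
          have := (Nat.pow_dvd_pow_iff_le_right hp.one_lt).mp h
          exact dvd_pow_self p (by omega)
  | coprime m n hm hn hmn ihm ihn =>
    obtain ⟨φ⟩ := unitsMulEquiv hmn
    obtain ⟨a, b, h1, h2, h3, h4⟩ := ihm (by omega)
    obtain ⟨a', b', h1', h2', h3', h4'⟩ := ihn (by omega)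
    refine ⟨a + a', b + b', ?_, ?_, by omega, ?_⟩
    · rw [torsionCard_congr φ, torsionCard_prod, h1, h1', pow_add]
    · rw [torsionCard_congr φ, torsionCard_prod, h2, h2', pow_add]
    · rw [inB_mul hq hmn, ← h4, ← h4']
      omega

theorem torsionCard_of_decomp {G : Type*} [CommGroup G] {k : ℕ} {d : Fin k → ℕ}
    (h : IsInvFactorDecomp G d) (m : ℕ) : torsionCard G m = ∏ i, (d i).gcd m := by
  obtain ⟨h1, -, ⟨φ⟩⟩ := h
  rw [torsionCard_congr φ, torsionCard_pi]
  exact Finset.prod_congr rfl fun i _ => torsionCard_multZMod (by have := h1 i; omega) m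

theorem lambda1_ne_two_iff (n : ℕ) (hn : n ≠ 0) :
    lambda1 n ≠ 2 ↔ InA n ∨ ∃ q, q.Prime ∧ q ≠ 2 ∧ InB q n := by
  by_cases hn2 : n ≤ 2
  · rw [lambda1, if_pos hn2]
    simp only [ne_eq, OfNat.one_ne_ofNat, not_false_eq_true, true_iff]
    left
    refine ⟨fun h => ?_, fun p hp h h2 => ?_⟩
    · have := Nat.le_of_dvd (by omega) h; omega
    · have := Nat.le_of_dvd (by omega) h
      have := hp.two_le
      omega
  have : NeZero n := ⟨hn⟩
  rw [lambda1, if_neg hn2]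
  set G := (ZMod n)ˣ
  constructor
  · contrapose!
    rintro ⟨hA, hB⟩
    obtain ⟨m, d, hd⟩ := exists_invFactorDecomp G
    have key : ∀ (k : ℕ) (d : Fin (k + 1) → ℕ), IsInvFactorDecomp G d → d 0 = 2 := by
      intro k d hd
      obtain ⟨h1, h2, ⟨φ⟩⟩ := id hd
      have hodd : ∀ q, q.Prime → q ≠ 2 → ¬ q ∣ d 0 := by
        intro q hq hq2 hqd
        obtain ⟨a, b, ha, hb, hab, hiff⟩ := torsionCard_units_comparison hq hq2 n hn
        refine hB q hq hq2 (hiff.mp (le_antisymm hab ?_))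
        rw [torsionCard_of_decomp hd] at ha hb
        have ha' : a = k + 1 := by
          rw [Finset.prod_congr rfl fun i _ =>
            Nat.gcd_eq_right (hqd.trans (h2 0 i (Fin.zero_le _)))] at ha
          rw [Finset.prod_const, Finset.card_univ, Fintype.card_fin] at ha
          exact (Nat.pow_right_injective hq.two_le ha).symm
        have hb' : 2 ^ b ≤ 2 ^ (k + 1) := by
          rw [← hb]
          calc _ ≤ ∏ i : Fin (k + 1), 2 :=
                Finset.prod_le_prod' fun i _ => Nat.le_of_dvd two_pos (Nat.gcd_dvd_right _ _)
            _ = _ := by simp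
        rw [ha']
        exact (Nat.pow_le_pow_iff_right one_lt_two).mp hb'
      have h4 : ¬ 4 ∣ d 0 := by
        intro h4
        apply hA
        apply inA_of_involutionsAreSquares
        refine InvolutionsAreSquares.congr φ.symm (InvolutionsAreSquares.pi fun i => ?_)
        have : NeZero (d i) := ⟨by have := h1 i; omega⟩
        apply InvolutionsAreSquares.of_isCyclic
        simpa using h4.trans (h2 0 i (Fin.zero_le _))
      have hd0 := h1 0
      obtain ⟨j, hj⟩ : ∃ j, d 0 = 2 ^ j := by
        refine ⟨(d 0).primeFactorsList.length, ?_⟩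
        exact Nat.eq_prime_pow_of_unique_prime_dvd (by omega) fun {p} hp hpd => by
          by_contra h
          exact hodd p hp h hpd
      have hj2 : j < 2 := by
        by_contra hj2
        exact h4 (hj ▸ pow_dvd_pow 2 (show 2 ≤ j by omega))
      interval_cases j
      · omega
      · simpa using hj
    have hm : m ≠ 0 := by
      rintro rfl
      obtain ⟨-, -, ⟨φ⟩⟩ := hd
      have h1 : (1 : G) = -1 := φ.injective (Subsingleton.elim _ _)
      have h1 : (1 : ZMod n) = -1 := by
        have := congrArg Units.val h1
        rwa [Units.val_neg, Units.val_one] at this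
      have : Fact (2 < n) := ⟨by omega⟩
      exact ZMod.neg_one_ne_one h1.symm
    obtain ⟨k, rfl⟩ := Nat.exists_eq_succ_of_ne_zero hm
    have : {m | ∃ (k : ℕ) (d : Fin (k + 1) → ℕ), IsInvFactorDecomp G d ∧ d 0 = m} = {2} := by
      ext m
      simp only [Set.mem_ofPred_eq, Set.mem_singleton_iff]
      constructor
      · rintro ⟨k, d, hd, rfl⟩
        exact key k d hd
      · rintro rfl
        exact ⟨k, d, hd, key k d hd⟩
    rw [leastInvFactor, this, csInf_singleton]
  · intro h hl
    have hne : {m | ∃ (k : ℕ) (d : Fin (k + 1) → ℕ), IsInvFactorDecomp G d ∧ d 0 = m}.Nonempty := by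
      by_contra he
      rw [Set.not_nonempty_iff_eq_empty] at he
      rw [leastInvFactor, he] at hl
      simp at hl
    have hmem := Nat.sInf_mem hne
    change leastInvFactor G ∈ _ at hmem
    rw [hl] at hmem
    obtain ⟨k, d, hd, hd0⟩ := hmem
    rcases h with h | ⟨q, hq, hq2, hB⟩
    · obtain ⟨-, -, ⟨φ⟩⟩ := hd
      exact not_involutionsAreSquares_of_head_eq_two hd0
        ((involutionsAreSquares_of_inA n hn h).congr φ)
    · obtain ⟨a, b, ha, hb, hab, hiff⟩ := torsionCard_units_comparison hq hq2 n hn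
      have hab' := hiff.mpr hB
      subst hab'
      rw [torsionCard_of_decomp hd] at ha hb
      have hb' : a = k + 1 := by
        rw [Finset.prod_congr rfl fun i _ =>
          Nat.gcd_eq_right (hd0 ▸ hd.2.1 0 i (Fin.zero_le _))] at hb
        rw [Finset.prod_const, Finset.card_univ, Fintype.card_fin] at hb
        exact (Nat.pow_right_injective le_rfl hb).symm
      have : q ^ a ≤ q ^ k := by
        rw [← ha, Fin.prod_univ_succ, hd0, (Nat.coprime_primes Nat.prime_two hq).mpr hq2.symm, one_mul]
        calc _ ≤ ∏ i : Fin k, q :=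
              Finset.prod_le_prod' fun i _ => Nat.le_of_dvd hq.pos (Nat.gcd_dvd_right _ _)
          _ = _ := by simp
      have := (Nat.pow_le_pow_iff_right hq.one_lt).mp this
      omega

end

section

open MeasureTheory Set

/-- Abel summation against a sequence whose partial sums are close to a linear function. -/
theorem norm_sum_mul_sub_integral_le {c : ℕ → ℂ} {κ : ℂ} {K : ℝ}
    (hK : ∀ t : ℝ, 0 ≤ t → ‖∑ k ∈ Finset.Icc 0 ⌊t⌋₊, c k - κ * t‖ ≤ K)
    {g g' : ℝ → ℂ} {a b : ℝ} (ha : 0 ≤ a) (hab : a ≤ b)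
    (hg : ∀ t ∈ Icc a b, HasDerivAt g (g' t) t) (hg' : ContinuousOn g' (Icc a b)) :
    ‖∑ k ∈ Finset.Ioc ⌊a⌋₊ ⌊b⌋₊, g k * c k - κ * ∫ t in a..b, g t‖ ≤
      K * (‖g a‖ + ‖g b‖ + ∫ t in a..b, ‖g' t‖) := by
  have hinteg : IntegrableOn g' (Icc a b) := hg'.integrableOn_Icc
  have hderiv : ∀ t ∈ Icc a b, deriv g t = g' t := fun t ht => (hg t ht).deriv
  have hinteg' : IntegrableOn (deriv g) (Icc a b) :=
    hinteg.congr_fun (fun t ht => (hderiv t ht).symm) measurableSet_Icc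
  have h1 := sum_mul_eq_sub_sub_integral_mul c ha hab
    (fun t ht => (hg t ht).differentiableAt) hinteg'
  have hu : uIcc a b = Icc a b := uIcc_of_le hab
  have hii : IntervalIntegrable g' volume a b :=
    (intervalIntegrable_iff_integrableOn_Icc_of_le hab).mpr hinteg
  have h2 := intervalIntegral.integral_mul_deriv_eq_deriv_mul (a := a) (b := b) (u := g) (u' := g')
    (v := fun t : ℝ => (t : ℂ)) (v' := fun _ => 1) (fun x hx => hg x (hu ▸ hx))
    (fun x _ => Complex.ofRealCLM.hasDerivAt) hii (by simp)
  simp only [mul_one] at h2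
  have h3 : ∫ t in Ioc a b, deriv g t * ∑ k ∈ Finset.Icc 0 ⌊t⌋₊, c k =
      ∫ t in a..b, g' t * ∑ k ∈ Finset.Icc 0 ⌊t⌋₊, c k := by
    rw [intervalIntegral.integral_of_le hab]
    exact setIntegral_congr_fun measurableSet_Ioc fun t ht => by
      simp only [hderiv t (Ioc_subset_Icc_self ht)]
  have hi1 : IntervalIntegrable (fun t => g' t * ∑ k ∈ Finset.Icc 0 ⌊t⌋₊, c k) volume a b :=
    (intervalIntegrable_iff_integrableOn_Icc_of_le hab).mpr (integrableOn_mul_sum_Icc c ha hinteg)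
  have hi2 : IntervalIntegrable (fun t => g' t * (t : ℂ)) volume a b :=
    hii.mul_continuousOn (by fun_prop)
  have h4 : ∑ k ∈ Finset.Ioc ⌊a⌋₊ ⌊b⌋₊, g k * c k - κ * ∫ t in a..b, g t =
      g b * (∑ k ∈ Finset.Icc 0 ⌊b⌋₊, c k - κ * b) - g a * (∑ k ∈ Finset.Icc 0 ⌊a⌋₊, c k - κ * a) -
      ∫ t in a..b, g' t * (∑ k ∈ Finset.Icc 0 ⌊t⌋₊, c k - κ * t) := by
    have h5 : ∫ t in a..b, g' t * (∑ k ∈ Finset.Icc 0 ⌊t⌋₊, c k - κ * t) =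
        (∫ t in a..b, g' t * ∑ k ∈ Finset.Icc 0 ⌊t⌋₊, c k) - κ * ∫ t in a..b, g' t * (t : ℂ) := by
      rw [← intervalIntegral.integral_const_mul, ← intervalIntegral.integral_sub hi1
        (hi2.const_mul κ)]
      congr 1; ext t; ring
    rw [h1, h2, h3, h5]; ring
  have h6 : ‖∫ t in a..b, g' t * (∑ k ∈ Finset.Icc 0 ⌊t⌋₊, c k - κ * t)‖ ≤
      K * ∫ t in a..b, ‖g' t‖ := by
    rw [← intervalIntegral.integral_const_mul]
    refine intervalIntegral.norm_integral_le_of_norm_le hab ?_ (hii.norm.const_mul K)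
    refine ae_of_all _ fun t ht => ?_
    rw [norm_mul, mul_comm]
    exact mul_le_mul_of_nonneg_right (hK t (ha.trans ht.1.le)) (norm_nonneg _)
  rw [h4]
  calc _ ≤ ‖g b‖ * K + ‖g a‖ * K + K * ∫ t in a..b, ‖g' t‖ := by
        refine (norm_sub_le _ _).trans (add_le_add ((norm_sub_le _ _).trans (add_le_add ?_ ?_)) h6)
        · rw [norm_mul]; exact mul_le_mul_of_nonneg_left (hK b (ha.trans hab)) (norm_nonneg _)
        · rw [norm_mul]; exact mul_le_mul_of_nonneg_left (hK a ha) (norm_nonneg _)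
    _ = _ := by ring

theorem sum_range_add_of_periodic {N : ℕ} {c : ℕ → ℂ} (hc : Function.Periodic c N) (n : ℕ) :
    ∑ k ∈ Finset.range N, c (n + k) = ∑ k ∈ Finset.range N, c k := by
  induction n with
  | zero => simp
  | succ n ih =>
    rw [← ih]
    have h1 := Finset.sum_range_succ (fun k => c (n + k)) N
    have h2 := Finset.sum_range_succ' (fun k => c (n + k)) N
    rw [h1, hc n] at h2
    simp only [add_zero, add_left_inj] at h2
    rw [h2]
    exact Finset.sum_congr rfl fun k _ => by congr 1; ring

theorem exists_periodic_sum_bound {N : ℕ} (hN : 0 < N) {c : ℕ → ℂ} (hc : Function.Periodic c N) :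
    ∃ (κ : ℂ) (K : ℝ), 0 ≤ K ∧
      ∀ t : ℝ, 0 ≤ t → ‖∑ k ∈ Finset.Icc 0 ⌊t⌋₊, c k - κ * t‖ ≤ K := by
  set κ : ℂ := (∑ k ∈ Finset.range N, c k) / N with hκ
  have hN' : (N : ℂ) ≠ 0 := by exact_mod_cast hN.ne'
  set D : ℕ → ℂ := fun n => ∑ k ∈ Finset.range n, c k - κ * n with hD
  have hper : Function.Periodic D N := by
    intro n
    simp only [hD, Finset.sum_range_add, sum_range_add_of_periodic hc]
    rw [hκ]; push_cast; field_simp; ring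
  set K := ∑ n ∈ Finset.range N, ‖D n‖ with hKd
  have hDK : ∀ n, ‖D n‖ ≤ K := fun n => by
    rw [← hper.map_mod_nat n]
    exact Finset.single_le_sum (f := fun n => ‖D n‖) (fun _ _ => norm_nonneg _)
      (Finset.mem_range.mpr (Nat.mod_lt _ hN))
  refine ⟨κ, K + ‖κ‖, by positivity, fun t ht => ?_⟩
  have h1 : ∑ k ∈ Finset.Icc 0 ⌊t⌋₊, c k - κ * t =
      D (⌊t⌋₊ + 1) + κ * (((⌊t⌋₊ + 1 - t : ℝ)) : ℂ) := by
    have : Finset.Icc 0 ⌊t⌋₊ = Finset.range (⌊t⌋₊ + 1) := by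
      ext; simp
    simp only [hD, this]; push_cast; ring
  rw [h1]
  refine (norm_add_le _ _).trans (add_le_add (hDK _) ?_)
  rw [norm_mul, Complex.norm_real, Real.norm_eq_abs]
  refine mul_le_of_le_one_right (norm_nonneg _) ?_
  have := Nat.floor_le ht
  have := Nat.lt_floor_add_one t
  rw [abs_le]; constructor <;> linarith

end

section

open MeasureTheory Set Filter

theorem norm_tsum_le_of_abel {c : ℕ → ℂ} {κ : ℂ} {K : ℝ} (hc : ∀ n, ‖c n‖ ≤ 1)
    (hK : ∀ t : ℝ, 0 ≤ t → ‖∑ k ∈ Finset.Icc 0 ⌊t⌋₊, c k - κ * t‖ ≤ K)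
    {g g' G : ℝ → ℂ} (hg : ∀ t : ℝ, 0 < t → HasDerivAt g (g' t) t)
    (hG : ∀ t : ℝ, 0 < t → HasDerivAt G (g t) t)
    (hg' : ContinuousOn g' (Ioi 0)) {X : ℕ} (hX : 0 < X) {B₁ B₂ B₃ : ℝ}
    (h1 : ∀ᶠ n : ℕ in atTop, ‖G n‖ ≤ B₁) (h2 : ∀ᶠ n : ℕ in atTop, ‖g n‖ ≤ B₂)
    (h3 : ∀ n : ℕ, X ≤ n → ∫ t in (X : ℝ)..n, ‖g' t‖ ≤ B₃) {f : ℕ → ℂ} {S : ℂ}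
    (hf0 : f 0 = 0) (hf : ∀ n, n ≠ 0 → f n = g n * c n) (hS : HasSum f S) :
    ‖S‖ ≤ ∑ k ∈ Finset.Ioc 0 X, ‖g k‖ + ‖κ‖ * (B₁ + ‖G X‖) + K * (‖g X‖ + B₂ + B₃) := by
  have hK0 : 0 ≤ K := (norm_nonneg _).trans (hK 0 le_rfl)
  have hlim := hS.tendsto_sum_nat.comp (tendsto_add_atTop_nat 1)
  refine le_of_tendsto hlim.norm ?_
  filter_upwards [h1, h2, eventually_ge_atTop X] with n hn1 hn2 hn
  have hXn : (X : ℝ) ≤ n := by exact_mod_cast hn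
  have hX0 : (0 : ℝ) < X := by exact_mod_cast hX
  have hmem : ∀ t ∈ Icc (X : ℝ) n, 0 < t := fun t ht => hX0.trans_le ht.1
  have hA := norm_sum_mul_sub_integral_le hK hX0.le hXn (fun t ht => hg t (hmem t ht))
    (hg'.mono fun t ht => hmem t ht)
  have hu : uIcc (X : ℝ) n = Icc (X : ℝ) n := uIcc_of_le hXn
  have hgc : ContinuousOn g (uIcc (X : ℝ) n) := fun t ht =>
    (hg t (hmem t (hu ▸ ht))).continuousAt.continuousWithinAt
  have hI : ∫ t in (X : ℝ)..n, g t = G n - G X :=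
    intervalIntegral.integral_eq_sub_of_hasDerivAt (fun t ht => hG t (hmem t (hu ▸ ht)))
      hgc.intervalIntegrable
  rw [hI, Nat.floor_natCast, Nat.floor_natCast] at hA
  have hsplit : ∑ k ∈ Finset.range (n + 1), f k =
      ∑ k ∈ Finset.Ioc 0 X, g k * c k + ∑ k ∈ Finset.Ioc X n, g k * c k := by
    rw [Finset.sum_range_succ', hf0, add_zero]
    rw [← Finset.sum_union (Finset.disjoint_left.mpr fun a ha hb => by
      simp only [Finset.mem_Ioc] at ha hb; omega),
      Finset.Ioc_union_Ioc_eq_Ioc (Nat.zero_le _) hn]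
    rw [Finset.sum_congr rfl fun k (_ : k ∈ Finset.range n) => hf (k + 1) (Nat.succ_ne_zero _)]
    have : Finset.Ioc 0 n = (Finset.range n).map ⟨fun k => k + 1, fun a b h => by simpa using h⟩ := by
      ext k
      simp only [Finset.mem_Ioc, Finset.mem_map, Finset.mem_range]
      constructor
      · rintro ⟨h1, h2⟩; exact ⟨k - 1, by omega, show k - 1 + 1 = k by omega⟩
      · rintro ⟨a, ha, rfl⟩
        change 0 < a + 1 ∧ a + 1 ≤ n
        omega
    rw [this, Finset.sum_map]
    rfl
  simp only [Function.comp]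
  rw [hsplit]
  have hs1 : ‖∑ k ∈ Finset.Ioc 0 X, g k * c k‖ ≤ ∑ k ∈ Finset.Ioc 0 X, ‖g k‖ := by
    refine (norm_sum_le _ _).trans (Finset.sum_le_sum fun k _ => ?_)
    rw [norm_mul]; exact mul_le_of_le_one_right (norm_nonneg _) (hc k)
  have hs2 : ‖∑ k ∈ Finset.Ioc X n, g k * c k‖ ≤ ‖κ‖ * (B₁ + ‖G X‖) + K * (‖g X‖ + B₂ + B₃) := by
    have e : ∑ k ∈ Finset.Ioc X n, g k * c k =
      κ * (G n - G X) + (∑ k ∈ Finset.Ioc X n, g k * c k - κ * (G n - G X)) := by ring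
    rw [e]
    refine (norm_add_le _ _).trans (add_le_add ?_ (hA.trans ?_))
    · rw [norm_mul]
      exact mul_le_mul_of_nonneg_left ((norm_sub_le _ _).trans (by linarith)) (norm_nonneg _)
    · exact mul_le_mul_of_nonneg_left (by linarith [h3 n hn]) hK0
  linarith [norm_add_le (∑ k ∈ Finset.Ioc 0 X, g k * c k) (∑ k ∈ Finset.Ioc X n, g k * c k)]

theorem sum_Ioc_inv_le (X : ℕ) :
    ∑ k ∈ Finset.Ioc 0 X, ((k : ℝ))⁻¹ ≤ 1 + Real.log X := by
  have := harmonic_le_one_add_log X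
  rw [harmonic_eq_sum_Icc] at this
  push_cast at this
  convert this using 2
  ext; simp [Nat.lt_iff_add_one_le]

theorem hasDerivAt_cpow_neg (s : ℂ) {t : ℝ} (ht : 0 < t) :
    HasDerivAt (fun u : ℝ => (u : ℂ) ^ (-s)) (-s * (t : ℂ) ^ (-s - 1)) t := by
  have h1 : (t : ℂ) ∈ Complex.slitPlane := Complex.ofReal_mem_slitPlane.mpr ht
  exact ((hasDerivAt_id (t : ℂ)).cpow_const h1).comp_ofReal.congr_deriv (by simp)

theorem norm_natCast_cpow_le {s : ℂ} (hs : 1 < s.re) {n : ℝ} (hn : 1 ≤ n) :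
    ‖(n : ℂ) ^ (-s)‖ ≤ n⁻¹ := by
  rw [Complex.norm_cpow_eq_rpow_re_of_pos (by linarith), ← Real.rpow_neg_one]
  exact Real.rpow_le_rpow_of_exponent_le hn (by simp; linarith)

theorem norm_cpow_sub_one_le {s : ℂ} (hs : 1 < s.re) {t : ℝ} (ht : 1 ≤ t) :
    ‖(t : ℂ) ^ (-s - 1)‖ ≤ (t ^ 2)⁻¹ := by
  rw [Complex.norm_cpow_eq_rpow_re_of_pos (by linarith), ← Real.rpow_natCast,
    ← Real.rpow_neg (by linarith)]
  exact Real.rpow_le_rpow_of_exponent_le ht (by simp; linarith)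

theorem norm_cpow_one_sub_le {s : ℂ} (hs : 1 < s.re) {t : ℝ} (ht : 1 ≤ t) :
    ‖(t : ℂ) ^ (1 - s)‖ ≤ 1 := by
  rw [Complex.norm_cpow_eq_rpow_re_of_pos (by linarith)]
  exact Real.rpow_le_one_of_one_le_of_nonpos ht (by simp; linarith)

theorem hasDerivAt_cpow_one_sub_div {s : ℂ} (hs : 1 - s ≠ 0) {t : ℝ} (ht : 0 < t) :
    HasDerivAt (fun u : ℝ => (u : ℂ) ^ (1 - s) / (1 - s)) ((t : ℂ) ^ (-s)) t := by
  have h1 := (hasDerivAt_cpow_neg (s - 1) ht).div_const (1 - s)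
  rw [show -(s - 1) = 1 - s by ring, mul_div_assoc, mul_div_cancel₀ _ hs,
    show 1 - s - 1 = -s by ring] at h1
  exact h1

theorem continuousOn_ofReal_cpow (z : ℂ) : ContinuousOn (fun t : ℝ => (t : ℂ) ^ z) (Ioi 0) := by
  intro t ht
  have h1 : (t : ℂ) ∈ Complex.slitPlane := Complex.ofReal_mem_slitPlane.mpr ht
  exact ((continuousAt_cpow_const h1).comp Complex.continuous_ofReal.continuousAt).continuousWithinAt

/-- Bound for a Dirichlet series with coefficients of bounded discrepancy, split at `X`. -/
theorem norm_LSeries_le_of_abel_div {c : ℕ → ℂ} {κ : ℂ} {K : ℝ} (hc : ∀ n, ‖c n‖ ≤ 1)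
    (hK : ∀ t : ℝ, 0 ≤ t → ‖∑ k ∈ Finset.Icc 0 ⌊t⌋₊, c k - κ * t‖ ≤ K)
    {s : ℂ} (hs : 1 < s.re) {X : ℕ} (hX : 0 < X) :
    ‖LSeries c s‖ ≤ 1 + Real.log X + ‖κ‖ * (2 / ‖1 - s‖) + K * ((2 + ‖s‖) / X) := by
  have hK0 : 0 ≤ K := (norm_nonneg _).trans (hK 0 le_rfl)
  have hX1 : (1 : ℝ) ≤ X := by exact_mod_cast hX
  have hsum : LSeriesSummable c s :=
    LSeriesSummable_of_bounded_of_one_lt_re (m := 1) (fun n _ => hc n) hs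
  have hs1 : 1 - s ≠ 0 := by
    intro h
    have := congrArg Complex.re h
    simp at this; linarith
  have hGb : ∀ t : ℝ, 1 ≤ t → ‖(t : ℂ) ^ (1 - s) / (1 - s)‖ ≤ 1 / ‖1 - s‖ := fun t ht => by
    rw [norm_div]
    exact div_le_div_of_nonneg_right (norm_cpow_one_sub_le hs ht) (norm_nonneg _)
  have hinteg : ∀ n : ℕ, X ≤ n → ∫ t in (X : ℝ)..n, ‖-s * (t : ℂ) ^ (-s - 1)‖ ≤ ‖s‖ / X := by
    intro n hn
    have hXn : (X : ℝ) ≤ n := by exact_mod_cast hn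
    have hu : uIcc (X : ℝ) n = Icc (X : ℝ) n := uIcc_of_le hXn
    have hF : ∀ t ∈ uIcc (X : ℝ) n, HasDerivAt (fun t : ℝ => -‖s‖ * t⁻¹) (‖s‖ * (t ^ 2)⁻¹) t := by
      intro t ht
      have ht0 : t ≠ 0 := by rw [hu] at ht; linarith [ht.1]
      exact ((hasDerivAt_inv ht0).const_mul (-‖s‖)).congr_deriv (by ring)
    have hci : ContinuousOn (fun t : ℝ => ‖s‖ * (t ^ 2)⁻¹) (uIcc (X : ℝ) n) := by
      refine ContinuousOn.mul continuousOn_const (ContinuousOn.inv₀ (by fun_prop) ?_)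
      intro t ht
      have : 0 < t := by rw [hu] at ht; linarith [ht.1]
      positivity
    have hci' : ContinuousOn (fun t : ℝ => ‖-s * (t : ℂ) ^ (-s - 1)‖) (uIcc (X : ℝ) n) := by
      refine (continuousOn_const.mul ((continuousOn_ofReal_cpow (-s - 1)).mono ?_)).norm
      intro t ht
      rw [hu] at ht
      exact lt_of_lt_of_le (by linarith) ht.1
    calc _ ≤ ∫ t in (X : ℝ)..n, ‖s‖ * (t ^ 2)⁻¹ := by
          refine intervalIntegral.integral_mono_on hXn hci'.intervalIntegrable
            hci.intervalIntegrable fun t ht => ?_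
          rw [norm_mul, norm_neg]
          exact mul_le_mul_of_nonneg_left (norm_cpow_sub_one_le hs (hX1.trans ht.1))
            (norm_nonneg _)
      _ = -‖s‖ * (n : ℝ)⁻¹ - -‖s‖ * (X : ℝ)⁻¹ :=
          intervalIntegral.integral_eq_sub_of_hasDerivAt hF hci.intervalIntegrable
      _ ≤ _ := by
          have : 0 ≤ ‖s‖ * (n : ℝ)⁻¹ := by positivity
          rw [div_eq_mul_inv]; linarith
  have hterm : ∀ n, n ≠ 0 → LSeries.term c s n = ((n : ℝ) : ℂ) ^ (-s) * c n := fun n hn => by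
    rw [LSeries.term_of_ne_zero hn, Complex.cpow_neg, Complex.ofReal_natCast]; field_simp
  have hcg : ContinuousOn (fun t : ℝ => -s * (t : ℂ) ^ (-s - 1)) (Ioi 0) :=
    continuousOn_const.mul (continuousOn_ofReal_cpow _)
  have := norm_tsum_le_of_abel hc hK (fun t ht => hasDerivAt_cpow_neg s ht)
    (fun t ht => hasDerivAt_cpow_one_sub_div hs1 ht) hcg hX (B₁ := 1 / ‖1 - s‖) (B₂ := (X : ℝ)⁻¹)
    (B₃ := ‖s‖ / X)
    ((eventually_ge_atTop 1).mono fun n hn => hGb n (by exact_mod_cast hn))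
    ((eventually_ge_atTop X).mono fun n hn =>
      (norm_natCast_cpow_le hs (by exact_mod_cast hX.trans_le hn)).trans
        (inv_anti₀ (by linarith) (by exact_mod_cast hn))) hinteg (LSeries.term_zero c s) hterm hsum.LSeriesHasSum
  refine this.trans (add_le_add (add_le_add ?_ ?_) ?_)
  · refine (Finset.sum_le_sum fun k hk => ?_).trans (sum_Ioc_inv_le X)
    exact norm_natCast_cpow_le hs (by exact_mod_cast (Finset.mem_Ioc.mp hk).1)
  · refine mul_le_mul_of_nonneg_left ?_ (norm_nonneg _)
    have := hGb X hX1
    rw [show 2 / ‖1 - s‖ = 1 / ‖1 - s‖ + 1 / ‖1 - s‖ by ring]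
    linarith
  · refine mul_le_mul_of_nonneg_left ?_ hK0
    have := norm_natCast_cpow_le hs hX1
    rw [add_div, div_eq_mul_inv (2 : ℝ)]
    linarith

theorem norm_LSeries_le_of_abel {c : ℕ → ℂ} {κ : ℂ} {K : ℝ} (hc : ∀ n, ‖c n‖ ≤ 1)
    (hK : ∀ t : ℝ, 0 ≤ t → ‖∑ k ∈ Finset.Icc 0 ⌊t⌋₊, c k - κ * t‖ ≤ K)
    {s : ℂ} (hs : 1 < s.re) {X : ℕ} (hX : 0 < X) :
    ‖LSeries c s‖ ≤ 1 + Real.log X + ‖κ‖ * (2 / ‖1 - s‖) + K * (2 + ‖s‖ / X) := by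
  have hK0 : 0 ≤ K := (norm_nonneg _).trans (hK 0 le_rfl)
  refine (norm_LSeries_le_of_abel_div hc hK hs hX).trans ?_
  gcongr
  rw [add_div]
  gcongr
  exact div_le_self zero_le_two (by exact_mod_cast hX)

end

section

open MeasureTheory Set Filter

theorem hasDerivAt_log_mul_cpow (s : ℂ) {t : ℝ} (ht : 0 < t) :
    HasDerivAt (fun u : ℝ => (Real.log u : ℂ) * (u : ℂ) ^ (-s))
      ((t : ℂ) ^ (-s - 1) * (1 - s * Real.log t)) t := by
  have h1 := (Real.hasDerivAt_log ht.ne').ofReal_comp.mul (hasDerivAt_cpow_neg s ht)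
  refine h1.congr_deriv ?_
  have h0 : (t : ℂ) ≠ 0 := by exact_mod_cast ht.ne'
  have : (t : ℂ) ^ (-s) = (t : ℂ) ^ (-s - 1) * t := by
    rw [Complex.cpow_sub _ _ h0, Complex.cpow_one]; field_simp
  rw [this]; push_cast; field_simp; ring

theorem hasDerivAt_log_mul_cpow_primitive {s : ℂ} (hs : 1 - s ≠ 0) {t : ℝ} (ht : 0 < t) :
    HasDerivAt (fun u : ℝ => (u : ℂ) ^ (1 - s) / (1 - s) * (Real.log u - 1 / (1 - s)))
      ((Real.log t : ℂ) * (t : ℂ) ^ (-s)) t := by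
  have h1 := (hasDerivAt_cpow_one_sub_div hs ht).mul
    ((Real.hasDerivAt_log ht.ne').ofReal_comp.sub_const (1 / (1 - s)))
  refine h1.congr_deriv ?_
  have h0 : (t : ℂ) ≠ 0 := by exact_mod_cast ht.ne'
  have : (t : ℂ) ^ (1 - s) = (t : ℂ) ^ (-s) * t := by
    rw [show 1 - s = -s + 1 by ring, Complex.cpow_add _ _ h0, Complex.cpow_one]
  rw [this]; push_cast; field_simp; ring

theorem norm_LSeries_logMul_le_of_abel {c : ℕ → ℂ} {κ : ℂ} {K : ℝ} (hc : ∀ n, ‖c n‖ ≤ 1)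
    (hK : ∀ t : ℝ, 0 ≤ t → ‖∑ k ∈ Finset.Icc 0 ⌊t⌋₊, c k - κ * t‖ ≤ K)
    {s : ℂ} (hs : 1 < s.re) (hs' : 1 ≤ ‖1 - s‖) {X : ℕ} (hX : 0 < X) :
    ‖LSeries (LSeries.logMul c) s‖ ≤ Real.log X * (1 + Real.log X) + ‖κ‖ * (Real.log X + 3) +
      K * (Real.log X + 1 + (1 + ‖s‖ * (Real.log X + 1)) / X) := by
  have hK0 : 0 ≤ K := (norm_nonneg _).trans (hK 0 le_rfl)
  have hX1 : (1 : ℝ) ≤ X := by exact_mod_cast hX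
  have hX0 : (0 : ℝ) < X := by linarith
  have hL0 : 0 ≤ Real.log X := Real.log_nonneg hX1
  have hsum : LSeriesSummable (LSeries.logMul c) s := by
    refine LSeriesSummable_logMul_of_lt_re ?_
    refine lt_of_le_of_lt (LSeries.abscissaOfAbsConv_le_of_forall_lt_LSeriesSummable (x := 1)
      fun y hy => LSeriesSummable_of_bounded_of_one_lt_re (m := 1) (fun n _ => hc n)
        (by simpa using hy)) (by exact_mod_cast hs)
  have hs1 : 1 - s ≠ 0 := norm_pos_iff.mp (by linarith)
  have hGb : ∀ t : ℝ, 1 ≤ t → ‖(t : ℂ) ^ (1 - s) / (1 - s) * (Real.log t - 1 / (1 - s))‖ ≤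
      t ^ (1 - s.re) * Real.log t + 1 := fun t ht => by
    have e1 : ‖(t : ℂ) ^ (1 - s)‖ = t ^ (1 - s.re) := by
      rw [Complex.norm_cpow_eq_rpow_re_of_pos (by linarith)]; simp
    have e2 : ‖(t : ℂ) ^ (1 - s)‖ ≤ 1 := norm_cpow_one_sub_le hs ht
    have e3 : ‖((Real.log t : ℂ) - 1 / (1 - s))‖ ≤ Real.log t + 1 := by
      refine (norm_sub_le _ _).trans (add_le_add ?_ ?_)
      · rw [Complex.norm_real, Real.norm_of_nonneg (Real.log_nonneg ht)]
      · rw [norm_div, norm_one]; exact div_le_one_of_le₀ hs' (norm_nonneg _)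
    rw [norm_mul, norm_div]
    calc _ ≤ ‖(t : ℂ) ^ (1 - s)‖ * (Real.log t + 1) :=
          mul_le_mul (div_le_self (norm_nonneg _) hs') e3 (norm_nonneg _) (norm_nonneg _)
      _ ≤ _ := by rw [mul_add, e1, mul_one]; rw [e1] at e2; linarith
  have hlim : Tendsto (fun t : ℝ => t ^ (1 - s.re) * Real.log t) atTop (nhds 0) := by
    have h := (isLittleO_log_rpow_atTop (r := s.re - 1) (by linarith)).tendsto_div_nhds_zero
    refine h.congr' ?_
    filter_upwards [eventually_gt_atTop 0] with t ht
    rw [show 1 - s.re = -(s.re - 1) by ring, Real.rpow_neg ht.le]; field_simp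
  have hG : ∀ᶠ n : ℕ in atTop,
      ‖((n : ℝ) : ℂ) ^ (1 - s) / (1 - s) * (Real.log (n : ℝ) - 1 / (1 - s))‖ ≤ 2 := by
    have := (hlim.comp tendsto_natCast_atTop_atTop).eventually (Iic_mem_nhds (zero_lt_one (α := ℝ)))
    filter_upwards [this, eventually_ge_atTop 1] with n hn hn1
    have hn : (n : ℝ) ^ (1 - s.re) * Real.log (n : ℝ) ≤ 1 := hn
    linarith [hGb n (by exact_mod_cast hn1)]
  have hinteg : ∀ n : ℕ, X ≤ n →
      ∫ t in (X : ℝ)..n, ‖(t : ℂ) ^ (-s - 1) * (1 - s * Real.log t)‖ ≤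
        (1 + ‖s‖ * (Real.log X + 1)) / X := by
    intro n hn
    have hXn : (X : ℝ) ≤ n := by exact_mod_cast hn
    have hu : uIcc (X : ℝ) n = Icc (X : ℝ) n := uIcc_of_le hXn
    have hpos : ∀ t ∈ uIcc (X : ℝ) n, 0 < t := by
      intro t ht
      rw [hu] at ht; linarith [ht.1]
    have hF : ∀ t ∈ uIcc (X : ℝ) n,
        HasDerivAt (fun t : ℝ => -(t⁻¹ * (1 + ‖s‖ * (Real.log t + 1))))
          ((t ^ 2)⁻¹ * (1 + ‖s‖ * Real.log t)) t := by
      intro t ht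
      have ht0 : t ≠ 0 := (hpos t ht).ne'
      refine ((hasDerivAt_inv ht0).mul ((((Real.hasDerivAt_log ht0).add_const 1).const_mul
        ‖s‖).const_add 1)).neg.congr_deriv ?_
      field_simp; ring
    have hlogc : ContinuousOn Real.log (uIcc (X : ℝ) n) :=
      Real.continuousOn_log.mono fun t ht => (hpos t ht).ne'
    have hci : ContinuousOn (fun t : ℝ => (t ^ 2)⁻¹ * (1 + ‖s‖ * Real.log t)) (uIcc (X : ℝ) n) := by
      refine ContinuousOn.mul (ContinuousOn.inv₀ (by fun_prop) ?_) (by fun_prop)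
      intro t ht
      have := hpos t ht
      positivity
    have hci' : ContinuousOn (fun t : ℝ => ‖(t : ℂ) ^ (-s - 1) * (1 - s * Real.log t)‖)
        (uIcc (X : ℝ) n) := by
      refine (((continuousOn_ofReal_cpow (-s - 1)).mono fun t ht => hpos t ht).mul ?_).norm
      fun_prop
    calc _ ≤ ∫ t in (X : ℝ)..n, (t ^ 2)⁻¹ * (1 + ‖s‖ * Real.log t) := by
          refine intervalIntegral.integral_mono_on hXn hci'.intervalIntegrable
            hci.intervalIntegrable fun t ht => ?_
          have ht1 : 1 ≤ t := hX1.trans ht.1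
          rw [norm_mul]
          refine mul_le_mul (norm_cpow_sub_one_le hs ht1) ((norm_sub_le _ _).trans ?_)
            (norm_nonneg _) (by positivity)
          rw [norm_one, norm_mul, Complex.norm_real, Real.norm_of_nonneg (Real.log_nonneg ht1)]
      _ = -((n : ℝ)⁻¹ * (1 + ‖s‖ * (Real.log n + 1))) -
            -((X : ℝ)⁻¹ * (1 + ‖s‖ * (Real.log X + 1))) :=
          intervalIntegral.integral_eq_sub_of_hasDerivAt hF hci.intervalIntegrable
      _ ≤ _ := by
          have hn1 : 0 ≤ Real.log n := Real.log_natCast_nonneg n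
          have : 0 ≤ (n : ℝ)⁻¹ * (1 + ‖s‖ * (Real.log n + 1)) := by positivity
          rw [div_eq_inv_mul]; linarith
  have hterm : ∀ n, n ≠ 0 → LSeries.term (LSeries.logMul c) s n =
      ((Real.log (n : ℝ) : ℂ) * ((n : ℝ) : ℂ) ^ (-s)) * c n := fun n hn => by
    rw [LSeries.term_of_ne_zero hn, Complex.cpow_neg, Complex.ofReal_natCast, LSeries.logMul,
      ← Complex.natCast_log]
    field_simp
  have hlogc : ContinuousOn Real.log (Ioi 0) :=
    Real.continuousOn_log.mono fun t ht => (ne_of_gt ht)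
  have hcg : ContinuousOn (fun t : ℝ => (t : ℂ) ^ (-s - 1) * (1 - s * Real.log t)) (Ioi 0) :=
    (continuousOn_ofReal_cpow _).mul (by fun_prop)
  have hgn : ∀ n : ℝ, 1 ≤ n → ‖(Real.log n : ℂ) * (n : ℂ) ^ (-s)‖ ≤ Real.log n * n⁻¹ := by
    intro n hn
    rw [norm_mul, Complex.norm_real, Real.norm_of_nonneg (Real.log_nonneg hn)]
    exact mul_le_mul_of_nonneg_left (norm_natCast_cpow_le hs hn) (Real.log_nonneg hn)
  have hlog1 : ∀ n : ℝ, 1 ≤ n → Real.log n * n⁻¹ ≤ 1 := by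
    intro n hn
    rw [← div_eq_mul_inv]
    exact div_le_one_of_le₀ ((Real.log_le_sub_one_of_pos (by linarith)).trans (by linarith))
      (by linarith)
  have := norm_tsum_le_of_abel hc hK (fun t ht => hasDerivAt_log_mul_cpow s ht)
    (fun t ht => hasDerivAt_log_mul_cpow_primitive hs1 ht) hcg hX (B₁ := 2) (B₂ := 1)
    (B₃ := (1 + ‖s‖ * (Real.log X + 1)) / X) hG
    ((eventually_ge_atTop 1).mono fun n hn =>
      (hgn n (by exact_mod_cast hn)).trans (hlog1 n (by exact_mod_cast hn)))
    hinteg (LSeries.term_zero _ s) hterm hsum.LSeriesHasSum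
  refine this.trans (add_le_add (add_le_add ?_ ?_) ?_)
  · refine (Finset.sum_le_sum (g := fun k : ℕ => Real.log X * (k : ℝ)⁻¹) fun k hk => ?_).trans ?_
    · have hk := Finset.mem_Ioc.mp hk
      have hk1 : (1 : ℝ) ≤ k := by exact_mod_cast hk.1
      refine (hgn k hk1).trans (mul_le_mul_of_nonneg_right ?_ (by positivity))
      exact Real.log_le_log (by linarith) (by exact_mod_cast hk.2)
    · rw [← Finset.mul_sum]
      exact mul_le_mul_of_nonneg_left (sum_Ioc_inv_le X) hL0
  · refine mul_le_mul_of_nonneg_left ?_ (norm_nonneg _)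
    have h1 := hGb X hX1
    have h2 : (X : ℝ) ^ (1 - s.re) ≤ 1 :=
      Real.rpow_le_one_of_one_le_of_nonpos hX1 (by linarith)
    nlinarith
  · refine mul_le_mul_of_nonneg_left ?_ hK0
    have h1 := hgn X hX1
    have h2 : Real.log X * (X : ℝ)⁻¹ ≤ Real.log X :=
      mul_le_of_le_one_right hL0 (inv_le_one_of_one_le₀ hX1)
    linarith

/-- Growth of a Dirichlet series with coefficients of bounded discrepancy. -/
theorem exists_LSeries_growth_bound {c : ℕ → ℂ} {κ : ℂ} {K : ℝ} (hc : ∀ n, ‖c n‖ ≤ 1)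
    (hK : ∀ t : ℝ, 0 ≤ t → ‖∑ k ∈ Finset.Icc 0 ⌊t⌋₊, c k - κ * t‖ ≤ K) :
    ∃ C : ℝ, 1 ≤ C ∧ ∀ s : ℂ, 1 < s.re → s.re ≤ 2 → 1 ≤ |s.im| →
      ‖LSeries c s‖ ≤ C * |s.im| ^ (1 / 12 : ℝ) ∧
      ‖LSeries (LSeries.logMul c) s‖ ≤ C * |s.im| ^ (1 / 12 : ℝ) := by
  have hK0 : 0 ≤ K := (norm_nonneg _).trans (hK 0 le_rfl)
  refine ⟨676 * (1 + 3 * ‖κ‖ + 5 * K), by nlinarith [norm_nonneg κ], fun s hs hs2 ht => ?_⟩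
  set X : ℕ := ⌈|s.im|⌉₊ with hXd
  have hX : 0 < X := Nat.ceil_pos.mpr (by linarith)
  have hXt : |s.im| ≤ X := Nat.le_ceil _
  have hXt' : (X : ℝ) ≤ 2 * |s.im| := by
    have := Nat.ceil_lt_add_one (abs_nonneg s.im)
    linarith
  have hX1 : (1 : ℝ) ≤ X := by linarith
  have hX0 : (0 : ℝ) < X := by linarith
  set l := 1 + Real.log X with hl
  have hl1 : 1 ≤ l := by linarith [Real.log_nonneg hX1]
  have hp : 1 ≤ |s.im| ^ (1 / 24 : ℝ) := Real.one_le_rpow ht (by norm_num)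
  have hlt : l ≤ 26 * |s.im| ^ (1 / 24 : ℝ) := by
    have h1 : Real.log X ≤ Real.log 2 + Real.log |s.im| := by
      rw [← Real.log_mul (by norm_num) (by linarith)]
      exact Real.log_le_log hX0 hXt'
    have h2 := Real.log_le_rpow_div (abs_nonneg s.im) (show (0 : ℝ) < 1 / 24 by norm_num)
    have h3 : Real.log 2 ≤ 1 := by linarith [Real.log_two_lt_d9]
    rw [hl]
    have : |s.im| ^ (1 / 24 : ℝ) / (1 / 24) = 24 * |s.im| ^ (1 / 24 : ℝ) := by ring
    linarith
  have hl2 : l ^ 2 ≤ 676 * |s.im| ^ (1 / 12 : ℝ) := by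
    calc l ^ 2 ≤ (26 * |s.im| ^ (1 / 24 : ℝ)) ^ 2 := pow_le_pow_left₀ (by linarith) hlt 2
      _ = 676 * (|s.im| ^ (1 / 24 : ℝ)) ^ 2 := by ring
      _ = _ := by rw [← Real.rpow_natCast, ← Real.rpow_mul (abs_nonneg _)]; norm_num
  have hns : ‖s‖ ≤ 3 * X := by
    have := Complex.norm_le_abs_re_add_abs_im s
    rw [abs_of_pos (by linarith : 0 < s.re)] at this
    linarith
  have hs' : 1 ≤ ‖1 - s‖ := by
    have := Complex.abs_im_le_norm (1 - s)
    simp only [Complex.sub_im, Complex.one_im, zero_sub, abs_neg] at this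
    linarith
  have hll : l ≤ l ^ 2 := by nlinarith
  have hκ := norm_nonneg κ
  have key : (1 + 3 * ‖κ‖ + 5 * K) * l ^ 2 ≤
      676 * (1 + 3 * ‖κ‖ + 5 * K) * |s.im| ^ (1 / 12 : ℝ) := by
    calc _ ≤ (1 + 3 * ‖κ‖ + 5 * K) * (676 * |s.im| ^ (1 / 12 : ℝ)) :=
          mul_le_mul_of_nonneg_left hl2 (by positivity)
      _ = _ := by ring
  constructor
  · refine (norm_LSeries_le_of_abel hc hK hs hX).trans (le_trans ?_ key)
    have h1 : 2 / ‖1 - s‖ ≤ 2 := div_le_self (by norm_num) hs'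
    have h2 : ‖s‖ / X ≤ 3 := by rw [div_le_iff₀ hX0]; exact hns
    have h3 : ‖κ‖ * (2 / ‖1 - s‖) ≤ ‖κ‖ * (3 * l ^ 2) :=
      mul_le_mul_of_nonneg_left (by nlinarith) hκ
    have h4 : K * (2 + ‖s‖ / X) ≤ K * (5 * l ^ 2) := mul_le_mul_of_nonneg_left (by nlinarith) hK0
    nlinarith
  · refine (norm_LSeries_logMul_le_of_abel hc hK hs hs' hX).trans (le_trans ?_ key)
    have e : Real.log X = l - 1 := by rw [hl]; ring
    have h2 : (1 + ‖s‖ * (Real.log X + 1)) / X ≤ 1 + 3 * l := by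
      rw [div_le_iff₀ hX0, e]
      nlinarith
    rw [e] at h2 ⊢
    have h3 : ‖κ‖ * (l - 1 + 3) ≤ ‖κ‖ * (3 * l ^ 2) := mul_le_mul_of_nonneg_left (by nlinarith) hκ
    have h4 : K * (l - 1 + 1 + (1 + ‖s‖ * (l - 1 + 1)) / X) ≤ K * (5 * l ^ 2) :=
      mul_le_mul_of_nonneg_left (by nlinarith) hK0
    nlinarith

end

section

open MeasureTheory Set Filter DirichletCharacter

theorem DirichletCharacter.exists_sum_bound {N : ℕ} [NeZero N] (χ : DirichletCharacter ℂ N) :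
    ∃ (κ : ℂ) (K : ℝ), 0 ≤ K ∧
      ∀ t : ℝ, 0 ≤ t → ‖∑ k ∈ Finset.Icc 0 ⌊t⌋₊, χ (k : ZMod N) - κ * t‖ ≤ K :=
  exists_periodic_sum_bound (NeZero.pos N) (c := fun k : ℕ => χ (k : ZMod N))
    fun k => by simp

theorem DirichletCharacter.deriv_LFunction_eq {N : ℕ} [NeZero N] (χ : DirichletCharacter ℂ N)
    {s : ℂ} (hs : 1 < s.re) :
    deriv (LFunction χ) s = -LSeries (LSeries.logMul (fun k : ℕ => χ (k : ZMod N))) s := by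
  have h1 : LFunction χ =ᶠ[nhds s] LSeries (fun k : ℕ => χ (k : ZMod N)) := by
    filter_upwards [(isOpen_lt continuous_const Complex.continuous_re).mem_nhds hs] with z hz
    exact LFunction_eq_LSeries χ hz
  rw [h1.deriv_eq]
  refine LSeries_deriv ?_
  rw [absicssaOfAbsConv_eq_one (NeZero.ne N)]
  exact_mod_cast hs

theorem DirichletCharacter.exists_LFunction_growth_bound {N : ℕ} [NeZero N]
    (χ : DirichletCharacter ℂ N) :
    ∃ C : ℝ, 1 ≤ C ∧ ∀ s : ℂ, 1 < s.re → s.re ≤ 2 → 1 ≤ |s.im| →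
      ‖LFunction χ s‖ ≤ C * |s.im| ^ (1 / 12 : ℝ) ∧
      ‖deriv (LFunction χ) s‖ ≤ C * |s.im| ^ (1 / 12 : ℝ) := by
  obtain ⟨κ, K, hK0, hK⟩ := χ.exists_sum_bound
  obtain ⟨C, hC, h⟩ := exists_LSeries_growth_bound (fun n => χ.norm_le_one _) hK
  refine ⟨C, hC, fun s hs hs2 ht => ?_⟩
  rw [χ.deriv_LFunction_eq hs, norm_neg, LFunction_eq_LSeries χ hs]
  exact h s hs hs2 ht

theorem DirichletCharacter.exists_LFunction_real_bound {N : ℕ} [NeZero N]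
    (χ : DirichletCharacter ℂ N) :
    ∃ D : ℝ, 1 ≤ D ∧ ∀ x : ℝ, 0 < x → x ≤ 1 → ‖LFunction χ (1 + x)‖ ≤ D / x := by
  obtain ⟨κ, K, hK0, hK⟩ := χ.exists_sum_bound
  refine ⟨1 + 2 * ‖κ‖ + 4 * K, by nlinarith [norm_nonneg κ], fun x hx hx1 => ?_⟩
  have hs : 1 < (1 + x : ℂ).re := by simpa using hx
  have h := norm_LSeries_le_of_abel (fun n => χ.norm_le_one _) hK hs one_pos
  rw [LFunction_eq_LSeries χ hs]
  refine h.trans ?_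
  have e1 : ‖(1 : ℂ) - (1 + x)‖ = x := by
    rw [show (1 : ℂ) - (1 + x) = ((-x : ℝ) : ℂ) by push_cast; ring, Complex.norm_real]
    simp [abs_of_pos hx]
  have e2 : ‖(1 + x : ℂ)‖ ≤ 2 := by
    rw [show (1 + x : ℂ) = ((1 + x : ℝ) : ℂ) by push_cast; ring, Complex.norm_real,
      Real.norm_of_nonneg (by linarith)]
    linarith
  rw [e1, le_div_iff₀ hx]
  simp only [Nat.cast_one, Real.log_one, add_zero, div_one]
  have h1 : (1 + ‖κ‖ * (2 / x) + K * (2 + ‖(1 + x : ℂ)‖)) * x =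
    x + 2 * ‖κ‖ + (K * (2 + ‖(1 + x : ℂ)‖)) * x := by field_simp
  rw [h1]
  have h2 : (K * (2 + ‖(1 + x : ℂ)‖)) ≤ 4 * K := by nlinarith
  have h3 : (K * (2 + ‖(1 + x : ℂ)‖)) * x ≤ 4 * K := by
    refine (mul_le_of_le_one_right (by positivity) hx1).trans h2
  linarith

/-- A zero-free estimate to the right of the line `re s = 1`, from the 3-4-1 inequality. -/
theorem DirichletCharacter.exists_LFunction_lower_bound {N : ℕ} [NeZero N]
    (χ : DirichletCharacter ℂ N) :
    ∃ c : ℝ, 0 < c ∧ ∀ s : ℂ, 1 < s.re → s.re ≤ 2 → 1 ≤ |s.im| →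
      c ≤ ‖LFunction χ s‖ * |s.im| ^ (1 / 3 : ℝ) := by
  obtain ⟨C, hC, hb⟩ := χ.exists_LFunction_growth_bound
  obtain ⟨C₂, hC₂, hb₂⟩ := (χ ^ 2).exists_LFunction_growth_bound
  obtain ⟨D, hD, hbD⟩ := (1 : DirichletCharacter ℂ N).exists_LFunction_real_bound
  set A := C + 2 * C₂ + D with hA
  have hA1 : 1 ≤ A := by linarith
  set η := 1 / (16 * A ^ 3) with hη
  have hη0 : 0 < η := by positivity
  have hη1 : η ≤ 1 := by
    rw [hη, div_le_one (by positivity)]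
    have := one_le_pow₀ hA1 (n := 3)
    linarith
  refine ⟨η / A ^ 4, by positivity, fun s hs hs2 ht => ?_⟩
  set t := s.im with htd
  set b := |t| ^ (1 / 12 : ℝ) with hbd
  have hb1 : 1 ≤ b := Real.one_le_rpow ht (by norm_num)
  have hb4 : |t| ^ (1 / 3 : ℝ) = b ^ 4 := by
    rw [hbd, ← Real.rpow_natCast, ← Real.rpow_mul (abs_nonneg _)]; norm_num
  set B := A * b with hB
  have hB1 : 1 ≤ B := by nlinarith
  have hB0 : 0 < B := by linarith
  have h341 : ∀ x : ℝ, 0 < x → x ≤ 1 →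
      x ^ 3 ≤ A ^ 3 * B * ‖LFunction χ (1 + x + Complex.I * t)‖ ^ 4 := by
    intro x hx hx1
    have h := χ.norm_LFunction_product_ge_one hx t
    rw [norm_mul, norm_mul, norm_pow, norm_pow] at h
    have h1 : ‖LFunctionTrivChar N (1 + x)‖ ≤ A / x :=
      (hbD x hx hx1).trans (div_le_div_of_nonneg_right (by linarith) hx.le)
    have h2 : ‖LFunction (χ ^ 2) (1 + x + 2 * Complex.I * t)‖ ≤ B := by
      have h3 := (hb₂ (1 + x + 2 * Complex.I * t) (by simpa using hx)
        (by simp; linarith) (by simp [abs_mul]; linarith)).1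
      refine h3.trans ?_
      have e : (1 + x + 2 * Complex.I * t : ℂ).im = 2 * t := by simp
      rw [e, abs_mul, Real.mul_rpow (by norm_num) (abs_nonneg _)]
      have h4 : |(2 : ℝ)| ^ (1 / 12 : ℝ) ≤ 2 := by
        rw [abs_of_pos (by norm_num)]
        exact Real.rpow_le_self_of_one_le (by norm_num) (by norm_num)
      calc C₂ * (|(2 : ℝ)| ^ (1 / 12 : ℝ) * |t| ^ (1 / 12 : ℝ)) ≤ C₂ * (2 * b) := by gcongr
        _ ≤ B := by rw [hB]; nlinarith
    have h5 : 1 ≤ (A / x) ^ 3 * ‖LFunction χ (1 + x + Complex.I * t)‖ ^ 4 * B := by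
      refine h.trans ?_
      gcongr
    rw [div_pow] at h5
    have hx3 : 0 < x ^ 3 := by positivity
    calc x ^ 3 = x ^ 3 * 1 := by ring
      _ ≤ x ^ 3 * (A ^ 3 / x ^ 3 * ‖LFunction χ (1 + x + Complex.I * t)‖ ^ 4 * B) :=
          mul_le_mul_of_nonneg_left h5 hx3.le
      _ = _ := by field_simp
  set δ := η / B ^ 5 with hδ
  have hδ0 : 0 < δ := by positivity
  have hδ1 : δ ≤ 1 := by
    rw [hδ, div_le_one (by positivity)]
    exact hη1.trans (one_le_pow₀ hB1)
  have hfar : ∀ x : ℝ, δ ≤ x → x ≤ 1 →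
      2 * η / B ^ 4 ≤ ‖LFunction χ (1 + x + Complex.I * t)‖ := by
    intro x hx hx1
    have h := h341 x (hδ0.trans_le hx) hx1
    have h1 : δ ^ 3 ≤ A ^ 3 * B * ‖LFunction χ (1 + x + Complex.I * t)‖ ^ 4 :=
      (pow_le_pow_left₀ hδ0.le hx 3).trans h
    refine le_of_pow_le_pow_left₀ (n := 4) (by norm_num) (norm_nonneg _) ?_
    have h2 : A ^ 3 * B * (2 * η / B ^ 4) ^ 4 = δ ^ 3 := by
      have : A ^ 3 * (16 * η) = 1 := by rw [hη]; field_simp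
      calc A ^ 3 * B * (2 * η / B ^ 4) ^ 4 = (A ^ 3 * (16 * η)) * (η ^ 3 * (B / B ^ 16)) := by
            field_simp; ring
        _ = δ ^ 3 := by rw [this, hδ]; field_simp
    rw [← h2] at h1
    exact le_of_mul_le_mul_left h1 (by positivity)
  have hmain : η / B ^ 4 ≤ ‖LFunction χ s‖ := by
    have hse : s = 1 + ((s.re - 1 : ℝ) : ℂ) + Complex.I * t := by
      apply Complex.ext <;> simp [htd]
    rcases le_total δ (s.re - 1) with hx | hx
    · have := hfar (s.re - 1) hx (by linarith)
      rw [← hse] at this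
      refine le_trans ?_ this
      gcongr; linarith
    · have h1 := hfar δ le_rfl hδ1
      set w : ℂ := 1 + δ + Complex.I * t with hw
      have hwre : w.re = 1 + δ := by simp [hw]
      have hwim : w.im = t := by simp [hw]
      have hconv : Convex ℝ ({z : ℂ | 1 < z.re} ∩ {z : ℂ | z.re ≤ 2} ∩
          ({z : ℂ | z.im ≤ t} ∩ {z : ℂ | t ≤ z.im})) :=
        ((convex_halfSpace_re_gt 1).inter (convex_halfSpace_re_le 2)).inter
          ((convex_halfSpace_im_le t).inter (convex_halfSpace_im_ge t))
      have h2 := hconv.norm_image_sub_le_of_norm_deriv_le (f := LFunction χ) (C := B)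
        (x := s) (y := w) (𝕜 := ℂ) (fun z hz => by
          refine differentiableAt_LFunction χ z (Or.inl ?_)
          rintro rfl
          exact absurd hz.1.1 (by simp)) (fun z hz => by
          have him : z.im = t := le_antisymm hz.2.1 hz.2.2
          have := (hb z hz.1.1 hz.1.2 (by rw [him]; exact ht)).2
          rw [him] at this
          refine this.trans ?_
          rw [hB]; gcongr; linarith)
        ⟨⟨hs, hs2⟩, le_refl s.im, le_refl s.im⟩
        ⟨⟨by rw [Set.mem_ofPred_eq, hwre]; linarith, by rw [Set.mem_ofPred_eq, hwre]; linarith⟩,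
          hwim.le, hwim.ge⟩
      have h3 : ‖w - s‖ ≤ δ := by
        have : w - s = ((1 + δ - s.re : ℝ) : ℂ) := by
          apply Complex.ext <;> simp [hw, htd]
        rw [this, Complex.norm_real, Real.norm_of_nonneg (by linarith)]
        linarith
      have h4 : B * ‖w - s‖ ≤ η / B ^ 4 := by
        calc B * ‖w - s‖ ≤ B * δ := by gcongr
          _ = _ := by rw [hδ]; field_simp
      have h5 : 2 * η / B ^ 4 = η / B ^ 4 + η / B ^ 4 := by ring
      have h6 := norm_sub_norm_le (LFunction χ w) (LFunction χ s)
      linarith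
  rw [hb4]
  have e : η / A ^ 4 = η / B ^ 4 * b ^ 4 := by
    rw [hB]; field_simp
  rw [e]
  gcongr

end

section

open MeasureTheory Set Filter DirichletCharacter

/-- The positive integers all of whose prime factors satisfy `P`. -/
def primeSet (P : ℕ → Prop) : Set ℕ := {n | n ≠ 0 ∧ ∀ p, p.Prime → p ∣ n → P p}

theorem mem_primeSet {P : ℕ → Prop} {n : ℕ} :
    n ∈ primeSet P ↔ n ≠ 0 ∧ ∀ p, p.Prime → p ∣ n → P p := Iff.rfl

theorem mul_mem_primeSet {P : ℕ → Prop} {m n : ℕ} :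
    m * n ∈ primeSet P ↔ m ∈ primeSet P ∧ n ∈ primeSet P := by
  simp only [mem_primeSet, mul_ne_zero_iff]
  constructor
  · rintro ⟨⟨hm, hn⟩, h⟩
    exact ⟨⟨hm, fun p hp hd => h p hp (hd.mul_right n)⟩, hn, fun p hp hd => h p hp (hd.mul_left m)⟩
  · rintro ⟨⟨hm, h1⟩, hn, h2⟩
    exact ⟨⟨hm, hn⟩, fun p hp hd => (hp.dvd_mul.mp hd).elim (h1 p hp) (h2 p hp)⟩

theorem one_mem_primeSet (P : ℕ → Prop) : 1 ∈ primeSet P :=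
  ⟨one_ne_zero, fun _ hp h => absurd (Nat.dvd_one.mp h) hp.one_lt.ne'⟩

theorem zero_notMem_primeSet (P : ℕ → Prop) : 0 ∉ primeSet P := fun h => h.1 rfl

theorem Nat.Prime.mem_primeSet {P : ℕ → Prop} {p : ℕ} (hp : p.Prime) : p ∈ primeSet P ↔ P p := by
  refine ⟨fun h => h.2 p hp dvd_rfl, fun h => ⟨hp.ne_zero, fun q hq hd => ?_⟩⟩
  rwa [(Nat.prime_dvd_prime_iff_eq hq hp).mp hd]

open Classical in
/-- The indicator function of `primeSet P`, as a completely multiplicative function. -/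
def primeInd (P : ℕ → Prop) : ℕ →*₀ ℂ where
  toFun n := if n ∈ primeSet P then 1 else 0
  map_zero' := if_neg (zero_notMem_primeSet P)
  map_one' := if_pos (one_mem_primeSet P)
  map_mul' m n := by
    by_cases h1 : m ∈ primeSet P <;> by_cases h2 : n ∈ primeSet P <;>
      simp [mul_mem_primeSet, h1, h2]

open Classical in
theorem primeInd_apply (P : ℕ → Prop) (n : ℕ) :
    primeInd P n = if n ∈ primeSet P then 1 else 0 := rfl

theorem norm_primeInd_le_one (P : ℕ → Prop) (n : ℕ) : ‖primeInd P n‖ ≤ 1 := by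
  rw [primeInd_apply]; split_ifs <;> simp

theorem LSeriesSummable_primeInd (P : ℕ → Prop) {s : ℂ} (hs : 1 < s.re) :
    LSeriesSummable (primeInd P) s :=
  LSeriesSummable_of_bounded_of_one_lt_re (m := 1) (fun n _ => norm_primeInd_le_one P n) hs

theorem abscissa_primeInd_lt (P : ℕ → Prop) {s : ℂ} (hs : 1 < s.re) :
    LSeries.abscissaOfAbsConv (primeInd P) < s.re :=
  lt_of_le_of_lt (LSeries.abscissaOfAbsConv_le_of_forall_lt_LSeriesSummable (x := 1)
    fun y hy => LSeriesSummable_primeInd P (by simpa using hy)) (by exact_mod_cast hs)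

theorem hasDerivAt_LSeries_primeInd (P : ℕ → Prop) {s : ℂ} (hs : 1 < s.re) :
    HasDerivAt (LSeries (primeInd P)) (-LSeries (LSeries.logMul (primeInd P)) s) s :=
  LSeries_hasDerivAt (abscissa_primeInd_lt P hs)

theorem LSeries_eq_tsum_hom (f : ℕ →*₀ ℂ) {s : ℂ} (hs : s ≠ 0) :
    LSeries.term f s = ⇑(f * riemannZetaSummandHom hs) := by
  ext n
  rcases eq_or_ne n 0 with rfl | hn
  · simp
  · rw [LSeries.term_of_ne_zero hn]
    change _ = f n * (n : ℂ) ^ (-s)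
    rw [Complex.cpow_neg, div_eq_mul_inv]

theorem hasProd_LSeries_hom (f : ℕ →*₀ ℂ) {s : ℂ} (hs : 1 < s.re) (hf : LSeriesSummable f s) :
    HasProd (fun p : Nat.Primes => (1 - f p * (p : ℂ) ^ (-s))⁻¹) (LSeries f s) := by
  have hs0 : s ≠ 0 := by rintro rfl; simp at hs; linarith
  have h1 : Summable fun n => ‖(f * riemannZetaSummandHom hs0) n‖ := by
    rw [← LSeries_eq_tsum_hom f hs0]; exact hf.norm
  have h2 := EulerProduct.eulerProduct_completely_multiplicative_hasProd h1
  rw [LSeries, LSeries_eq_tsum_hom f hs0]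
  exact h2

/-- A Dirichlet character as a completely multiplicative function on the natural numbers. -/
def DirichletCharacter.natHom {N : ℕ} (χ : DirichletCharacter ℂ N) (hN : N ≠ 1) : ℕ →*₀ ℂ where
  toFun n := χ (n : ZMod N)
  map_zero' := by
    have : Nontrivial (ZMod N) := ZMod.nontrivial_iff.mpr hN
    rw [Nat.cast_zero]
    exact MulChar.map_nonunit χ not_isUnit_zero
  map_one' := by simp
  map_mul' m n := by simp

theorem LFunction_mul_eq {N : ℕ} [NeZero N] (hN : N ≠ 1) {χ : DirichletCharacter ℂ N}
    (hχ : χ ^ 2 = 1) {s : ℂ} (hs : 1 < s.re) :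
    LSeries (primeInd fun p => χ (p : ZMod N) = 1) s ^ 2 *
      LSeries (primeInd fun p => χ (p : ZMod N) = -1) (2 * s) =
    LFunctionTrivChar N s * LFunction χ s := by
  rw [LFunctionTrivChar, LFunction_eq_LSeries χ hs, LFunction_eq_LSeries 1 hs]
  have hs2 : 1 < (2 * s).re := by simp; linarith
  have hsum : ∀ ψ : DirichletCharacter ℂ N, LSeriesSummable (ψ.natHom hN) s := fun ψ =>
    LSeriesSummable_of_bounded_of_one_lt_re (m := 1) (fun n _ => ψ.norm_le_one _) hs
  have h1 := hasProd_LSeries_hom _ hs (LSeriesSummable_primeInd (fun p => χ (p : ZMod N) = 1) hs)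
  have h2 := hasProd_LSeries_hom _ hs2
    (LSeriesSummable_primeInd (fun p => χ (p : ZMod N) = -1) hs2)
  have h3 := hasProd_LSeries_hom _ hs (hsum 1)
  have h4 := hasProd_LSeries_hom _ hs (hsum χ)
  have h5 := (h1.mul h1).mul h2
  rw [pow_two]
  refine h5.unique ((h3.mul h4).congr_fun ?_)
  intro p
  have hp := p.2
  have e2 : ((p : ℕ) : ℂ) ^ (-(2 * s)) = (((p : ℕ) : ℂ) ^ (-s)) ^ 2 := by
    rw [← Complex.cpow_nat_mul]; congr 1; push_cast; ring
  simp only [primeInd_apply, hp.mem_primeSet, DirichletCharacter.natHom, MonoidWithZeroHom.coe_mk,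
    ZeroHom.coe_mk, e2]
  set a := (((p : ℕ) : ℂ) ^ (-s)) with ha
  by_cases hu : IsUnit ((p : ℕ) : ZMod N)
  · have hsq : χ (p : ZMod N) ^ 2 = 1 := by
      rw [← MulChar.pow_apply' χ two_ne_zero, hχ, MulChar.one_apply hu]
    have h11 : (1 : DirichletCharacter ℂ N) (p : ZMod N) = 1 := MulChar.one_apply hu
    rcases sq_eq_one_iff.mp hsq with h | h
    · simp [h, h11]; norm_num
    · simp [h, h11]; norm_num
      rw [← mul_inv]; congr 1; ring
  · have h0 : χ (p : ZMod N) = 0 := MulChar.map_nonunit χ hu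
    have h10 : (1 : DirichletCharacter ℂ N) (p : ZMod N) = 0 := MulChar.map_nonunit _ hu
    simp [h0, h10]

end

section

open MeasureTheory Set Filter DirichletCharacter Topology

theorem norm_LSeries_primeInd_sub_one_le (P : ℕ → Prop) {z : ℂ} (hz : 2 ≤ z.re) :
    ‖LSeries (primeInd P) z - 1‖ ≤ 13 / 20 := by
  have h1 : HasSum (LSeries.term (primeInd P) z) (LSeries (primeInd P) z) :=
    (LSeriesSummable_primeInd P (show 1 < z.re by linarith)).LSeriesHasSum
  have h2 := h1.sub (hasSum_ite_eq (1 : ℕ) (1 : ℂ))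
  have h3 := hasSum_zeta_two.sub (hasSum_ite_eq (1 : ℕ) (1 : ℝ))
  have h4 : ‖LSeries (primeInd P) z - 1‖ ≤ Real.pi ^ 2 / 6 - 1 := by
    rw [← h2.tsum_eq]
    refine tsum_of_norm_bounded h3 fun n => ?_
    rcases eq_or_ne n 0 with rfl | hn
    · simp
    rcases eq_or_ne n 1 with rfl | hn1
    · simp
    · simp only [hn1, if_false, sub_zero]
      rw [LSeries.norm_term_eq, if_neg hn]
      have hn' : (1 : ℝ) ≤ n := by exact_mod_cast Nat.one_le_iff_ne_zero.mpr hn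
      refine div_le_div₀ zero_le_one (norm_primeInd_le_one P n) (by positivity) ?_
      rw [← Real.rpow_natCast]
      exact Real.rpow_le_rpow_of_exponent_le hn' (by simpa using hz)
  have h5 : Real.pi ^ 2 ≤ 3.1416 ^ 2 := pow_le_pow_left₀ Real.pi_pos.le Real.pi_lt_d4.le 2
  norm_num at h5
  linarith

theorem exists_norm_LSeries_logMul_primeInd_le (P : ℕ → Prop) :
    ∃ C : ℝ, 0 ≤ C ∧ ∀ z : ℂ, 2 ≤ z.re → ‖LSeries (LSeries.logMul (primeInd P)) z‖ ≤ C := by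
  have hsum : LSeriesSummable (LSeries.logMul (primeInd P)) 2 :=
    LSeriesSummable_logMul_of_lt_re (abscissa_primeInd_lt P (by norm_num))
  refine ⟨∑' n, ‖LSeries.term (LSeries.logMul (primeInd P)) 2 n‖,
    tsum_nonneg fun _ => norm_nonneg _, fun z hz => ?_⟩
  exact tsum_of_norm_bounded hsum.norm.hasSum fun n =>
    LSeries.norm_term_le_of_re_le_re _ (by simpa using hz) n

theorem LSeries_primeInd_real (P : ℕ → Prop) (σ : ℝ) :
    ∃ r : ℝ, 0 ≤ r ∧ LSeries (primeInd P) σ = r := by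
  refine ⟨∑' n, ‖LSeries.term (primeInd P) σ n‖, tsum_nonneg fun _ => norm_nonneg _, ?_⟩
  rw [Complex.ofReal_tsum, LSeries]
  refine tsum_congr fun n => ?_
  rw [LSeries.norm_term_eq, LSeries.term_def]
  rcases eq_or_ne n 0 with rfl | hn
  · simp
  · rw [if_neg hn, if_neg hn, primeInd_apply]
    split_ifs
    · simp [Complex.ofReal_cpow (Nat.cast_nonneg n)]
    · simp

section
variable {N : ℕ} [NeZero N] (hN : N ≠ 1) {χ : DirichletCharacter ℂ N} (hχ : χ ^ 2 = 1)
  (hχ1 : χ ≠ 1)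

theorem hasDerivAt_LSeries_two_mul (P : ℕ → Prop) {s : ℂ} (hs : 1 / 2 < s.re) :
    HasDerivAt (fun z => LSeries (primeInd P) (2 * z))
      (-LSeries (LSeries.logMul (primeInd P)) (2 * s) * 2) s := by
  have h2 : HasDerivAt (fun z : ℂ => 2 * z) 2 s := by
    simpa using (hasDerivAt_id s).const_mul (2 : ℂ)
  exact (hasDerivAt_LSeries_primeInd P (s := 2 * s) (by simp; linarith)).comp s h2

set_option maxHeartbeats 1000000 in
include hN hχ in
theorem exists_landau_far_bound :
    ∃ M : ℝ, 0 ≤ M ∧ ∀ s : ℂ, 1 < s.re → s.re ≤ 2 → 1 ≤ |s.im| →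
      ‖LSeries (primeInd fun p => χ (p : ZMod N) = 1) s‖ ≤ M * |s.im| ^ (1 / 2 : ℝ) ∧
      ‖LSeries (LSeries.logMul (primeInd fun p => χ (p : ZMod N) = 1)) s‖ ≤
        M * |s.im| ^ (1 / 2 : ℝ) := by
  obtain ⟨C₁, hC₁, hb₁⟩ := χ.exists_LFunction_growth_bound
  obtain ⟨C₀, hC₀, hb₀⟩ := (1 : DirichletCharacter ℂ N).exists_LFunction_growth_bound
  obtain ⟨c₁, hc₁, hl₁⟩ := χ.exists_LFunction_lower_bound
  obtain ⟨c₀, hc₀, hl₀⟩ := (1 : DirichletCharacter ℂ N).exists_LFunction_lower_bound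
  obtain ⟨D, hD, hw'⟩ := exists_norm_LSeries_logMul_primeInd_le (fun p => χ (p : ZMod N) = -1)
  set A := 2 * C₀ * C₁ + 6 * C₀ * C₁ * D with hA
  have hA0 : 0 ≤ A := by positivity
  set e := Real.sqrt (c₀ * c₁ / 2) with he
  have he0 : 0 < e := Real.sqrt_pos.mpr (by positivity)
  refine ⟨3 * C₀ * C₁ + 3 * A / e, by positivity, fun s hs hs2 ht => ?_⟩
  set F := LSeries (primeInd fun p => χ (p : ZMod N) = 1) with hF
  set F' := -LSeries (LSeries.logMul (primeInd fun p => χ (p : ZMod N) = 1)) s with hF'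
  set w := fun z => LSeries (primeInd fun p => χ (p : ZMod N) = -1) (2 * z) with hw
  set w' := -LSeries (LSeries.logMul (primeInd fun p => χ (p : ZMod N) = -1)) (2 * s) * 2 with hwd
  set t := |s.im| with htd
  have ht0 : 0 < t := by linarith
  have hFd : HasDerivAt F F' s := hasDerivAt_LSeries_primeInd _ hs
  have hwd' : HasDerivAt w w' s := hasDerivAt_LSeries_two_mul _ (by linarith)
  have hs1 : s ≠ 1 := by rintro rfl; simp at hs
  have hd1 := (differentiableAt_LFunction χ s (Or.inl hs1)).hasDerivAt
  have hd0 := (differentiableAt_LFunction (1 : DirichletCharacter ℂ N) s (Or.inl hs1)).hasDerivAt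
  have heq : (fun z => F z ^ 2 * w z) =ᶠ[𝓝 s]
      fun z => LFunction (1 : DirichletCharacter ℂ N) z * LFunction χ z := by
    filter_upwards [(isOpen_lt continuous_const Complex.continuous_re).mem_nhds hs] with z hz
    exact LFunction_mul_eq hN hχ hz
  have hder : 2 * F s * F' * w s + F s ^ 2 * w' =
      deriv (LFunction (1 : DirichletCharacter ℂ N)) s * LFunction χ s +
      LFunction (1 : DirichletCharacter ℂ N) s * deriv (LFunction χ) s := by
    have h1 := (hFd.pow 2).mul hwd'
    have h2 := (hd0.mul hd1).congr_of_eventuallyEq heq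
    have h3 := h1.unique h2
    simpa using h3
  have hval := heq.self_of_nhds
  simp only at hval
  set L0 := LFunction (1 : DirichletCharacter ℂ N) s
  set L1 := LFunction χ s
  set L0' := deriv (LFunction (1 : DirichletCharacter ℂ N)) s
  set L1' := deriv (LFunction χ) s
  obtain ⟨b1, b1'⟩ := hb₁ s hs hs2 ht
  obtain ⟨b0, b0'⟩ := hb₀ s hs hs2 ht
  have l1 := hl₁ s hs hs2 ht
  have l0 := hl₀ s hs hs2 ht
  set b := t ^ (1 / 12 : ℝ) with hbd
  have hb1 : 1 ≤ b := Real.one_le_rpow ht (by norm_num)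
  have hb0 : 0 < b := by linarith
  have hbp : ∀ (k : ℕ), b ^ k = t ^ (k / 12 : ℝ) := fun k => by
    rw [hbd, ← Real.rpow_natCast, ← Real.rpow_mul ht0.le]; congr 1; ring
  have e4 : t ^ (1 / 3 : ℝ) = b ^ 4 := by rw [hbp]; norm_num
  have e6 : t ^ (1 / 2 : ℝ) = b ^ 6 := by rw [hbp]; norm_num
  rw [e4] at l1 l0
  have hw1 : ‖w s - 1‖ ≤ 13 / 20 := norm_LSeries_primeInd_sub_one_le _ (by simp; linarith)
  have hwl : 7 / 20 ≤ ‖w s‖ := by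
    have h := norm_sub_norm_le (1 : ℂ) (w s)
    rw [norm_sub_rev, norm_one] at h
    linarith
  have hwu : ‖w s‖ ≤ 2 := by
    have h := norm_sub_norm_le (w s) (1 : ℂ)
    rw [norm_one] at h
    linarith
  have hwD : ‖w'‖ ≤ 2 * D := by
    rw [hwd, norm_mul, norm_neg, Complex.norm_ofNat]
    linarith [hw' (2 * s) (by simp; linarith)]
  have hnv : ‖F s‖ ^ 2 * ‖w s‖ = ‖L0‖ * ‖L1‖ := by
    rw [← norm_pow, ← norm_mul, hval, norm_mul]
  have hLL : ‖L0‖ * ‖L1‖ ≤ C₀ * C₁ * b ^ 2 := by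
    calc _ ≤ (C₀ * b) * (C₁ * b) := mul_le_mul b0 b1 (norm_nonneg _) (by positivity)
      _ = _ := by ring
  have hLl : c₀ * c₁ ≤ ‖L0‖ * ‖L1‖ * b ^ 8 := by
    calc _ ≤ (‖L0‖ * b ^ 4) * (‖L1‖ * b ^ 4) := mul_le_mul l0 l1 hc₁.le (by positivity)
      _ = _ := by ring
  have hF2 : ‖F s‖ ^ 2 ≤ 3 * (C₀ * C₁ * b ^ 2) := by nlinarith [sq_nonneg ‖F s‖]
  have hFl : e ≤ ‖F s‖ * b ^ 4 := by
    rw [he]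
    refine Real.sqrt_le_iff.mpr ⟨by positivity, ?_⟩
    rw [← hnv] at hLl
    have : ‖F s‖ ^ 2 * ‖w s‖ * b ^ 8 ≤ ‖F s‖ ^ 2 * 2 * b ^ 8 := by gcongr
    nlinarith
  have hCC : 1 ≤ C₀ * C₁ := by nlinarith
  have hFu : ‖F s‖ ≤ 3 * C₀ * C₁ * b := by
    refine le_of_pow_le_pow_left₀ two_ne_zero (by positivity) (hF2.trans ?_)
    have : 0 ≤ C₀ * C₁ * b ^ 2 * (3 * (C₀ * C₁) - 1) := by
      have : 0 ≤ 3 * (C₀ * C₁) - 1 := by linarith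
      positivity
    nlinarith
  have hb6 : b ≤ b ^ 6 := le_self_pow₀ hb1 (by norm_num)
  rw [e6]
  have hMe : 0 ≤ 3 * A / e := by positivity
  constructor
  · calc _ ≤ 3 * C₀ * C₁ * b := hFu
      _ ≤ (3 * C₀ * C₁ + 3 * A / e) * b ^ 6 := by
        refine mul_le_mul (by linarith) hb6 hb0.le (by positivity)
  · rw [← norm_neg, ← hF']
    have hnum : ‖2 * F s * F' * w s‖ ≤ A * b ^ 2 := by
      have : 2 * F s * F' * w s = L0' * L1 + L0 * L1' - F s ^ 2 * w' := by rw [← hder]; ring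
      rw [this]
      calc _ ≤ ‖L0' * L1‖ + ‖L0 * L1'‖ + ‖F s ^ 2 * w'‖ :=
            (norm_sub_le _ _).trans (by gcongr; exact norm_add_le _ _)
        _ ≤ (C₀ * b) * (C₁ * b) + (C₀ * b) * (C₁ * b) + (3 * (C₀ * C₁ * b ^ 2)) * (2 * D) := by
            rw [norm_mul, norm_mul, norm_mul, norm_pow]
            gcongr
        _ = _ := by rw [hA]; ring
    rw [norm_mul, norm_mul, norm_mul, Complex.norm_ofNat] at hnum
    have h1 : ‖F'‖ * e ≤ 3 * A * b ^ 6 := by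
      calc ‖F'‖ * e ≤ ‖F'‖ * (‖F s‖ * b ^ 4) := by gcongr
        _ = (‖F s‖ * ‖F'‖) * b ^ 4 := by ring
        _ ≤ (3 * A * b ^ 2) * b ^ 4 := by
            refine mul_le_mul_of_nonneg_right ?_ (by positivity)
            nlinarith [mul_nonneg (norm_nonneg (F s)) (norm_nonneg F')]
        _ = _ := by ring
    calc ‖F'‖ ≤ 3 * A * b ^ 6 / e := by rwa [le_div_iff₀ he0]
      _ = 3 * A / e * b ^ 6 := by ring
      _ ≤ _ := by gcongr; linarith [show 0 ≤ 3 * C₀ * C₁ by positivity]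
end

end

section

open MeasureTheory Set Filter DirichletCharacter Topology

theorem hasDerivAt_sub_one_cpow (a : ℂ) {s : ℂ} (hs : 1 < s.re) :
    HasDerivAt (fun z : ℂ => (z - 1) ^ a) (a * (s - 1) ^ (a - 1)) s := by
  have h := ((hasDerivAt_id s).sub_const 1).cpow_const (c := a)
    (Or.inl (by simpa using hs) : (s - 1) ∈ Complex.slitPlane)
  simpa using h

theorem sub_one_ne_zero_of_one_lt_re {s : ℂ} (hs : 1 < s.re) : s - 1 ≠ 0 := fun h => by
  have := congrArg Complex.re h
  simp at this
  linarith

/-- A function with `F ^ 2 * (s - 1)` holomorphic and nonvanishing near the segment behaves like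
a constant multiple of `(s - 1) ^ (-1/2)`. -/
theorem exists_sqrt_singularity {U : Set ℂ} (hU : IsOpen U)
    (hKU : Icc (1 : ℝ) 2 ×ℂ Icc (-1) 1 ⊆ U) {F F' Q : ℂ → ℂ} (hQ : DifferentiableOn ℂ Q U)
    (hQ0 : ∀ s ∈ Icc (1 : ℝ) 2 ×ℂ Icc (-1) 1, Q s ≠ 0)
    (hF : ∀ s : ℂ, 1 < s.re → HasDerivAt F (F' s) s)
    (hFQ : ∀ s : ℂ, 1 < s.re → F s ^ 2 * (s - 1) = Q s)
    (hreal : ∀ σ : ℝ, 1 < σ → ∃ r : ℝ, 0 ≤ r ∧ F σ = r) :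
    ∃ K₁ : ℝ, 0 < K₁ ∧ (K₁ : ℂ) ^ 2 = Q 1 ∧ ∃ C : ℝ, 0 ≤ C ∧
      ∀ s : ℂ, 1 < s.re → s.re ≤ 2 → |s.im| ≤ 1 →
        ‖F s * (s - 1) ^ (1 / 2 : ℂ) - K₁‖ ≤ C * ‖s - 1‖ ∧
        ‖F' s * (s - 1) ^ (1 / 2 : ℂ) + F s * (1 / 2 * (s - 1) ^ (1 / 2 - 1 : ℂ))‖ ≤ C := by
  have hcomp : IsCompact (Icc (1 : ℝ) 2 ×ℂ Icc (-1) 1) := isCompact_Icc.reProdIm isCompact_Icc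
  have hQc : ContinuousOn Q (Icc (1 : ℝ) 2 ×ℂ Icc (-1) 1) := hQ.continuousOn.mono hKU
  obtain ⟨q₁, hq₁⟩ := hcomp.exists_bound_of_continuousOn ((hQ.deriv hU).continuousOn.mono hKU)
  obtain ⟨q₀, hq₀⟩ := hcomp.exists_bound_of_continuousOn (hQc.inv₀ hQ0)
  have h1mem : (1 : ℂ) ∈ Icc (1 : ℝ) 2 ×ℂ Icc (-1) 1 := by simp [Complex.mem_reProdIm]
  set K : ℂ → ℂ := fun s => F s * (s - 1) ^ (1 / 2 : ℂ) with hKdef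
  set K' : ℂ → ℂ := fun s =>
    F' s * (s - 1) ^ (1 / 2 : ℂ) + F s * (1 / 2 * (s - 1) ^ (1 / 2 - 1 : ℂ)) with hK'def
  have hK : ∀ s : ℂ, 1 < s.re → HasDerivAt K (K' s) s := fun s hs =>
    (hF s hs).mul (hasDerivAt_sub_one_cpow _ hs)
  have hKsq : ∀ s : ℂ, 1 < s.re → K s ^ 2 = Q s := fun s hs => by
    rw [hKdef, mul_pow, ← Complex.cpow_nat_mul, ← hFQ s hs]
    norm_num
  set D : Set ℂ := {s | 1 < s.re ∧ s.re ≤ 2 ∧ |s.im| ≤ 1} with hD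
  have hDK : D ⊆ Icc (1 : ℝ) 2 ×ℂ Icc (-1) 1 := fun s hs => by
    rw [Complex.mem_reProdIm]
    exact ⟨⟨hs.1.le, hs.2.1⟩, abs_le.mp hs.2.2⟩
  have hDconv : Convex ℝ D := by
    have : D = {s : ℂ | 1 < s.re} ∩ ({s | s.re ≤ 2} ∩ ({s | s.im ≤ 1} ∩ {s | -1 ≤ s.im})) := by
      ext s
      simp only [hD, abs_le, mem_inter_iff, Set.mem_ofPred_eq]
      tauto
    rw [this]
    exact (convex_halfSpace_re_gt 1).inter ((convex_halfSpace_re_le 2).inter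
      ((convex_halfSpace_im_le 1).inter (convex_halfSpace_im_ge (-1))))
  have hderQ : ∀ s : ℂ, 1 < s.re → s ∈ U → 2 * K s * K' s = deriv Q s := fun s hs hsU => by
    have h1 := (hK s hs).pow 2
    have h2 : (fun z => K z ^ 2) =ᶠ[𝓝 s] Q := by
      filter_upwards [(isOpen_lt continuous_const Complex.continuous_re).mem_nhds hs] with z hz
      exact hKsq z hz
    have h3 := (h1.congr_of_eventuallyEq h2.symm).deriv
    rw [h3]
    norm_num
  set C : ℝ := q₁ * Real.sqrt q₀ with hC
  have hq₁0 : 0 ≤ q₁ := (norm_nonneg _).trans (hq₁ 1 h1mem)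
  have hC0 : 0 ≤ C := mul_nonneg hq₁0 (Real.sqrt_nonneg _)
  have hK'b : ∀ s ∈ D, ‖K' s‖ ≤ C := fun s hs => by
    have hQs := hQ0 s (hDK hs)
    have hKs : K s ≠ 0 := fun h => hQs (by rw [← hKsq s hs.1, h]; simp)
    have h1 := hderQ s hs.1 (hKU (hDK hs))
    have h2 : K' s = deriv Q s * (K s)⁻¹ / 2 := by rw [← h1]; field_simp
    have h3 : ‖(K s)⁻¹‖ ≤ Real.sqrt q₀ := by
      refine Real.le_sqrt_of_sq_le ?_
      rw [← norm_pow, inv_pow, hKsq s hs.1]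
      exact hq₀ s (hDK hs)
    rw [h2, norm_div, norm_mul, Complex.norm_ofNat]
    have := mul_le_mul (hq₁ s (hDK hs)) h3 (norm_nonneg _) hq₁0
    have h5 : 0 ≤ ‖deriv Q s‖ * ‖(K s)⁻¹‖ := by positivity
    linarith
  have hlip : ∀ s ∈ D, ∀ z ∈ D, ‖K z - K s‖ ≤ C * ‖z - s‖ := fun s hs z hz =>
    hDconv.norm_image_sub_le_of_norm_hasDerivWithin_le
      (fun w hw => (hK w hw.1).hasDerivWithinAt) hK'b hs hz
  have hKreal : ∀ σ : ℝ, 1 < σ → K σ = (Real.sqrt (Q σ).re : ℝ) := fun σ hσ => by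
    obtain ⟨r, hr, hFr⟩ := hreal σ hσ
    have h1 : K σ = ((r * (σ - 1) ^ (1 / 2 : ℝ) : ℝ) : ℂ) := by
      have h2 := Complex.ofReal_cpow (show (0 : ℝ) ≤ σ - 1 by linarith) (1 / 2)
      push_cast at h2
      simp only [hKdef]
      rw [hFr]
      push_cast
      rw [h2]
    have h2 := hKsq σ (by simpa using hσ)
    rw [← h2, h1, ← Complex.ofReal_pow, Complex.ofReal_re, Real.sqrt_sq]
    have : 0 ≤ σ - 1 := by linarith
    positivity
  have htend : Tendsto (fun σ : ℝ => (σ : ℂ)) (𝓝[>] 1) (𝓝 1) := by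
    have := (Complex.continuous_ofReal.tendsto 1).mono_left (nhdsWithin_le_nhds (s := Ioi (1 : ℝ)))
    simpa using this
  have hQ1 : Tendsto (fun σ : ℝ => Q σ) (𝓝[>] 1) (𝓝 (Q 1)) :=
    ((hQ.differentiableAt (hU.mem_nhds (hKU h1mem))).continuousAt.tendsto).comp htend
  set K₁ : ℝ := Real.sqrt (Q 1).re with hK₁
  have hKtend : Tendsto (fun σ : ℝ => K σ) (𝓝[>] 1) (𝓝 (K₁ : ℂ)) := by
    have h1 : Tendsto (fun σ : ℝ => ((Real.sqrt (Q σ).re : ℝ) : ℂ)) (𝓝[>] 1) (𝓝 (K₁ : ℂ)) :=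
      (Complex.continuous_ofReal.tendsto _).comp ((Real.continuous_sqrt.tendsto _).comp
        ((Complex.continuous_re.tendsto _).comp hQ1))
    refine h1.congr' ?_
    filter_upwards [self_mem_nhdsWithin] with σ hσ
    exact (hKreal σ hσ).symm
  have hK₁sq : (K₁ : ℂ) ^ 2 = Q 1 := by
    refine tendsto_nhds_unique (hKtend.pow 2) (hQ1.congr' ?_)
    filter_upwards [self_mem_nhdsWithin] with σ hσ
    exact (hKsq σ (by simpa using hσ)).symm
  refine ⟨K₁, ?_, hK₁sq, C, hC0, fun s hs1 hs2 him => ⟨?_, hK'b s ⟨hs1, hs2, him⟩⟩⟩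
  · refine lt_of_le_of_ne (Real.sqrt_nonneg _) fun h => hQ0 1 h1mem ?_
    rw [← hK₁sq, ← h]
    simp
  · refine le_of_tendsto_of_tendsto ((tendsto_const_nhds.sub hKtend).norm)
      ((tendsto_const_nhds.sub htend).norm.const_mul C) ?_
    filter_upwards [self_mem_nhdsWithin,
      mem_nhdsWithin_of_mem_nhds (Iio_mem_nhds (show (1 : ℝ) < 2 by norm_num))] with σ hσ hσ2
    exact hlip σ ⟨by simpa using hσ, by simpa using (le_of_lt hσ2), by simp⟩ s ⟨hs1, hs2, him⟩

theorem one_le_norm_of_one_lt_re {s : ℂ} (hs : 1 < s.re) : 1 ≤ ‖s‖ :=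
  hs.le.trans ((le_abs_self _).trans (Complex.abs_re_le_norm s))

theorem exists_near_bound {F F' : ℂ → ℂ} {K₁ C : ℝ} (hK₁ : 0 < K₁) (hC : 0 ≤ C)
    (h : ∀ s : ℂ, 1 < s.re → s.re ≤ 2 → |s.im| ≤ 1 →
        ‖F s * (s - 1) ^ (1 / 2 : ℂ) - K₁‖ ≤ C * ‖s - 1‖ ∧
        ‖F' s * (s - 1) ^ (1 / 2 : ℂ) + F s * (1 / 2 * (s - 1) ^ (1 / 2 - 1 : ℂ))‖ ≤ C) :
    ∃ M : ℝ, 0 ≤ M ∧ ∀ s : ℂ, 1 < s.re → s.re ≤ 2 → s.im ≠ 0 → |s.im| ≤ 1 →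
      ‖F s / s - K₁ * (s - 1) ^ (-(1 / 2) : ℂ)‖ ≤ M * |s.im| ^ (-(1 / 2) : ℝ) ∧
      ‖F' s / s - F s / s ^ 2 - K₁ * (-(1 / 2) * (s - 1) ^ (-(1 / 2) - 1 : ℂ))‖ ≤
        M * |s.im| ^ (-(1 / 2) : ℝ) := by
  refine ⟨10 * (C + K₁), by positivity, fun s hs1 hs2 him0 him => ?_⟩
  obtain ⟨h1, h2⟩ := h s hs1 hs2 him
  have hs0 : s - 1 ≠ 0 := sub_one_ne_zero_of_one_lt_re hs1
  have hns := one_le_norm_of_one_lt_re hs1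
  have hsne : s ≠ 0 := fun h0 => by rw [h0, norm_zero] at hns; linarith
  set z := (s - 1) ^ (1 / 2 : ℂ) with hz
  have hz0 : z ≠ 0 := by simp [hz, Complex.cpow_eq_zero_iff, hs0]
  have hzz : z * z = s - 1 := by
    rw [hz, ← Complex.cpow_add _ _ hs0]; norm_num
  have e1 : (s - 1) ^ (1 / 2 - 1 : ℂ) = z⁻¹ := by
    rw [hz, ← Complex.cpow_neg]; norm_num
  have e2 : (s - 1) ^ (-(1 / 2) : ℂ) = z⁻¹ := by rw [hz, ← Complex.cpow_neg]
  have e3 : (s - 1) ^ (-(1 / 2) - 1 : ℂ) = z⁻¹ * (s - 1)⁻¹ := by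
    rw [Complex.cpow_sub _ _ hs0, e2, Complex.cpow_one, div_eq_mul_inv]
  have hnz : ‖z⁻¹‖ ≤ |s.im| ^ (-(1 / 2) : ℝ) := by
    rw [← e2, Complex.norm_cpow_of_ne_zero hs0]
    have : (s - 1).im = s.im := by simp
    have h3 : |s.im| ≤ ‖s - 1‖ := by rw [← this]; exact Complex.abs_im_le_norm _
    have h4 : (-(1 / 2) : ℂ).im = 0 := by norm_num
    have h5 : (-(1 / 2) : ℂ).re = -(1 / 2) := by norm_num
    rw [h4, h5, mul_zero, Real.exp_zero, div_one]
    exact Real.rpow_le_rpow_of_nonpos (abs_pos.mpr him0) h3 (by norm_num)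
  have hs1n : ‖s - 1‖ ≤ 2 := by
    refine (Complex.norm_le_abs_re_add_abs_im _).trans ?_
    simp only [Complex.sub_re, Complex.one_re, Complex.sub_im, Complex.one_im, sub_zero]
    rw [abs_of_pos (by linarith)]
    linarith
  rw [e1] at h2
  rw [e2, e3]
  set g := F s * z / s - K₁ with hg
  have hgb : ‖g‖ ≤ (C + K₁) * ‖s - 1‖ := by
    have : g = ((F s * z - K₁) - K₁ * (s - 1)) / s := by rw [hg]; field_simp; ring
    rw [this, norm_div]
    refine (div_le_self (norm_nonneg _) hns).trans ((norm_sub_le _ _).trans ?_)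
    rw [norm_mul, Complex.norm_real, Real.norm_of_nonneg hK₁.le]
    linarith
  have hKz : ‖F s * z‖ ≤ 2 * C + K₁ := by
    have h3 : F s * z = (F s * z - K₁) + K₁ := by ring
    rw [h3]
    refine (norm_add_le _ _).trans ?_
    rw [Complex.norm_real, Real.norm_of_nonneg hK₁.le]
    nlinarith
  constructor
  · have : F s / s - K₁ * z⁻¹ = g * z⁻¹ := by rw [hg]; field_simp
    rw [this, norm_mul]
    refine mul_le_mul ?_ hnz (norm_nonneg _) (by positivity)
    nlinarith
  · have h3 : F' s / s - F s / s ^ 2 - K₁ * (-(1 / 2) * (z⁻¹ * (s - 1)⁻¹)) =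
        ((F' s * z + F s * (1 / 2 * z⁻¹)) / s - (F s * z) / s ^ 2 - 1 / 2 * (g / (s - 1))) * z⁻¹ := by
      rw [hg, ← hzz]
      field_simp
      ring
    rw [h3, norm_mul]
    refine mul_le_mul ?_ hnz (norm_nonneg _) (by positivity)
    have n1 : ‖(F' s * z + F s * (1 / 2 * z⁻¹)) / s‖ ≤ C := by
      rw [norm_div]
      exact (div_le_self (norm_nonneg _) hns).trans h2
    have n2 : ‖(F s * z) / s ^ 2‖ ≤ 2 * C + K₁ := by
      rw [norm_div, norm_pow]
      exact (div_le_self (norm_nonneg _) (one_le_pow₀ hns)).trans hKz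
    have n3 : ‖1 / 2 * (g / (s - 1))‖ ≤ C + K₁ := by
      have h12 : ‖(1 / 2 : ℂ)‖ = 1 / 2 := by norm_num
      rw [norm_mul, h12, norm_div]
      have : ‖g‖ / ‖s - 1‖ ≤ C + K₁ := by
        rw [div_le_iff₀ (norm_pos_iff.mpr hs0)]; exact hgb
      have : 0 ≤ ‖g‖ / ‖s - 1‖ := by positivity
      linarith
    refine (norm_sub_le _ _).trans ?_
    have := norm_sub_le ((F' s * z + F s * (1 / 2 * z⁻¹)) / s) ((F s * z) / s ^ 2)
    linarith

end

section

open MeasureTheory Set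

theorem integrable_inv_sqrt_abs_div :
    Integrable (fun t : ℝ => |t| ^ (-(1 / 2) : ℝ) / (1 + |t|)) := by
  have hmeas : Measurable (fun t : ℝ => |t| ^ (-(1 / 2) : ℝ) / (1 + |t|)) := by
    apply Measurable.div <;> fun_prop
  have hpos : IntegrableOn (fun t : ℝ => |t| ^ (-(1 / 2) : ℝ) / (1 + |t|)) (Ioi 0) := by
    rw [← Ioc_union_Ioi_eq_Ioi zero_le_one]
    refine IntegrableOn.union ?_ ?_
    · have h := (intervalIntegral.intervalIntegrable_rpow' (a := 0) (b := 1)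
        (show (-1 : ℝ) < -(1 / 2) by norm_num)).1
      refine Integrable.mono' h hmeas.aestronglyMeasurable ?_
      filter_upwards [ae_restrict_mem measurableSet_Ioc] with t ht
      rw [abs_of_pos ht.1, Real.norm_of_nonneg (div_nonneg (Real.rpow_nonneg ht.1.le _) (by linarith [ht.1]))]
      exact div_le_self (Real.rpow_nonneg ht.1.le _) (by linarith [ht.1])
    · have h := integrableOn_Ioi_rpow_of_lt (show (-(3 / 2) : ℝ) < -1 by norm_num) one_pos
      refine Integrable.mono' h hmeas.aestronglyMeasurable ?_
      filter_upwards [ae_restrict_mem measurableSet_Ioi] with t ht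
      have ht0 : (0 : ℝ) < t := one_pos.trans ht
      rw [abs_of_pos ht0, Real.norm_of_nonneg (div_nonneg (Real.rpow_nonneg ht0.le _) (by linarith))]
      rw [div_le_iff₀ (by linarith), show (-(1 / 2) : ℝ) = -(3 / 2) + 1 by norm_num,
        Real.rpow_add ht0, Real.rpow_one]
      have := Real.rpow_nonneg ht0.le (-(3 / 2))
      nlinarith
  have hneg : IntegrableOn (fun t : ℝ => |t| ^ (-(1 / 2) : ℝ) / (1 + |t|)) (Iio 0) := by
    have h : IntegrableOn (fun t : ℝ => |t| ^ (-(1 / 2) : ℝ) / (1 + |t|)) (Ioi (-0)) := by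
      simpa using hpos
    simpa using h.comp_neg_Iio
  rw [← integrableOn_univ, ← Iic_union_Ioi (a := (0 : ℝ))]
  exact ((integrableOn_Iic_iff_integrableOn_Iio (μ := volume)).mpr hneg).union hpos

/-- The Laplace transform of a primitive. -/
theorem laplace_primitive {D : ℝ → ℝ} {σ : ℝ} (hσ : 0 < σ)
    (hD : IntegrableOn (fun v => D v * Real.exp (-σ * v)) (Ioi 0)) :
    Integrable (fun u => (∫ v in Ioc 0 u, D v) * Real.exp (-σ * u)) ∧
    ∀ s : ℂ, s.re = σ → ∫ u : ℝ, ((∫ v in Ioc 0 u, D v : ℝ) : ℂ) * Complex.exp (-s * u) =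
      s⁻¹ * ∫ v : ℝ in Ioi 0, (D v : ℂ) * Complex.exp (-s * v) := by
  set T : Set (ℝ × ℝ) := {p | 0 < p.2 ∧ p.2 ≤ p.1} with hT
  have hTm : MeasurableSet T :=
    (measurableSet_lt measurable_const measurable_snd).inter
      (measurableSet_le measurable_snd measurable_fst)
  set k : ℂ → ℝ × ℝ → ℂ := fun s => T.indicator fun p => (D p.2 : ℂ) * Complex.exp (-s * p.1) with hk
  have hDm : AEStronglyMeasurable (fun v => D v) (volume.restrict (Ioi 0)) := by
    have : D = fun v => D v * Real.exp (-σ * v) * Real.exp (σ * v) := by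
      funext v
      rw [mul_assoc, ← Real.exp_add]; simp
    rw [this]
    exact hD.aestronglyMeasurable.mul (by fun_prop)
  have hnorm : ∀ s : ℂ, s.re = σ → ∀ v u : ℝ, 
      ‖k s (u, v)‖ = (Ioi (0 : ℝ)).indicator (fun v => (Ici v).indicator (fun u => |D v| * Real.exp (-σ * u)) u) v := by
    intro s hs v u
    by_cases hv : 0 < v
    · by_cases hu : v ≤ u
      · have : (u, v) ∈ T := ⟨hv, hu⟩
        simp [hk, this, hv, hu, Complex.norm_exp, hs]
      · have : (u, v) ∉ T := fun h => hu h.2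
        simp [hk, this, hv, hu]
    · have : (u, v) ∉ T := fun h => hv h.1
      simp [hk, this, hv]
  have hkm : ∀ s : ℂ, AEStronglyMeasurable (k s) (volume.prod volume) := by
    intro s
    have h1 : AEStronglyMeasurable (fun v => (Ioi (0 : ℝ)).indicator D v) volume :=
      (aestronglyMeasurable_indicator_iff measurableSet_Ioi).mpr hDm
    have h2 : AEStronglyMeasurable (fun p : ℝ × ℝ => (Ioi (0 : ℝ)).indicator D p.2) (volume.prod volume) :=
      h1.comp_snd
    have h3 : k s = T.indicator fun p => (((Ioi (0 : ℝ)).indicator D p.2 : ℝ) : ℂ) * Complex.exp (-s * p.1) := by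
      apply Set.indicator_congr
      rintro ⟨u, v⟩ h
      simp [h.1]
    rw [h3]
    refine AEStronglyMeasurable.indicator ?_ hTm
    exact (Complex.continuous_ofReal.comp_aestronglyMeasurable h2).mul (by fun_prop)
  have hexp : ∀ v : ℝ, IntegrableOn (fun u => Real.exp (-σ * u)) (Ici v) := fun v =>
    (integrableOn_Ici_iff_integrableOn_Ioi (μ := volume)).mpr (integrableOn_exp_mul_Ioi (by linarith) v)
  have hki : ∀ s : ℂ, s.re = σ → Integrable (k s) (volume.prod volume) := by
    intro s hs
    rw [integrable_prod_iff' (hkm s)]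
    constructor
    · refine Filter.Eventually.of_forall fun v => ?_
      have hm : AEStronglyMeasurable (fun u => k s (u, v)) volume := by
        have : (fun u => k s (u, v)) = {u | (u, v) ∈ T}.indicator
          fun u => (D v : ℂ) * Complex.exp (-s * u) := by
          funext u; rfl
        rw [this]
        refine AEStronglyMeasurable.indicator (by fun_prop) ?_
        exact hTm.preimage (by fun_prop)
      refine (integrable_norm_iff hm).mp ?_
      simp_rw [hnorm s hs v]
      by_cases hv : v ∈ Ioi (0 : ℝ)
      · simp only [Set.indicator_of_mem hv]
        exact IntegrableOn.integrable_indicator ((hexp v).const_mul _) measurableSet_Ici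
      · simp [Set.indicator_of_notMem hv]
    · have : (fun v => ∫ u, ‖k s (u, v)‖) =
          (Ioi (0 : ℝ)).indicator fun v => σ⁻¹ * ‖D v * Real.exp (-σ * v)‖ := by
        funext v
        simp_rw [hnorm s hs v]
        by_cases hv : v ∈ Ioi (0 : ℝ)
        · simp only [Set.indicator_of_mem hv]
          rw [integral_indicator measurableSet_Ici, integral_const_mul,
            integral_Ici_eq_integral_Ioi, integral_exp_mul_Ioi (by linarith), norm_mul, Real.norm_eq_abs,
            Real.norm_of_nonneg (Real.exp_pos _).le]
          field_simp
        · simp [Set.indicator_of_notMem hv]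
      rw [this]
      exact IntegrableOn.integrable_indicator (hD.norm.const_mul _) measurableSet_Ioi
  have hinner : ∀ (s : ℂ) (u : ℝ), ∫ v, k s (u, v) =
      ((∫ v in Ioc 0 u, D v : ℝ) : ℂ) * Complex.exp (-s * u) := by
    intro s u
    have : (fun v => k s (u, v)) = (Ioc 0 u).indicator fun v => (D v : ℂ) * Complex.exp (-s * u) := by
      funext v; rfl
    rw [this, integral_indicator measurableSet_Ioc, integral_mul_const]
    congr 1
    exact integral_ofReal
  constructor
  · have h := (hki σ (by simp)).integral_prod_left
    have h' := h.re
    refine h'.congr (Filter.Eventually.of_forall fun u => ?_)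
    simp only
    rw [hinner]
    have : Complex.exp (-(σ : ℂ) * u) = ((Real.exp (-σ * u) : ℝ) : ℂ) := by push_cast; rfl
    rw [this, ← Complex.ofReal_mul]
    exact Complex.ofReal_re _
  · intro s hs
    simp_rw [← hinner s]
    rw [integral_integral_swap (f := fun u v => k s (u, v)) (hki s hs), ← integral_const_mul,
      ← integral_indicator measurableSet_Ioi]
    congr 1
    funext v
    by_cases hv : 0 < v
    · have : (fun u => k s (u, v)) = (Ici v).indicator fun u : ℝ => (D v : ℂ) * Complex.exp (-s * u) := by
        funext u
        by_cases hu : v ≤ u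
        · have : (u, v) ∈ T := ⟨hv, hu⟩
          simp [hk, this, hu]
        · have : (u, v) ∉ T := fun h => hu h.2
          simp [hk, this, hu]
      rw [this, integral_indicator measurableSet_Ici, integral_const_mul,
            integral_Ici_eq_integral_Ioi, integral_exp_mul_complex_Ioi (by simpa [hs] using hσ),
            Set.indicator_of_mem (show v ∈ Ioi 0 from hv)]
      have hs0 : s ≠ 0 := by rintro rfl; simp at hs; linarith
      field_simp
    · have : (fun u => k s (u, v)) = fun _ => 0 := by
        funext u
        have : (u, v) ∉ T := fun h => hv h.1
        simp [hk, this]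
      rw [this]
      simp [hv]

theorem norm_mul_le_of_fourier {G H H' : ℝ → ℂ} (hGc : Continuous G) (hGi : Integrable G)
    (hH : FourierTransform.fourier G = H) (hHi : Integrable H) (hd : ∀ ξ, HasDerivAt H (H' ξ) ξ)
    (hH'i : Integrable H') (u : ℝ) : |u| * ‖G u‖ ≤ ∫ ξ, ‖H' ξ‖ := by
  have h1 : FourierTransformInv.fourierInv H = G := by
    rw [← hH]; exact hGc.fourierInv_fourier_eq hGi (hH ▸ hHi)
  have hderiv : deriv H = H' := funext fun ξ => (hd ξ).deriv
  have h2 := Real.fourier_deriv hHi (fun ξ => (hd ξ).differentiableAt) (hderiv ▸ hH'i)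
  have h3 := congrFun h2 (-u)
  rw [hderiv] at h3
  have h4 : FourierTransform.fourier H (-u) = G u := by
    rw [← h1, Real.fourierInv_eq_fourier_neg]
  have h5 : ‖FourierTransform.fourier H' (-u)‖ ≤ ∫ ξ, ‖H' ξ‖ :=
    VectorFourier.norm_fourierIntegral_le_integral_norm _ _ _ _ _
  rw [h3, h4, norm_smul] at h5
  refine le_trans ?_ h5
  gcongr
  simp only [norm_mul, Complex.norm_real, Complex.norm_I, Complex.norm_ofNat, norm_neg, Real.norm_eq_abs, Complex.ofReal_neg,
    mul_one, abs_of_pos Real.pi_pos]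
  nlinarith [Real.pi_gt_three, abs_nonneg u]

end

section

open MeasureTheory Set

theorem integrableOn_inv_sqrt_mul_exp {r : ℝ} (hr : 0 < r) :
    IntegrableOn (fun v : ℝ => v ^ (-(1 / 2) : ℝ) * Real.exp (-r * v)) (Ioi 0) := by
  have := integrableOn_rpow_mul_exp_neg_mul_rpow (p := 1) (s := -(1 / 2)) (b := r) (by norm_num) one_pos hr
  simpa using this

theorem laplace_inv_sqrt {b : ℂ} (hb : 0 < b.re) :
    ∫ v : ℝ in Ioi 0, ((v ^ (-(1 / 2) : ℝ) : ℝ) : ℂ) * Complex.exp (-b * v) =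
      (Real.sqrt Real.pi : ℂ) * b ^ (-(1 / 2) : ℂ) := by
  have h1 := integral_comp_rpow_Ioi_of_pos
    (g := fun v : ℝ => ((v ^ (-(1 / 2) : ℝ) : ℝ) : ℂ) * Complex.exp (-b * v)) (show (0 : ℝ) < 2 by norm_num)
  rw [← h1]
  have h2 : ∫ x in Ioi (0 : ℝ), ((2 : ℝ) * x ^ ((2 : ℝ) - 1)) •
      ((((x ^ (2 : ℝ)) ^ (-(1 / 2) : ℝ) : ℝ) : ℂ) * Complex.exp (-b * ((x ^ (2 : ℝ) : ℝ) : ℂ))) =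
      ∫ x in Ioi (0 : ℝ), 2 * Complex.exp (-b * (x : ℂ) ^ 2) := by
    refine setIntegral_congr_fun measurableSet_Ioi fun x hx => ?_
    have hx : 0 < x := hx
    rw [← Real.rpow_mul hx.le, Complex.real_smul, ← mul_assoc, ← Complex.ofReal_mul, mul_assoc,
      ← Real.rpow_add hx]
    norm_num
  rw [h2, integral_const_mul, integral_gaussian_complex_Ioi hb]
  have hb0 : b ≠ 0 := by rintro rfl; simp at hb
  have harg : b.arg ≠ Real.pi := by
    intro h
    have := Complex.abs_arg_lt_pi_div_two_iff.mpr (Or.inl hb)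
    rw [h, abs_of_pos Real.pi_pos] at this
    linarith [Real.pi_pos]
  have hpi : ((Real.sqrt Real.pi : ℝ) : ℂ) = (Real.pi : ℂ) ^ (1 / 2 : ℂ) := by
    rw [Real.sqrt_eq_rpow, Complex.ofReal_cpow Real.pi_pos.le]
    norm_num
  have hpi0 : (Real.pi : ℂ) ≠ 0 := by exact_mod_cast Real.pi_ne_zero
  rw [hpi, Complex.cpow_neg, div_eq_mul_inv (Real.pi : ℂ) b, ← Complex.inv_cpow _ _ harg,
    Complex.cpow_def_of_ne_zero (mul_ne_zero hpi0 (inv_ne_zero hb0)),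
    Complex.cpow_def_of_ne_zero hpi0, Complex.cpow_def_of_ne_zero (inv_ne_zero hb0),
    Complex.log_ofReal_mul Real.pi_pos (inv_ne_zero hb0), add_mul, Complex.exp_add,
    Complex.ofReal_log Real.pi_pos.le]
  ring

theorem tauberian_primitive_bound {N : ℝ → ℝ} {E E' : ℂ → ℂ} {c M : ℝ}
    (hN : ∀ σ : ℝ, 1 < σ → IntegrableOn (fun v => N v * Real.exp (-σ * v)) (Ioi 0))
    (hE : ∀ s : ℂ, 1 < s.re → E s = (∫ v : ℝ in Ioi 0, (N v : ℂ) * Complex.exp (-s * v)) -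
      c * Real.sqrt Real.pi * (s - 1) ^ (-(1 / 2) : ℂ))
    (hd : ∀ s : ℂ, 1 < s.re → HasDerivAt E (E' s) s)
    (hb : ∀ s : ℂ, 1 < s.re → s.re ≤ 2 → s.im ≠ 0 →
      ‖E s‖ ≤ M * |s.im| ^ (-(1 / 2) : ℝ) ∧ ‖E' s‖ ≤ M * |s.im| ^ (-(1 / 2) : ℝ)) :
    ∃ C : ℝ, 0 < C ∧ ∀ u : ℝ, 1 ≤ u →
      |∫ v in Ioc 0 u, (N v - c * (Real.exp v * v ^ (-(1 / 2) : ℝ)))| ≤ C * (Real.exp u / u) := by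
  set D : ℝ → ℝ := fun v => N v - c * (Real.exp v * v ^ (-(1 / 2) : ℝ)) with hDdef
  have hM : 0 ≤ M := by
    have := (norm_nonneg _).trans (hb ⟨2, 1⟩ (by norm_num) le_rfl one_ne_zero).1
    simpa using this
  have hDexp : ∀ σ v : ℝ, D v * Real.exp (-σ * v) = N v * Real.exp (-σ * v) -
      c * (v ^ (-(1 / 2) : ℝ) * Real.exp (-(σ - 1) * v)) := by
    intro σ v
    rw [hDdef, sub_mul, show -(σ - 1) * v = v + -σ * v by ring, Real.exp_add]
    ring
  have hDexpC : ∀ (s : ℂ) (v : ℝ), (D v : ℂ) * Complex.exp (-s * v) = (N v : ℂ) * Complex.exp (-s * v) -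
      c * (((v ^ (-(1 / 2) : ℝ) : ℝ) : ℂ) * Complex.exp (-(s - 1) * v)) := by
    intro s v
    rw [hDdef, show -(s - 1) * (v : ℂ) = v + -s * v by ring, Complex.exp_add]
    push_cast
    ring
  have hDi : ∀ σ : ℝ, 1 < σ → IntegrableOn (fun v => D v * Real.exp (-σ * v)) (Ioi 0) := by
    intro σ hσ
    simp_rw [hDexp]
    exact (hN σ hσ).sub ((integrableOn_inv_sqrt_mul_exp (by linarith)).const_mul c)
  have toC : ∀ (f : ℝ → ℝ) (s : ℂ), IntegrableOn (fun v => f v * Real.exp (-s.re * v)) (Ioi 0) →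
      IntegrableOn (fun v : ℝ => (f v : ℂ) * Complex.exp (-s * v)) (Ioi 0) := by
    intro f s h
    have h1 : IntegrableOn (fun v => ((f v * Real.exp (-s.re * v) : ℝ) : ℂ)) (Ioi 0) := h.ofReal
    have h2 : ∀ v : ℝ, (f v : ℂ) * Complex.exp (-s * v) =
        ((f v * Real.exp (-s.re * v) : ℝ) : ℂ) * Complex.exp (((-s.im * v : ℝ) : ℂ) * Complex.I) := by
      intro v
      push_cast
      rw [mul_assoc, ← Complex.exp_add]
      congr 2
      apply Complex.ext <;> simp
    simp_rw [h2]
    refine Integrable.mul_bdd (c := 1) h1 (by fun_prop) ?_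
    exact Filter.Eventually.of_forall fun v => (Complex.norm_exp_ofReal_mul_I _).le
  have hDE : ∀ s : ℂ, 1 < s.re → ∫ v : ℝ in Ioi 0, (D v : ℂ) * Complex.exp (-s * v) = E s := by
    intro s hs
    simp_rw [hDexpC]
    rw [integral_sub, integral_const_mul, laplace_inv_sqrt (by simpa using hs), hE s hs]
    · ring
    · exact toC N s (hN _ hs)
    · exact (toC _ (s - 1) (integrableOn_inv_sqrt_mul_exp (by simpa using hs))).const_mul _
  set I0 : ℝ := ∫ t : ℝ, |t| ^ (-(1 / 2) : ℝ) / (1 + |t|) with hI0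
  have hI0nn : 0 ≤ I0 := integral_nonneg fun t => by positivity
  have hYc : Continuous fun u => ∫ v in Ioc 0 u, D v := by
    have hloc : ∀ a b : ℝ, IntervalIntegrable ((Ioi (0 : ℝ)).indicator D) volume a b := by
      intro a b
      have h1 : Integrable ((Ioi (0 : ℝ)).indicator fun v => D v * Real.exp (-2 * v)) :=
        (hDi 2 (by norm_num)).integrable_indicator measurableSet_Ioi
      have h2 := h1.intervalIntegrable (a := a) (b := b)
      have h3 := h2.mul_continuousOn (g := fun v : ℝ => Real.exp (2 * v)) (by fun_prop)
      refine h3.congr (fun v _ => ?_)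
      by_cases hv : v ∈ Ioi (0 : ℝ)
      · simp only [Set.indicator_of_mem hv]
        rw [mul_assoc, ← Real.exp_add]; simp
      · simp [Set.indicator_of_notMem hv]
    have h := intervalIntegral.continuous_primitive hloc 0
    convert h using 2 with u
    rcases le_total 0 u with hu | hu
    · rw [intervalIntegral.integral_of_le hu]
      refine setIntegral_congr_fun measurableSet_Ioc fun v hv => ?_
      simp [hv.1]
    · rw [Ioc_eq_empty (by simpa using hu), intervalIntegral.integral_of_ge hu]
      simp only [Measure.restrict_empty, integral_zero_measure]
      rw [setIntegral_eq_zero_of_forall_eq_zero]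
      · simp
      · intro v hv
        simp [hv.2]
  refine ⟨2 * Real.pi * (6 * M * I0) * Real.exp 1 + 1, by positivity, fun u hu => ?_⟩
  have hu0 : 0 < u := by linarith
  set σ : ℝ := 1 + 1 / u with hσdef
  have hσ1 : 1 < σ := by rw [hσdef]; linarith [one_div_pos.mpr hu0]
  have hσ2 : σ ≤ 2 := by
    have : 1 / u ≤ 1 := by rw [div_le_one hu0]; exact hu
    linarith
  obtain ⟨hGi, hLap⟩ := laplace_primitive (by linarith) (hDi σ hσ1)
  set z : ℝ → ℂ := fun ξ => (σ : ℂ) + ((2 * Real.pi * ξ : ℝ) : ℂ) * Complex.I with hz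
  have hzre : ∀ ξ, (z ξ).re = σ := fun ξ => by rw [hz]; simp only [Complex.add_re, Complex.ofReal_re, Complex.re_ofReal_mul, Complex.I_re, mul_zero, add_zero]
  have hzim : ∀ ξ, (z ξ).im = 2 * Real.pi * ξ := fun ξ => by rw [hz]; simp only [Complex.add_im, Complex.ofReal_im, Complex.im_ofReal_mul, Complex.I_im, mul_one, zero_add]
  have hz0 : ∀ ξ, z ξ ≠ 0 := fun ξ h => by
    have := hzre ξ; rw [h] at this; simp at this; linarith
  set G : ℝ → ℂ := fun u => (((∫ v in Ioc 0 u, D v) * Real.exp (-σ * u) : ℝ) : ℂ) with hG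
  set H : ℝ → ℂ := fun ξ => (z ξ)⁻¹ * E (z ξ) with hH
  set H' : ℝ → ℂ := fun ξ => (2 * Real.pi * Complex.I) *
    ((z ξ)⁻¹ * E' (z ξ) - ((z ξ) ^ 2)⁻¹ * E (z ξ)) with hH'
  have hFour : FourierTransform.fourier G = H := by
    funext ξ
    rw [Real.fourier_real_eq_integral_exp_smul, hH]
    simp only
    rw [← hDE _ (by rw [hzre]; exact hσ1), ← hLap _ (hzre ξ)]
    congr 1
    funext u
    rw [hG, smul_eq_mul]
    push_cast
    rw [mul_left_comm, ← Complex.exp_add]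
    congr 2
    rw [hz]
    push_cast
    ring
  have hzder : ∀ ξ, HasDerivAt z (2 * Real.pi * Complex.I) ξ := by
    intro ξ
    have h1 : HasDerivAt (fun ξ : ℝ => ((2 * Real.pi * ξ : ℝ) : ℂ)) (((2 * Real.pi * 1 : ℝ)) : ℂ) ξ :=
      ((hasDerivAt_id ξ).const_mul (2 * Real.pi)).ofReal_comp
    have h2 := (h1.mul_const Complex.I).const_add (σ : ℂ)
    refine h2.congr_deriv ?_
    push_cast; ring
  have hHd : ∀ ξ, HasDerivAt H (H' ξ) ξ := by
    intro ξ
    have h1 : HasDerivAt (fun ξ => E (z ξ)) (E' (z ξ) * (2 * Real.pi * Complex.I)) ξ :=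
      HasDerivAt.comp (𝕜' := ℂ) ξ (hd _ (by rw [hzre]; exact hσ1)) (hzder ξ)
    have h2 := ((hzder ξ).inv (hz0 ξ)).mul h1
    refine h2.congr_deriv ?_
    rw [hH', Pi.inv_apply]
    have := hz0 ξ
    field_simp
    ring
  have hnz : ∀ ξ, (1 + |ξ|) / 2 ≤ ‖z ξ‖ := by
    intro ξ
    have h1 := Complex.abs_re_le_norm (z ξ)
    have h2 := Complex.abs_im_le_norm (z ξ)
    rw [hzre, abs_of_pos (by linarith)] at h1
    rw [hzim, abs_mul, abs_of_pos Real.two_pi_pos] at h2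
    nlinarith [Real.pi_gt_three, abs_nonneg ξ]
  have hnz1 : ∀ ξ, 1 ≤ ‖z ξ‖ := by
    intro ξ
    have h1 := Complex.abs_re_le_norm (z ξ)
    rw [hzre, abs_of_pos (by linarith)] at h1
    linarith
  have hbz : ∀ ξ, ξ ≠ 0 → ‖E (z ξ)‖ ≤ M * |ξ| ^ (-(1 / 2) : ℝ) ∧ ‖E' (z ξ)‖ ≤ M * |ξ| ^ (-(1 / 2) : ℝ) := by
    intro ξ hξ
    have him : (z ξ).im ≠ 0 := by
      rw [hzim]; exact mul_ne_zero Real.two_pi_pos.ne' hξ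
    have hle : |(z ξ).im| ^ (-(1 / 2) : ℝ) ≤ |ξ| ^ (-(1 / 2) : ℝ) := by
      apply Real.rpow_le_rpow_of_nonpos (abs_pos.mpr hξ) _ (by norm_num)
      rw [hzim, abs_mul, abs_of_pos Real.two_pi_pos]
      nlinarith [Real.pi_gt_three, abs_nonneg ξ]
    obtain ⟨h1, h2⟩ := hb (z ξ) (by rw [hzre]; exact hσ1) (by rw [hzre]; exact hσ2) him
    exact ⟨h1.trans (by gcongr), h2.trans (by gcongr)⟩
  have hinv : ∀ ξ, ‖(z ξ)⁻¹‖ ≤ 2 / (1 + |ξ|) := by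
    intro ξ
    rw [norm_inv, inv_le_comm₀ (by linarith [hnz1 ξ]) (by positivity), inv_div]
    exact hnz ξ
  have hinv2 : ∀ ξ, ‖((z ξ) ^ 2)⁻¹‖ ≤ 2 / (1 + |ξ|) := by
    intro ξ
    refine le_trans ?_ (hinv ξ)
    rw [norm_inv, norm_inv, norm_pow]
    have := hnz1 ξ
    apply inv_anti₀ (by linarith)
    nlinarith
  have hHb : ∀ ξ, ξ ≠ 0 → ‖H ξ‖ ≤ 2 * M * (|ξ| ^ (-(1 / 2) : ℝ) / (1 + |ξ|)) := by
    intro ξ hξ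
    rw [hH, norm_mul]
    calc _ ≤ 2 / (1 + |ξ|) * (M * |ξ| ^ (-(1 / 2) : ℝ)) :=
          mul_le_mul (hinv ξ) (hbz ξ hξ).1 (norm_nonneg _) (by positivity)
      _ = _ := by ring
  have hH'b : ∀ ξ, ξ ≠ 0 → ‖H' ξ‖ ≤ 2 * Real.pi * (4 * M) * (|ξ| ^ (-(1 / 2) : ℝ) / (1 + |ξ|)) := by
    intro ξ hξ
    have h1 : ‖(2 * Real.pi * Complex.I : ℂ)‖ = 2 * Real.pi := by
      simp [abs_of_pos Real.pi_pos]
    rw [hH', norm_mul, h1]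
    have h2 : ‖(z ξ)⁻¹ * E' (z ξ) - ((z ξ) ^ 2)⁻¹ * E (z ξ)‖ ≤
        2 / (1 + |ξ|) * (M * |ξ| ^ (-(1 / 2) : ℝ)) + 2 / (1 + |ξ|) * (M * |ξ| ^ (-(1 / 2) : ℝ)) := by
      refine (norm_sub_le _ _).trans ?_
      rw [norm_mul, norm_mul]
      exact add_le_add (mul_le_mul (hinv ξ) (hbz ξ hξ).2 (norm_nonneg _) (by positivity))
        (mul_le_mul (hinv2 ξ) (hbz ξ hξ).1 (norm_nonneg _) (by positivity))
    calc _ ≤ 2 * Real.pi * (2 / (1 + |ξ|) * (M * |ξ| ^ (-(1 / 2) : ℝ)) + 2 / (1 + |ξ|) * (M * |ξ| ^ (-(1 / 2) : ℝ))) := by gcongr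
      _ = _ := by ring
  have hne : ∀ᵐ ξ : ℝ, ξ ≠ 0 := by
    simp [ae_iff]
  have hHcont : Continuous H := continuous_iff_continuousAt.mpr fun ξ => (hHd ξ).continuousAt
  have hHi : Integrable H := by
    refine Integrable.mono' (integrable_inv_sqrt_abs_div.const_mul (2 * M)) hHcont.aestronglyMeasurable ?_
    filter_upwards [hne] with ξ hξ using hHb ξ hξ
  have hH'm : AEStronglyMeasurable H' volume := by
    have : H' = deriv H := funext fun ξ => (hHd ξ).deriv.symm
    rw [this]
    exact (measurable_deriv H).aestronglyMeasurable
  have hH'i : Integrable H' := by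
    refine Integrable.mono' (integrable_inv_sqrt_abs_div.const_mul (2 * Real.pi * (4 * M))) hH'm ?_
    filter_upwards [hne] with ξ hξ using hH'b ξ hξ
  have key := norm_mul_le_of_fourier (G := G) (by rw [hG]; fun_prop) hGi.ofReal hFour hHi hHd hH'i u
  have hinteg : ∫ ξ, ‖H' ξ‖ ≤ 2 * Real.pi * (4 * M) * I0 := by
    rw [hI0, ← integral_const_mul]
    refine integral_mono_ae hH'i.norm (integrable_inv_sqrt_abs_div.const_mul _) ?_
    filter_upwards [hne] with ξ hξ using hH'b ξ hξ
  rw [hG, Complex.norm_real, Real.norm_eq_abs, abs_mul, abs_of_pos hu0, Real.abs_exp] at key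
  have hexp : Real.exp (-σ * u) = (Real.exp 1 * Real.exp u)⁻¹ := by
    rw [← Real.exp_add, ← Real.exp_neg, hσdef]
    congr 1
    field_simp
    ring
  rw [hexp] at key
  have hle := key.trans hinteg
  set Y := |∫ v in Ioc 0 u, D v|
  have he1 := Real.exp_pos 1
  have heu := Real.exp_pos u
  have h1 : Y ≤ 2 * Real.pi * (4 * M) * I0 * Real.exp 1 * (Real.exp u / u) := by
    have : u * (Y * (Real.exp 1 * Real.exp u)⁻¹) = Y / (Real.exp 1 * (Real.exp u / u)) := by
      field_simp
    rw [this, div_le_iff₀ (by positivity)] at hle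
    linarith
  refine h1.trans ?_
  gcongr
  have : 2 * Real.pi * (4 * M) * I0 * Real.exp 1 ≤ 2 * Real.pi * (6 * M * I0) * Real.exp 1 := by
    have : 0 ≤ Real.pi * M * I0 * Real.exp 1 := by positivity
    nlinarith
  linarith

theorem tauberian {N : ℝ → ℝ} (hmono : MonotoneOn N (Ioi 0)) {E E' : ℂ → ℂ} {c M : ℝ} (hc : 0 ≤ c)
    (hN : ∀ σ : ℝ, 1 < σ → IntegrableOn (fun v => N v * Real.exp (-σ * v)) (Ioi 0))
    (hE : ∀ s : ℂ, 1 < s.re → E s = (∫ v : ℝ in Ioi 0, (N v : ℂ) * Complex.exp (-s * v)) -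
      c * Real.sqrt Real.pi * (s - 1) ^ (-(1 / 2) : ℂ))
    (hd : ∀ s : ℂ, 1 < s.re → HasDerivAt E (E' s) s)
    (hb : ∀ s : ℂ, 1 < s.re → s.re ≤ 2 → s.im ≠ 0 →
      ‖E s‖ ≤ M * |s.im| ^ (-(1 / 2) : ℝ) ∧ ‖E' s‖ ≤ M * |s.im| ^ (-(1 / 2) : ℝ)) :
    ∃ C : ℝ, 0 < C ∧ ∀ u : ℝ, 2 ≤ u →
      |N u - c * (Real.exp u * u ^ (-(1 / 2) : ℝ))| ≤ C * (Real.exp u * u ^ (-(3 / 4) : ℝ)) := by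
  obtain ⟨C, hC, hY⟩ := tauberian_primitive_bound hN hE hd hb
  set g : ℝ → ℝ := fun v => Real.exp v * v ^ (-(1 / 2) : ℝ) with hg
  refine ⟨2 * c + 4 * C, by positivity, fun u hu => ?_⟩
  have hu0 : 0 < u := by linarith
  set h : ℝ := u ^ (-(1 / 4) : ℝ) with hh
  have hh0 : 0 < h := Real.rpow_pos_of_pos hu0 _
  have hh1 : h ≤ 1 := Real.rpow_le_one_of_one_le_of_nonpos (by linarith) (by norm_num)
  have hgc : ContinuousOn g (Ioi 0) := by
    intro v hv
    refine ContinuousAt.continuousWithinAt ?_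
    exact Real.continuous_exp.continuousAt.mul (Real.continuousAt_rpow_const _ _ (Or.inl (ne_of_gt hv)))
  have hNint : ∀ a b : ℝ, 0 < a → a ≤ b → IntegrableOn N (Ioc a b) := by
    intro a b ha hab
    have : IntegrableOn N (Icc a b) :=
      (hmono.mono fun x hx => lt_of_lt_of_le ha hx.1).integrableOn_isCompact isCompact_Icc
    exact this.mono_set Ioc_subset_Icc_self
  have hgint : ∀ a b : ℝ, 0 < a → a ≤ b → IntegrableOn g (Ioc a b) := by
    intro a b ha hab
    have : IntegrableOn g (Icc a b) :=
      (hgc.mono fun x hx => lt_of_lt_of_le ha hx.1).integrableOn_compact isCompact_Icc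
    exact this.mono_set Ioc_subset_Icc_self
  have hDint0 : ∀ b : ℝ, IntegrableOn (fun v => N v - c * g v) (Ioc 0 b) := by
    intro b
    have h1 : IntegrableOn N (Ioc 0 b) := by
      have := (hN 2 (by norm_num)).mono_set (fun x hx => hx.1 : Ioc (0 : ℝ) b ⊆ Ioi 0)
      have h2 : IntegrableOn (fun v => N v * Real.exp (-2 * v) * Real.exp (2 * v)) (Ioc 0 b) := by
        refine (this.mul_continuousOn_of_subset (K := Icc 0 b) (by fun_prop) measurableSet_Ioc isCompact_Icc Ioc_subset_Icc_self)
      refine h2.congr_fun (fun v _ => ?_) measurableSet_Ioc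
      simp only
      rw [mul_assoc, ← Real.exp_add]; simp
    have h2 : IntegrableOn g (Ioc 0 b) := by
      rcases le_total b 0 with hb | hb
      · simp [Ioc_eq_empty (not_lt.mpr hb)]
      have := (intervalIntegral.intervalIntegrable_rpow' (a := 0) (b := b)
        (show (-1 : ℝ) < -(1 / 2) by norm_num))
      have := (this.continuousOn_mul (g := fun v : ℝ => Real.exp v) (by fun_prop)).1
      exact this
    exact h1.sub (h2.const_mul c)
  have hdiff : ∀ a b : ℝ, 0 < a → a ≤ b → (∫ v in Ioc 0 b, (N v - c * g v)) -
      (∫ v in Ioc 0 a, (N v - c * g v)) = (∫ v in Ioc a b, N v) - c * ∫ v in Ioc a b, g v := by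
    intro a b ha hab
    rw [← Ioc_union_Ioc_eq_Ioc ha.le hab, setIntegral_union (Ioc_disjoint_Ioc_of_le le_rfl) measurableSet_Ioc
      (hDint0 a) ((hDint0 b).mono_set (Ioc_subset_Ioc_left ha.le)), integral_sub (hNint a b ha hab)
      ((hgint a b ha hab).const_mul c), integral_const_mul]
    ring
  have hvol : ∀ a b : ℝ, a ≤ b → ∀ k : ℝ, ∫ _ in Ioc a b, k = (b - a) * k := by
    intro a b hab k
    simp [hab]
  have hux : u ^ (-(3 / 4) : ℝ) = h * u ^ (-(1 / 2) : ℝ) := by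
    rw [hh, ← Real.rpow_add hu0]; norm_num
  have hux2 : h * u ^ (-(3 / 4) : ℝ) = 1 / u := by
    rw [hh, ← Real.rpow_add hu0]
    norm_num
    exact Real.rpow_neg_one u
  have hU := Real.exp_pos u
  set r := u ^ (-(1 / 2) : ℝ) with hr
  have hr0 : 0 < r := Real.rpow_pos_of_pos hu0 _
  set q := u ^ (-(3 / 4) : ℝ) with hq
  have hq0 : 0 < q := Real.rpow_pos_of_pos hu0 _
  have hexp_le : Real.exp h ≤ 1 + 2 * h := by
    have := Real.abs_exp_sub_one_le (x := h) (by rw [abs_of_pos hh0]; exact hh1)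
    rw [abs_of_pos hh0] at this
    linarith [(abs_le.mp this).2]
  rw [abs_le]
  constructor
  · have h1 := hdiff (u - h) u (by linarith) (by linarith)
    have hN1 : ∫ v in Ioc (u - h) u, N v ≤ h * N u := by
      calc _ ≤ ∫ v in Ioc (u - h) u, N u := by
            refine setIntegral_mono_on (hNint _ _ (by linarith) (by linarith)) (by simp)
              measurableSet_Ioc fun v hv => ?_
            exact hmono (show 0 < v by linarith [hv.1]) hu0 hv.2
        _ = _ := by rw [hvol _ _ (by linarith)]; ring
    have hg1 : h * ((1 - h) * Real.exp u * r) ≤ ∫ v in Ioc (u - h) u, g v := by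
      calc _ = ∫ v in Ioc (u - h) u, ((1 - h) * Real.exp u * r) := by rw [hvol _ _ (by linarith)]; ring
        _ ≤ _ := by
            refine setIntegral_mono_on (integrableOn_const (by simp)) (hgint _ _ (by linarith) (by linarith))
              measurableSet_Ioc fun v hv => ?_
            have hv0 : 0 < v := by linarith [hv.1]
            rw [hg]
            simp only
            apply mul_le_mul _ _ hr0.le (Real.exp_pos v).le
            · calc (1 - h) * Real.exp u ≤ Real.exp (-h) * Real.exp u := by
                    gcongr; linarith [Real.add_one_le_exp (-h)]
                _ = Real.exp (u - h) := by rw [← Real.exp_add]; congr 1; ring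
                _ ≤ _ := Real.exp_le_exp.mpr hv.1.le
            · exact Real.rpow_le_rpow_of_nonpos hv0 hv.2 (by norm_num)
    have hY1 := hY u (by linarith)
    have hY2 := hY (u - h) (by linarith)
    have h3 : Real.exp (u - h) / (u - h) ≤ 2 * (Real.exp u / u) := by
      rw [← mul_div_assoc, div_le_div_iff₀ (by linarith) hu0]
      have : Real.exp (u - h) ≤ Real.exp u := Real.exp_le_exp.mpr (by linarith)
      nlinarith [Real.exp_pos (u - h)]
    have h4 : -(3 * C * (Real.exp u / u)) ≤ h * N u - c * (h * ((1 - h) * Real.exp u * r)) := by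
      have e1 := (abs_le.mp hY1).1
      have e2 := (abs_le.mp hY2).2
      have e3 := mul_le_mul_of_nonneg_left hg1 hc
      have e4 := mul_le_mul_of_nonneg_left h3 hC.le
      linarith
    have h5 : Real.exp u / u = Real.exp u * (h * q) := by rw [hux2]; ring
    rw [h5] at h4
    have h6 : h * (-(3 * C * (Real.exp u * q))) ≤ h * (N u - c * ((1 - h) * Real.exp u * r)) := by
      linarith
    have h7 := le_of_mul_le_mul_left h6 hh0
    have h8 : c * ((1 - h) * Real.exp u * r) = c * (Real.exp u * r) - c * (Real.exp u * q) := by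
      rw [hux]; ring
    rw [h8] at h7
    have h9 : 0 ≤ c * (Real.exp u * q) := by positivity
    have h10 : 0 ≤ C * (Real.exp u * q) := by positivity
    linarith
  · have h1 := hdiff u (u + h) hu0 (by linarith)
    have hN1 : h * N u ≤ ∫ v in Ioc u (u + h), N v := by
      calc _ = ∫ v in Ioc u (u + h), N u := by rw [hvol _ _ (by linarith)]; ring
        _ ≤ _ := by
            refine setIntegral_mono_on (by simp) (hNint _ _ (by linarith) (by linarith))
              measurableSet_Ioc fun v hv => ?_
            exact hmono hu0 (show 0 < v by linarith [hv.1]) hv.1.le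
    have hg1 : ∫ v in Ioc u (u + h), g v ≤ h * ((1 + 2 * h) * Real.exp u * r) := by
      calc _ ≤ ∫ v in Ioc u (u + h), ((1 + 2 * h) * Real.exp u * r) := by
            refine setIntegral_mono_on (hgint _ _ (by linarith) (by linarith)) (integrableOn_const (by simp))
              measurableSet_Ioc fun v hv => ?_
            have hv0 : 0 < v := by linarith [hv.1]
            rw [hg]
            simp only
            apply mul_le_mul _ _ (Real.rpow_pos_of_pos hv0 _).le (by positivity)
            · calc Real.exp v ≤ Real.exp (u + h) := Real.exp_le_exp.mpr hv.2
                _ = Real.exp h * Real.exp u := by rw [← Real.exp_add]; congr 1; ring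
                _ ≤ _ := by gcongr
            · exact Real.rpow_le_rpow_of_nonpos hu0 hv.1.le (by norm_num)
        _ = _ := by rw [hvol _ _ (by linarith)]; ring
    have hY1 := hY u (by linarith)
    have hY2 := hY (u + h) (by linarith)
    have h3 : Real.exp (u + h) / (u + h) ≤ 3 * (Real.exp u / u) := by
      rw [← mul_div_assoc, div_le_div_iff₀ (by linarith) hu0]
      have : Real.exp (u + h) ≤ 3 * Real.exp u := by
        rw [add_comm, Real.exp_add]; gcongr; linarith
      nlinarith [Real.exp_pos (u + h)]
    have h4 : h * N u - c * (h * ((1 + 2 * h) * Real.exp u * r)) ≤ 4 * C * (Real.exp u / u) := by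
      have e1 := (abs_le.mp hY1).1
      have e2 := (abs_le.mp hY2).2
      have e3 := mul_le_mul_of_nonneg_left hg1 hc
      have e4 := mul_le_mul_of_nonneg_left h3 hC.le
      linarith
    have h5 : Real.exp u / u = Real.exp u * (h * q) := by rw [hux2]; ring
    rw [h5] at h4
    have h6 : h * (N u - c * ((1 + 2 * h) * Real.exp u * r)) ≤ h * (4 * C * (Real.exp u * q)) := by
      linarith
    have h7 := le_of_mul_le_mul_left h6 hh0
    have h8 : c * ((1 + 2 * h) * Real.exp u * r) = c * (Real.exp u * r) + 2 * c * (Real.exp u * q) := by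
      rw [hux]; ring
    rw [h8] at h7
    linarith

end

section

open MeasureTheory Set Filter DirichletCharacter Topology

/-- The number of elements of `S` in `[1, x]`. -/
def countSet (S : Set ℕ) (x : ℝ) : ℕ := by
  classical exact ((Finset.Icc 1 ⌊x⌋₊).filter (· ∈ S)).card

theorem countSet_eq (S : Set ℕ) [DecidablePred (· ∈ S)] (x : ℝ) :
    countSet S x = ((Finset.Icc 1 ⌊x⌋₊).filter (· ∈ S)).card := by
  unfold countSet
  congr

theorem countSet_mono (S : Set ℕ) : Monotone (countSet S) := fun x y hxy => by
  classical
  rw [countSet_eq, countSet_eq]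
  exact Finset.card_le_card (Finset.filter_subset_filter _
    (Finset.Icc_subset_Icc_right (Nat.floor_mono hxy)))

theorem countSet_le (S : Set ℕ) {x : ℝ} (hx : 0 ≤ x) : (countSet S x : ℝ) ≤ x := by
  classical
  rw [countSet_eq]
  refine le_trans (Nat.cast_le.mpr (Finset.card_filter_le _ _)) ?_
  simpa using Nat.floor_le hx

theorem sum_primeInd (P : ℕ → Prop) (x : ℝ) :
    ∑ k ∈ Finset.Icc 1 ⌊x⌋₊, primeInd P k = countSet (primeSet P) x := by
  classical
  rw [countSet_eq, Finset.card_filter]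
  push_cast
  refine Finset.sum_congr rfl fun k _ => ?_
  rw [primeInd_apply]

theorem integral_Ioi_zero_exp {g : ℝ → ℂ} :
    ∫ v in Ioi (0 : ℝ), (Real.exp v : ℂ) * g (Real.exp v) = ∫ t in Ioi (1 : ℝ), g t := by
  have himg : Real.exp '' Ioi 0 = Ioi 1 := by
    ext t
    constructor
    · rintro ⟨v, hv, rfl⟩
      exact Real.one_lt_exp_iff.mpr hv
    · intro ht
      exact ⟨Real.log t, Real.log_pos ht, Real.exp_log (zero_lt_one.trans ht)⟩
  rw [← himg, integral_image_eq_integral_abs_deriv_smul measurableSet_Ioi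
    (fun v _ => (Real.hasDerivAt_exp v).hasDerivWithinAt) Real.exp_injective.injOn]
  refine setIntegral_congr_fun measurableSet_Ioi fun v _ => ?_
  simp [abs_of_pos (Real.exp_pos v)]

theorem LSeries_primeInd_eq_integral (P : ℕ → Prop) {s : ℂ} (hs : 1 < s.re) :
    ∫ v in Ioi (0 : ℝ), ((countSet (primeSet P) (Real.exp v) : ℝ) : ℂ) * Complex.exp (-s * v) =
      LSeries (primeInd P) s / s := by
  have hs0 : s ≠ 0 := by rintro rfl; simp at hs; linarith
  have hO : (fun n : ℕ => ∑ k ∈ Finset.Icc 1 n, primeInd P k) =O[atTop]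
      fun n : ℕ => (n : ℝ) ^ (1 : ℝ) := by
    refine Asymptotics.IsBigO.of_bound 1 (Eventually.of_forall fun n => ?_)
    have h1 := sum_primeInd P n
    rw [Nat.floor_natCast] at h1
    rw [h1, one_mul, Real.rpow_one, Complex.norm_natCast, Real.norm_natCast]
    exact countSet_le _ (Nat.cast_nonneg n)
  rw [LSeries_eq_mul_integral _ zero_le_one hs (LSeriesSummable_primeInd P hs) hO,
    mul_div_cancel_left₀ _ hs0, ← integral_Ioi_zero_exp]
  refine setIntegral_congr_fun measurableSet_Ioi fun v _ => ?_
  rw [sum_primeInd, Complex.cpow_def_of_ne_zero (by exact_mod_cast (Real.exp_pos v).ne'),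
    ← Complex.ofReal_log (Real.exp_pos v).le, Real.log_exp, Complex.ofReal_exp, mul_left_comm,
    ← Complex.exp_add]
  push_cast
  congr 2
  ring

theorem integrableOn_countSet_exp (S : Set ℕ) {σ : ℝ} (hσ : 1 < σ) :
    IntegrableOn (fun v => (countSet S (Real.exp v) : ℝ) * Real.exp (-σ * v)) (Ioi 0) := by
  have hmono : Monotone fun v : ℝ => (countSet S (Real.exp v) : ℝ) := fun a b hab =>
    Nat.cast_le.mpr (countSet_mono S (Real.exp_le_exp.mpr hab))
  refine Integrable.mono' (exp_neg_integrableOn_Ioi 0 (show 0 < σ - 1 by linarith))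
    (hmono.measurable.mul (by fun_prop)).aestronglyMeasurable (Eventually.of_forall fun v => ?_)
  rw [Real.norm_of_nonneg (by positivity)]
  refine (mul_le_mul_of_nonneg_right (countSet_le S (Real.exp_pos v).le)
    (Real.exp_pos _).le).trans_eq ?_
  rw [← Real.exp_add]
  congr 1
  ring

theorem exists_landau_bound {N : ℕ} [NeZero N] (hN : N ≠ 1) {χ : DirichletCharacter ℂ N}
    (hχ : χ ^ 2 = 1) (hχ1 : χ ≠ 1) :
    ∃ K₁ : ℝ, 0 < K₁ ∧ (K₁ : ℂ) ^ 2 = (∏ p ∈ N.primeFactors, (1 - (p : ℂ) ^ (-1 : ℂ))) *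
        LFunction χ 1 / LSeries (primeInd fun p => χ (p : ZMod N) = -1) 2 ∧
      ∃ M : ℝ, ∀ s : ℂ, 1 < s.re → s.re ≤ 2 → s.im ≠ 0 →
        ‖LSeries (primeInd fun p => χ (p : ZMod N) = 1) s / s - K₁ * (s - 1) ^ (-(1 / 2) : ℂ)‖ ≤
          M * |s.im| ^ (-(1 / 2) : ℝ) ∧
        ‖-LSeries (LSeries.logMul (primeInd fun p => χ (p : ZMod N) = 1)) s / s -
          LSeries (primeInd fun p => χ (p : ZMod N) = 1) s / s ^ 2 -
          K₁ * (-(1 / 2) * (s - 1) ^ (-(1 / 2) - 1 : ℂ))‖ ≤ M * |s.im| ^ (-(1 / 2) : ℝ) := by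
  set F := LSeries (primeInd fun p => χ (p : ZMod N) = 1) with hF
  set w : ℂ → ℂ := fun s => LSeries (primeInd fun p => χ (p : ZMod N) = -1) (2 * s) with hw
  have hwne : ∀ s : ℂ, 1 ≤ s.re → w s ≠ 0 := fun s hs h0 => by
    have h1 := norm_LSeries_primeInd_sub_one_le (fun p => χ (p : ZMod N) = -1)
      (z := 2 * s) (by simpa using hs)
    have h2 : LSeries (primeInd fun p => χ (p : ZMod N) = -1) (2 * s) = 0 := h0
    rw [h2] at h1
    norm_num at h1
  have hwd : DifferentiableOn ℂ w {s | 1 / 2 < s.re} := fun s hs =>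
    (hasDerivAt_LSeries_two_mul _ hs).differentiableAt.differentiableWithinAt
  have hV : IsOpen {s : ℂ | 1 / 2 < s.re} := isOpen_lt continuous_const Complex.continuous_re
  set U : Set ℂ := {s | 1 / 2 < s.re} ∩ w ⁻¹' {0}ᶜ with hUdef
  have hU : IsOpen U := hwd.continuousOn.isOpen_inter_preimage hV isOpen_compl_singleton
  have hKU : Icc (1 : ℝ) 2 ×ℂ Icc (-1) 1 ⊆ U := fun s hs => by
    rw [Complex.mem_reProdIm] at hs
    exact ⟨lt_of_lt_of_le (by norm_num) hs.1.1, hwne s hs.1.1⟩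
  set Q : ℂ → ℂ := fun s => (∏ p ∈ N.primeFactors, (1 - (p : ℂ) ^ (-s))) * riemannZeta₁ s *
    LFunction χ s / w s with hQdef
  have hQ : DifferentiableOn ℂ Q U := by
    refine DifferentiableOn.div (((DifferentiableOn.fun_finsetProd fun p hp => ?_).mul
      differentiable_riemannZeta₁.differentiableOn).mul
      (differentiable_LFunction hχ1).differentiableOn) (hwd.mono inter_subset_left)
      fun s hs => hs.2
    have : (p : ℂ) ≠ 0 := by exact_mod_cast (Nat.prime_of_mem_primeFactors hp).ne_zero
    refine Differentiable.differentiableOn ?_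
    exact (differentiable_const _).sub (differentiable_neg.const_cpow (Or.inl this))
  have hfac : ∀ s : ℂ, 1 ≤ s.re → ∏ p ∈ N.primeFactors, (1 - (p : ℂ) ^ (-s)) ≠ 0 := fun s hs => by
    refine Finset.prod_ne_zero_iff.mpr fun p hp h0 => ?_
    have hp' := Nat.prime_of_mem_primeFactors hp
    have h1 : ‖(p : ℂ) ^ (-s)‖ = 1 := by rw [← sub_eq_zero.mp h0]; simp
    rw [Complex.norm_natCast_cpow_of_pos hp'.pos] at h1
    have h2 : (p : ℝ) ^ (-s).re < 1 := Real.rpow_lt_one_of_one_lt_of_neg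
      (by exact_mod_cast hp'.one_lt) (by simp; linarith)
    linarith
  have hQ0 : ∀ s ∈ Icc (1 : ℝ) 2 ×ℂ Icc (-1) 1, Q s ≠ 0 := fun s hs => by
    rw [Complex.mem_reProdIm] at hs
    have hre := hs.1.1
    refine div_ne_zero (mul_ne_zero (mul_ne_zero (hfac s hre) ?_)
      (LFunction_ne_zero_of_one_le_re χ (Or.inl hχ1) hre)) (hwne s hre)
    rcases eq_or_ne s 1 with rfl | hs1
    · simp [riemannZeta₁_one]
    · intro h0
      exact riemannZeta_ne_zero_of_one_le_re hre
        (by rw [riemannZeta_eq_inv_sub_mul hs1, h0, mul_zero])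
  have hFQ : ∀ s : ℂ, 1 < s.re → F s ^ 2 * (s - 1) = Q s := fun s hs => by
    have hs0 := sub_one_ne_zero_of_one_lt_re hs
    have hs1 : s ≠ 1 := sub_ne_zero.mp hs0
    have h1 := LFunction_mul_eq hN hχ hs
    rw [LFunctionTrivChar_eq_mul_riemannZeta hs1] at h1
    rw [hQdef, eq_div_iff (hwne s hs.le), mul_right_comm, h1, riemannZeta_eq_inv_sub_mul hs1]
    field_simp
  obtain ⟨K₁, hK₁, hK₁sq, C, hC, hb⟩ := exists_sqrt_singularity hU hKU
    (F := F) (F' := fun s => -LSeries (LSeries.logMul (primeInd fun p => χ (p : ZMod N) = 1)) s)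
    hQ hQ0 (fun s hs => hasDerivAt_LSeries_primeInd _ hs) hFQ
    (fun σ _ => LSeries_primeInd_real _ σ)
  refine ⟨K₁, hK₁, ?_, ?_⟩
  · rw [hK₁sq, hQdef]
    simp [riemannZeta₁_one, hw]
  obtain ⟨M₁, hM₁, hnear⟩ := exists_near_bound hK₁ hC hb
  obtain ⟨M₂, hM₂, hfar⟩ := exists_landau_far_bound hN hχ
  refine ⟨M₁ + 2 * M₂ + K₁, fun s hs1 hs2 him => ?_⟩
  have hpos : 0 < |s.im| ^ (-(1 / 2) : ℝ) := Real.rpow_pos_of_pos (abs_pos.mpr him) _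
  rcases le_total |s.im| 1 with h1 | h1
  · obtain ⟨ha, hb⟩ := hnear s hs1 hs2 him h1
    have : M₁ * |s.im| ^ (-(1 / 2) : ℝ) ≤ (M₁ + 2 * M₂ + K₁) * |s.im| ^ (-(1 / 2) : ℝ) :=
      mul_le_mul_of_nonneg_right (by linarith) hpos.le
    exact ⟨ha.trans this, hb.trans this⟩
  · obtain ⟨ha, hb⟩ := hfar s hs1 hs2 h1
    have ht0 : 0 < |s.im| := by linarith
    have htn : |s.im| ≤ ‖s‖ := Complex.abs_im_le_norm s
    have hsn := one_le_norm_of_one_lt_re hs1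
    have hsub : |s.im| ≤ ‖s - 1‖ := by
      have := Complex.abs_im_le_norm (s - 1)
      simpa using this
    have hs0 := sub_one_ne_zero_of_one_lt_re hs1
    have hsplit : |s.im| ^ (1 / 2 : ℝ) = |s.im| ^ (-(1 / 2) : ℝ) * |s.im| := by
      rw [← Real.rpow_add_one ht0.ne']; norm_num
    have hdiv : ∀ z : ℂ, ‖z‖ ≤ M₂ * |s.im| ^ (1 / 2 : ℝ) →
        ‖z / s‖ ≤ M₂ * |s.im| ^ (-(1 / 2) : ℝ) := fun z hz => by
      rw [norm_div, div_le_iff₀ (by linarith)]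
      refine hz.trans ?_
      rw [hsplit, ← mul_assoc]
      exact mul_le_mul_of_nonneg_left htn (by positivity)
    have hcp : ∀ a : ℝ, a ≤ -(1 / 2) → ‖(s - 1) ^ (a : ℂ)‖ ≤ |s.im| ^ (-(1 / 2) : ℝ) := by
      intro a ha
      rw [Complex.norm_cpow_of_ne_zero hs0]
      simp only [Complex.ofReal_im, mul_zero, Real.exp_zero, div_one, Complex.ofReal_re]
      refine (Real.rpow_le_rpow_of_nonpos ht0 hsub (by linarith)).trans ?_
      exact Real.rpow_le_rpow_of_exponent_le h1 ha
    have hc1 : ‖(s - 1) ^ (-(1 / 2) : ℂ)‖ ≤ |s.im| ^ (-(1 / 2) : ℝ) := by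
      simpa using hcp (-(1 / 2)) le_rfl
    have hc2 : ‖(s - 1) ^ (-(1 / 2) - 1 : ℂ)‖ ≤ |s.im| ^ (-(1 / 2) : ℝ) := by
      simpa using hcp (-(1 / 2) - 1) (by norm_num)
    have hKn : ‖(K₁ : ℂ)‖ = K₁ := by rw [Complex.norm_real, Real.norm_of_nonneg hK₁.le]
    constructor
    · refine (norm_sub_le _ _).trans ?_
      have h2 := hdiv _ ha
      rw [norm_mul, hKn]
      have h3 := mul_le_mul_of_nonneg_left hc1 hK₁.le
      nlinarith [mul_nonneg hM₁ hpos.le, mul_nonneg hM₂ hpos.le]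
    · refine (norm_sub_le _ _).trans ((add_le_add_left (norm_sub_le _ _) _).trans ?_)
      have h2 := hdiv (-LSeries (LSeries.logMul (primeInd fun p => χ (p : ZMod N) = 1)) s)
        (by rw [norm_neg]; exact hb)
      have h3 : ‖F s / s ^ 2‖ ≤ M₂ * |s.im| ^ (-(1 / 2) : ℝ) := by
        rw [pow_two, ← div_div, norm_div]
        exact (div_le_self (norm_nonneg _) hsn).trans (hdiv _ ha)
      have h4 : ‖(K₁ : ℂ) * (-(1 / 2) * (s - 1) ^ (-(1 / 2) - 1 : ℂ))‖ ≤
          K₁ * |s.im| ^ (-(1 / 2) : ℝ) := by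
        rw [norm_mul, norm_mul, hKn]
        refine mul_le_mul_of_nonneg_left ?_ hK₁.le
        have : ‖(-(1 / 2) : ℂ)‖ = 1 / 2 := by norm_num
        rw [this]
        linarith [norm_nonneg ((s - 1) ^ (-(1 / 2) - 1 : ℂ))]
      nlinarith [mul_nonneg hM₁ hpos.le, mul_nonneg hM₂ hpos.le]

/-- Landau's theorem for the integers all of whose prime factors `p` satisfy `χ p = 1`. -/
theorem exists_countSet_asymptotic {N : ℕ} [NeZero N] (hN : N ≠ 1) {χ : DirichletCharacter ℂ N}
    (hχ : χ ^ 2 = 1) (hχ1 : χ ≠ 1) :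
    ∃ c : ℝ, 0 < c ∧ ((c ^ 2 * Real.pi : ℝ) : ℂ) =
        (∏ p ∈ N.primeFactors, (1 - (p : ℂ) ^ (-1 : ℂ))) *
        LFunction χ 1 / LSeries (primeInd fun p => χ (p : ZMod N) = -1) 2 ∧
      ∃ C : ℝ, 0 < C ∧ ∀ x : ℝ, Real.exp 2 ≤ x →
        |(countSet (primeSet fun p => χ (p : ZMod N) = 1) x : ℝ) -
          c * (x * Real.log x ^ (-(1 / 2) : ℝ))| ≤ C * (x * Real.log x ^ (-(3 / 4) : ℝ)) := by
  obtain ⟨K₁, hK₁, hK₁sq, M, hb⟩ := exists_landau_bound hN hχ hχ1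
  set F := LSeries (primeInd fun p => χ (p : ZMod N) = 1) with hF
  have hpi : 0 < Real.sqrt Real.pi := Real.sqrt_pos.mpr Real.pi_pos
  have hcK : K₁ / Real.sqrt Real.pi * Real.sqrt Real.pi = K₁ := div_mul_cancel₀ _ hpi.ne'
  refine ⟨K₁ / Real.sqrt Real.pi, by positivity, ?_, ?_⟩
  · rw [← hK₁sq, div_pow, Real.sq_sqrt Real.pi_pos.le, div_mul_cancel₀ _ Real.pi_pos.ne']
    push_cast
    rfl
  obtain ⟨C, hC, h⟩ := tauberian
    (N := fun v => (countSet (primeSet fun p => χ (p : ZMod N) = 1) (Real.exp v) : ℝ))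
    (E := fun s => F s / s - K₁ * (s - 1) ^ (-(1 / 2) : ℂ))
    (E' := fun s => -LSeries (LSeries.logMul (primeInd fun p => χ (p : ZMod N) = 1)) s / s -
          F s / s ^ 2 - K₁ * (-(1 / 2) * (s - 1) ^ (-(1 / 2) - 1 : ℂ)))
    (c := K₁ / Real.sqrt Real.pi) (M := M)
    (fun a _ b _ hab => Nat.cast_le.mpr (countSet_mono _ (Real.exp_le_exp.mpr hab)))
    (by positivity) (fun σ hσ => integrableOn_countSet_exp _ hσ)
    (fun s hs => by
      rw [LSeries_primeInd_eq_integral _ hs, ← Complex.ofReal_mul, hcK])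
    (fun s hs => by
      have hs0 : s ≠ 0 := by rintro rfl; simp at hs; linarith
      have h1 := ((hasDerivAt_LSeries_primeInd (fun p => χ (p : ZMod N) = 1) hs).div
        (hasDerivAt_id s) hs0).sub ((hasDerivAt_sub_one_cpow (-(1 / 2)) hs).const_mul (K₁ : ℂ))
      refine h1.congr_deriv ?_
      rw [id, mul_one, sub_div, pow_two, mul_div_mul_right _ _ hs0])
    hb
  refine ⟨C, hC, fun x hx => ?_⟩
  have hx0 : 0 < x := (Real.exp_pos 2).trans_le hx
  have := h (Real.log x) ((Real.le_log_iff_exp_le hx0).mpr hx)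
  simpa only [Real.exp_log hx0] using this

end

section

open MeasureTheory Set Filter DirichletCharacter Topology

theorem rpow_neg_sub_rpow_neg_le {m s : ℝ} (hm : 1 ≤ m) (hs : 1 ≤ s) (hs2 : s ≤ 2) :
    |(m + 2) ^ (-s) - m ^ (-s)| ≤ 4 / m ^ 2 := by
  have hm0 : 0 < m := by linarith
  have h1 : (m + 2) ^ (-s) ≤ m ^ (-s) :=
    Real.rpow_le_rpow_of_nonpos hm0 (by linarith) (by linarith)
  rw [abs_sub_comm, abs_of_nonneg (by linarith)]
  have hr0 : 0 < m / (m + 2) := by positivity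
  have hr1 : m / (m + 2) ≤ 1 := by rw [div_le_one (by linarith)]; linarith
  have h2 : (m + 2) ^ (-s) = m ^ (-s) * (m / (m + 2)) ^ s := by
    rw [Real.div_rpow hm0.le (by linarith), Real.rpow_neg hm0.le, Real.rpow_neg (by linarith)]
    have := (Real.rpow_pos_of_pos hm0 s).ne'
    field_simp
  have h3 : (m / (m + 2)) ^ (2 : ℝ) ≤ (m / (m + 2)) ^ s :=
    Real.rpow_le_rpow_of_exponent_ge hr0 hr1 hs2
  have h4 : m ^ (-s) ≤ m⁻¹ := by
    rw [← Real.rpow_neg_one]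
    exact Real.rpow_le_rpow_of_exponent_le hm (by linarith)
  have h5 : 1 - (m / (m + 2)) ^ 2 ≤ 4 / m := by
    rw [div_pow, one_sub_div (by positivity), div_le_div_iff₀ (by positivity) hm0]
    nlinarith
  rw [Real.rpow_two] at h3
  calc m ^ (-s) - (m + 2) ^ (-s) = m ^ (-s) * (1 - (m / (m + 2)) ^ s) := by rw [h2]; ring
    _ ≤ m⁻¹ * (4 / m) := by
        refine mul_le_mul h4 (by linarith) ?_ (by positivity)
        have := Real.rpow_le_one hr0.le hr1 (show 0 ≤ s by linarith)
        linarith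
    _ = 4 / m ^ 2 := by field_simp

theorem hasSum_indicator_range {i : ℕ → ℕ} (hi : Function.Injective i) {s : ℝ} (hs : 1 < s) :
    HasSum ((range i).indicator fun n : ℕ => (n : ℝ) ^ (-s)) (∑' k, (i k : ℝ) ^ (-s)) ∧
      Summable fun k => (i k : ℝ) ^ (-s) := by
  have hsum : Summable fun k => (i k : ℝ) ^ (-s) :=
    (Real.summable_nat_rpow.mpr (by linarith : -s < -1)).comp_injective hi
  refine ⟨(hi.hasSum_iff fun n hn => indicator_of_notMem hn _).mp ?_, hsum⟩
  convert hsum.hasSum using 1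
  ext k
  simp

variable {N : ℕ} [NeZero N] (hN : 3 ≤ N) {χ : DirichletCharacter ℂ N}
  (hχ : ∀ n : ℕ, χ n = (if n % N = 1 then 1 else 0) - (if n % N = N - 1 then 1 else 0))

omit [NeZero N] in
include hN hχ in
theorem LSeries_eq_one_add_tsum {s : ℝ} (hs : 1 < s) :
    LSeries (fun n => χ n) s =
      ((1 + ∑' k : ℕ, (((N * (k + 1) + 1 : ℕ) : ℝ) ^ (-s) -
        ((N * (k + 1) - 1 : ℕ) : ℝ) ^ (-s)) : ℝ) : ℂ) := by
  have hN0 : 0 < N := by lia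
  have hpos : ∀ k : ℕ, 3 ≤ N * (k + 1) := fun k =>
    hN.trans (Nat.le_mul_of_pos_right N k.succ_pos)
  have hA := hasSum_indicator_range (i := fun k => N * (k + 1) + 1)
    (fun a b h => by simpa [hN0.ne'] using h) hs
  have hB := hasSum_indicator_range (i := fun k => N * (k + 1) - 1)
    (fun a b h => by
      have ha := hpos a
      have hb := hpos b
      have h' : N * (a + 1) = N * (b + 1) := by simp only at h; lia
      simpa [hN0.ne'] using h') hs
  have h1 := ((hasSum_ite_eq (1 : ℕ) (1 : ℝ)).add hA.1).sub hB.1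
  rw [← add_sub, ← hA.2.tsum_sub hB.2] at h1
  have h2 := Complex.hasSum_ofReal.mpr h1
  refine HasSum.tsum_eq ?_
  convert h2 using 1
  ext n
  rcases eq_or_ne n 0 with rfl | hn
  · simp
    have hs0 : -s ≠ 0 := by linarith
    have e1 : (0 : ℝ) ^ (-s) = 0 := Real.zero_rpow hs0
    simp [e1]
  rw [LSeries.term_of_ne_zero hn, hχ n]
  have hpow : ((n : ℂ) ^ (s : ℂ))⁻¹ = (((n : ℝ) ^ (-s) : ℝ) : ℂ) := by
    rw [Complex.ofReal_cpow (Nat.cast_nonneg n), ← Complex.cpow_neg]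
    push_cast
    rfl
  rw [div_eq_mul_inv, hpow]
  have hmod : ∀ m, n % N = m → N * (n / N) + m = n := fun m h => h ▸ Nat.div_add_mod n N
  have c1 : n ∈ range (fun k => N * (k + 1) + 1) ↔ n % N = 1 ∧ n ≠ 1 := by
    constructor
    · rintro ⟨k, rfl⟩
      refine ⟨?_, by have := hpos k; simp only; lia⟩
      rw [Nat.mul_add_mod, Nat.mod_eq_of_lt (by lia)]
    · rintro ⟨h, h'⟩
      have h3 := hmod 1 h
      have h4 : n / N ≠ 0 := fun h0 => h' (by rw [h0] at h3; lia)
      refine ⟨n / N - 1, ?_⟩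
      simp only
      rw [Nat.sub_add_cancel (Nat.one_le_iff_ne_zero.mpr h4), h3]
  have c2 : n ∈ range (fun k => N * (k + 1) - 1) ↔ n % N = N - 1 := by
    constructor
    · rintro ⟨k, rfl⟩
      have h5 : N * (k + 1) - 1 = N * k + (N - 1) := by rw [Nat.mul_succ]; lia
      simp only
      rw [h5, Nat.mul_add_mod, Nat.mod_eq_of_lt (by lia)]
    · intro h
      have h3 := hmod _ h
      refine ⟨n / N, ?_⟩
      simp only
      rw [Nat.mul_succ]
      lia
  simp only [indicator, c1, c2]
  by_cases e1 : n = 1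
  · subst e1
    have e2 : 1 % N = 1 := Nat.mod_eq_of_lt (by lia)
    have e3 : ¬ (1 = N - 1) := by lia
    simp [e2, e3]
  · by_cases e2 : n % N = 1
    · have e3 : ¬ (1 = N - 1) := by lia
      simp [e1, e2, e3]
    · simp only [e1, e2]
      by_cases e3 : n % N = N - 1 <;> simp [e3]

include hN hχ in
theorem LFunction_one_eq_cot :
    LFunction χ 1 = Real.pi / N * Complex.cot (Real.pi / N) := by
  have hN0 : (N : ℝ) ≠ 0 := by exact_mod_cast (by lia : N ≠ 0)
  have hχ1 : χ ≠ 1 := fun h => by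
    have h1 := hχ (N - 1)
    have hcop : IsUnit ((N - 1 : ℕ) : ZMod N) := by
      rw [Nat.cast_sub (by lia)]
      simp
    rw [h, MulChar.one_apply hcop, Nat.mod_eq_of_lt (by lia), if_neg (by lia), if_pos rfl] at h1
    norm_num at h1
  have htend : Tendsto (fun σ : ℝ => (σ : ℂ)) (𝓝[>] 1) (𝓝 1) := by
    have := (Complex.continuous_ofReal.tendsto 1).mono_left (nhdsWithin_le_nhds (s := Ioi (1 : ℝ)))
    simpa using this
  have hL : Tendsto (fun σ : ℝ => LFunction χ σ) (𝓝[>] 1) (𝓝 (LFunction χ 1)) :=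
    ((differentiable_LFunction hχ1).continuous.tendsto 1).comp htend
  set g : ℕ → ℝ := fun k => ((N * (k + 1) + 1 : ℕ) : ℝ)⁻¹ - ((N * (k + 1) - 1 : ℕ) : ℝ)⁻¹ with hg
  have hm : ∀ k : ℕ, (1 : ℝ) ≤ ((N * (k + 1) - 1 : ℕ) : ℝ) ∧
      ((N * (k + 1) + 1 : ℕ) : ℝ) = ((N * (k + 1) - 1 : ℕ) : ℝ) + 2 ∧
      (k + 1 : ℝ) ≤ ((N * (k + 1) - 1 : ℕ) : ℝ) := fun k => by
    have h1 : k + 1 + 1 ≤ N * (k + 1) := by nlinarith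
    refine ⟨by exact_mod_cast (by lia), ?_, by exact_mod_cast (by lia)⟩
    have : N * (k + 1) + 1 = N * (k + 1) - 1 + 2 := by lia
    exact_mod_cast this
  have hlim : Tendsto (fun s : ℝ => ∑' k : ℕ, (((N * (k + 1) + 1 : ℕ) : ℝ) ^ (-s) -
        ((N * (k + 1) - 1 : ℕ) : ℝ) ^ (-s))) (𝓝[>] 1) (𝓝 (∑' k, g k)) := by
    refine tendsto_tsum_of_dominated_convergence
      (bound := fun k : ℕ => 4 * ((k + 1 : ℕ) : ℝ)⁻¹ ^ 2) ?_ (fun k => ?_) ?_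
    · refine Summable.mul_left _ ?_
      have := (summable_nat_add_iff 1).mpr (Real.summable_nat_pow_inv.mpr one_lt_two)
      simpa using this
    · have hcont : ∀ m : ℕ, m ≠ 0 →
          Tendsto (fun s : ℝ => (m : ℝ) ^ (-s)) (𝓝[>] 1) (𝓝 ((m : ℝ)⁻¹)) := fun m hm => by
        have h1 : Continuous fun s : ℝ => (m : ℝ) ^ (-s) :=
          continuous_const.rpow continuous_neg fun _ => Or.inl (by exact_mod_cast hm)
        have := (h1.tendsto 1).mono_left (nhdsWithin_le_nhds (s := Ioi (1 : ℝ)))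
        simpa [Real.rpow_neg_one] using this
      refine (hcont _ (by lia)).sub (hcont _ fun h0 => ?_)
      have := (hm k).1
      rw [h0] at this
      norm_num at this
    · filter_upwards [self_mem_nhdsWithin,
        mem_nhdsWithin_of_mem_nhds (Iio_mem_nhds (show (1 : ℝ) < 2 by norm_num))] with s h1 h2 k
      obtain ⟨ha, hb, hc⟩ := hm k
      rw [hb, Real.norm_eq_abs]
      refine (rpow_neg_sub_rpow_neg_le ha (le_of_lt h1) (le_of_lt h2)).trans ?_
      rw [inv_pow, ← div_eq_mul_inv]
      push_cast
      gcongr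
  have hkey : LFunction χ 1 = ((1 + ∑' k, g k : ℝ) : ℂ) := by
    refine tendsto_nhds_unique hL ?_
    have h1 := (Complex.continuous_ofReal.tendsto _).comp (hlim.const_add 1)
    refine h1.congr' ?_
    filter_upwards [self_mem_nhdsWithin] with s hs
    rw [LFunction_eq_LSeries χ (by simpa using hs), LSeries_eq_one_add_tsum hN hχ hs]
    rfl
  have hx : ((N : ℂ)⁻¹) ∈ Complex.integerComplement := by
    rintro ⟨m, hm⟩
    have h1 : (m * N : ℂ) = 1 := by
      rw [hm]; exact inv_mul_cancel₀ (by exact_mod_cast hN0)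
    have h2 : m * (N : ℤ) = 1 := by exact_mod_cast h1
    have h3 := Int.eq_one_or_neg_one_of_mul_eq_one' h2
    lia
  have hcot := cot_series_rep' hx
  have hNC : (N : ℂ) ≠ 0 := by exact_mod_cast hN0
  have hgk : ∀ k : ℕ, (g k : ℂ) = (N : ℂ)⁻¹ *
      (1 / ((N : ℂ)⁻¹ - (k + 1)) + 1 / ((N : ℂ)⁻¹ + (k + 1))) := fun k => by
    obtain ⟨ha, hb, hc⟩ := hm k
    have h1 : (((N * (k + 1) - 1 : ℕ) : ℝ) : ℂ) = N * (k + 1) - 1 := by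
      rw [Nat.cast_sub (by nlinarith)]
      push_cast
      ring
    have h2 : (((N * (k + 1) - 1 : ℕ) : ℝ) : ℂ) ≠ 0 := by
      exact_mod_cast (by linarith : ((N * (k + 1) - 1 : ℕ) : ℝ) ≠ 0)
    have h3 : ((N : ℂ) * (k + 1) + 1) ≠ 0 := by exact_mod_cast (by lia : N * (k + 1) + 1 ≠ 0)
    rw [h1] at h2
    rw [hg]
    push_cast [h1]
    have e1 : (N : ℂ)⁻¹ - (k + 1) = -(N * (k + 1) - 1) * (N : ℂ)⁻¹ := by field_simp; ring
    have e2 : (N : ℂ)⁻¹ + (k + 1) = (N * (k + 1) + 1) * (N : ℂ)⁻¹ := by field_simp; ring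
    rw [e1, e2]
    field_simp
    ring
  rw [hkey]
  push_cast
  simp_rw [hgk]
  rw [tsum_mul_left, ← hcot]
  rw [div_eq_mul_inv (Real.pi : ℂ)]
  field_simp
  ring

end

section

open MeasureTheory Set Filter DirichletCharacter Topology

theorem hasProd_sqrt_primeInd (P : ℕ → Prop) [DecidablePred P] :
    HasProd (fun p : Nat.Primes => if P p then (1 - 1 / ((p : ℕ) : ℝ) ^ 2) ^ ((1 : ℝ) / 2) else 1)
      (‖LSeries (primeInd P) 2‖ ^ (-(1 / 2) : ℝ)) := by
  have h1 := hasProd_LSeries_hom (primeInd P) (s := 2) (by norm_num)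
    (LSeriesSummable_primeInd P (by norm_num))
  have hne : LSeries (primeInd P) 2 ≠ 0 := fun h0 => by
    have := norm_LSeries_primeInd_sub_one_le P (z := 2) (by norm_num)
    rw [h0] at this
    norm_num at this
  have hcont : ContinuousAt (fun z : ℂ => ‖z‖ ^ (-(1 / 2) : ℝ)) (LSeries (primeInd P) 2) :=
    continuous_norm.continuousAt.rpow_const (Or.inl (norm_ne_zero_iff.mpr hne))
  have h2 := hcont.tendsto.comp h1
  refine Tendsto.congr (fun s => ?_) h2
  simp only [Function.comp]
  rw [norm_prod, ← Real.finsetProd_rpow _ _ fun p _ => norm_nonneg _]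
  refine Finset.prod_congr rfl fun p _ => ?_
  have hmem : (p : ℕ) ∈ primeSet P ↔ P p := p.2.mem_primeSet
  rw [primeInd_apply]
  by_cases hp : P p
  · have hp2 : (2 : ℝ) ≤ (p : ℕ) := by exact_mod_cast p.2.two_le
    have h4 : (1 : ℝ) / ((p : ℕ) : ℝ) ^ 2 ≤ 1 := by
      rw [div_le_one (by positivity)]; nlinarith
    have h3 : (1 - 1 * ((p : ℕ) : ℂ) ^ (-2 : ℂ))⁻¹ = (((1 - 1 / ((p : ℕ) : ℝ) ^ 2)⁻¹ : ℝ) : ℂ) := by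
      rw [Complex.cpow_neg]
      have : ((p : ℕ) : ℂ) ^ (2 : ℂ) = ((p : ℕ) : ℂ) ^ 2 := by
        exact_mod_cast Complex.cpow_natCast ((p : ℕ) : ℂ) 2
      rw [this]
      push_cast
      simp
    have hn : 0 ≤ 1 - 1 / ((p : ℕ) : ℝ) ^ 2 := by linarith
    rw [if_pos (hmem.mpr hp), if_pos hp, h3, Complex.norm_real,
      Real.norm_of_nonneg (inv_nonneg.mpr hn), Real.inv_rpow hn, Real.rpow_neg hn, inv_inv]
  · rw [if_neg (mt hmem.mp hp), if_neg hp]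
    simp

theorem tprod_sqrt_primeInd (P : ℕ → Prop) :
    ∏' p : {p : Nat.Primes // P p}, ((1 - 1 / ((p : ℕ) : ℝ) ^ 2) ^ ((1 : ℝ) / 2)) =
      ‖LSeries (primeInd P) 2‖ ^ (-(1 / 2) : ℝ) := by
  classical
  rw [← (hasProd_sqrt_primeInd P).tprod_eq]
  refine (tprod_subtype {p : Nat.Primes | P p}
    fun p : Nat.Primes => (1 - 1 / ((p : ℕ) : ℝ) ^ 2) ^ ((1 : ℝ) / 2)).trans
    (tprod_congr fun p => ?_)
  rw [mulIndicator]
  congr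

theorem norm_rpow_two_mod_three :
    ‖LSeries (primeInd fun p => p % 3 = 2) 2‖ ^ (-(1 / 2) : ℝ) =
      (3 / 4) ^ ((1 : ℝ) / 2) * ‖LSeries (primeInd fun p => p % 6 = 5) 2‖ ^ (-(1 / 2) : ℝ) := by
  have h1 := (hasProd_ite_eq (⟨2, Nat.prime_two⟩ : Nat.Primes) ((3 / 4 : ℝ) ^ ((1 : ℝ) / 2))).mul
    (hasProd_sqrt_primeInd fun p => p % 6 = 5)
  refine (hasProd_sqrt_primeInd fun p => p % 3 = 2).unique ?_
  refine h1.congr_fun fun p => ?_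
  rcases eq_or_ne p ⟨2, Nat.prime_two⟩ with rfl | hp
  · norm_num
  · rw [if_neg hp, one_mul]
    have hp2 : (p : ℕ) ≠ 2 := fun h => hp (Subtype.ext h)
    have hodd := p.2.eq_two_or_odd
    have : (p : ℕ) % 3 = 2 ↔ (p : ℕ) % 6 = 5 := by lia
    simp only [this]

theorem norm_LSeries_primeInd_two (P : ℕ → Prop) :
    0 < ‖LSeries (primeInd P) 2‖ ∧ LSeries (primeInd P) 2 = (‖LSeries (primeInd P) 2‖ : ℝ) := by
  obtain ⟨r, hr, h⟩ := LSeries_primeInd_real P 2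
  push_cast at h
  have h1 := norm_LSeries_primeInd_sub_one_le P (z := 2) (by norm_num)
  have hne : r ≠ 0 := fun h0 => by
    rw [h, h0] at h1
    norm_num at h1
  rw [h, Complex.norm_real, Real.norm_of_nonneg hr]
  exact ⟨lt_of_le_of_ne hr hne.symm, rfl⟩

/-- The nontrivial character modulo 4 with complex values. -/
def chiFour : DirichletCharacter ℂ 4 := ZMod.χ₄.ringHomComp (Int.castRingHom ℂ)

/-- The nontrivial character modulo 3 with integer values. -/
def chiThreeInt : MulChar (ZMod 3) ℤ where
  toFun a :=
    match a with
    | 0 => 0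
    | 1 => 1
    | 2 => -1
  map_one' := rfl
  map_mul' := by decide
  map_nonunit' := by decide

/-- The nontrivial character modulo 3 with complex values. -/
def chiThree : DirichletCharacter ℂ 3 := chiThreeInt.ringHomComp (Int.castRingHom ℂ)

theorem chiFour_natCast (n : ℕ) :
    chiFour n = (if n % 4 = 1 then 1 else 0) - (if n % 4 = 4 - 1 then 1 else 0) := by
  have h1 : chiFour n = ((ZMod.χ₄ n : ℤ) : ℂ) := rfl
  rw [h1, ZMod.χ₄_nat_eq_if_mod_four]
  have : n % 4 < 4 := Nat.mod_lt _ (by norm_num)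
  split_ifs <;> first | lia | simp

theorem chiThree_natCast (n : ℕ) :
    chiThree n = (if n % 3 = 1 then 1 else 0) - (if n % 3 = 3 - 1 then 1 else 0) := by
  have h1 : chiThree n = ((chiThreeInt n : ℤ) : ℂ) := rfl
  have h2 : ∀ a : ZMod 3, chiThreeInt a = (if a = 1 then 1 else 0) - (if a = 2 then 1 else 0) := by
    decide
  rw [h1, h2]
  have e1 : (n : ZMod 3) = 1 ↔ n % 3 = 1 := by
    have := ZMod.natCast_eq_natCast_iff' n 1 3
    simpa using this
  have e2 : (n : ZMod 3) = 2 ↔ n % 3 = 3 - 1 := by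
    have := ZMod.natCast_eq_natCast_iff' n 2 3
    simpa using this
  simp only [e1, e2]
  split_ifs <;> simp

theorem eq_one_iff_of_natCast {N : ℕ} (hN : 3 ≤ N) {χ : DirichletCharacter ℂ N}
    (hχ : ∀ n : ℕ, χ n = (if n % N = 1 then 1 else 0) - (if n % N = N - 1 then 1 else 0)) (n : ℕ) :
    (χ n = 1 ↔ n % N = 1) ∧ (χ n = -1 ↔ n % N = N - 1) := by
  rw [hχ]
  by_cases h1 : n % N = 1
  · have : ¬ (1 = N - 1) := by lia
    simp only [h1, this]
    norm_num
  · by_cases h2 : n % N = N - 1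
    · simp only [h2]
      have : ¬ (N - 1 = 1) := by lia
      norm_num [this]
    · simp [h1, h2]

theorem pow_two_eq_one_of_natCast {N : ℕ} [NeZero N] {χ : DirichletCharacter ℂ N}
    (hχ : ∀ n : ℕ, χ n = (if n % N = 1 then 1 else 0) - (if n % N = N - 1 then 1 else 0)) :
    χ ^ 2 = 1 := by
  ext a
  have h1 : χ a ≠ 0 := (a.isUnit.map χ).ne_zero
  rw [MulChar.pow_apply_coe, MulChar.one_apply_coe]
  have h2 : (a : ZMod N) = ((a : ZMod N).val : ℕ) := (ZMod.natCast_zmod_val _).symm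
  rw [h2, hχ] at h1 ⊢
  split_ifs at h1 ⊢ <;> simp_all

theorem exists_countSet_asymptotic_of_natCast {N : ℕ} [NeZero N] (hN : 3 ≤ N)
    {χ : DirichletCharacter ℂ N}
    (hχ : ∀ n : ℕ, χ n = (if n % N = 1 then 1 else 0) - (if n % N = N - 1 then 1 else 0)) :
    ∃ c : ℝ, 0 < c ∧ c ^ 2 = (∏ p ∈ N.primeFactors, (1 - (p : ℝ)⁻¹)) *
        ((N : ℝ)⁻¹ * Real.cot (Real.pi / N)) /
        ‖LSeries (primeInd fun p => p % N = N - 1) 2‖ ∧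
      ∃ C : ℝ, 0 < C ∧ ∀ x : ℝ, Real.exp 2 ≤ x →
        |(countSet (primeSet fun p => p % N = 1) x : ℝ) -
          c * (x * Real.log x ^ (-(1 / 2) : ℝ))| ≤ C * (x * Real.log x ^ (-(3 / 4) : ℝ)) := by
  have hχ1 : χ ≠ 1 := fun h => by
    have h1 := hχ (N - 1)
    have hcop : IsUnit ((N - 1 : ℕ) : ZMod N) := by
      rw [Nat.cast_sub (by lia)]
      simp
    rw [h, MulChar.one_apply hcop, Nat.mod_eq_of_lt (by lia), if_neg (by lia), if_pos rfl] at h1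
    norm_num at h1
  obtain ⟨c, hc, hcsq, hC⟩ :=
    exists_countSet_asymptotic (by lia) (pow_two_eq_one_of_natCast hχ) hχ1
  simp only [fun p => (eq_one_iff_of_natCast hN hχ p).1, fun p => (eq_one_iff_of_natCast hN hχ p).2]
    at hcsq hC
  refine ⟨c, hc, ?_, hC⟩
  obtain ⟨hpos, heq⟩ := norm_LSeries_primeInd_two fun p => p % N = N - 1
  rw [LFunction_one_eq_cot hN hχ, heq] at hcsq
  have h1 : (Real.pi : ℂ) / N * Complex.cot (Real.pi / N) =
      ((Real.pi / N * Real.cot (Real.pi / N) : ℝ) : ℂ) := by push_cast; rfl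
  have h2 : ∏ p ∈ N.primeFactors, (1 - (p : ℂ) ^ (-1 : ℂ)) =
      ((∏ p ∈ N.primeFactors, (1 - (p : ℝ)⁻¹) : ℝ) : ℂ) := by
    push_cast
    exact Finset.prod_congr rfl fun p _ => by rw [Complex.cpow_neg_one]
  rw [h1, h2, ← Complex.ofReal_mul, ← Complex.ofReal_div] at hcsq
  have h3 := Complex.ofReal_injective hcsq
  have hpi := Real.pi_pos.ne'
  apply mul_right_cancel₀ hpi
  rw [h3]
  field_simp

theorem cot_pi_div_four : Real.cot (Real.pi / 4) = 1 := by
  rw [Real.cot_eq_cos_div_sin, Real.cos_pi_div_four, Real.sin_pi_div_four]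
  exact div_self (by positivity)

theorem cot_pi_div_three : Real.cot (Real.pi / 3) = 1 / Real.sqrt 3 := by
  rw [Real.cot_eq_cos_div_sin, Real.cos_pi_div_three, Real.sin_pi_div_three]
  field_simp

theorem eq_of_sq_eq {a b : ℝ} (ha : 0 ≤ a) (hb : 0 ≤ b) (h : a ^ 2 = b ^ 2) : a = b :=
  (sq_eq_sq₀ ha hb).mp h

theorem rpow_half_sq {a : ℝ} (ha : 0 ≤ a) : (a ^ ((1 : ℝ) / 2)) ^ 2 = a := by
  rw [← Real.sqrt_eq_rpow, Real.sq_sqrt ha]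

theorem rpow_neg_half_sq {a : ℝ} (ha : 0 ≤ a) : (a ^ (-(1 / 2) : ℝ)) ^ 2 = a⁻¹ := by
  rw [Real.rpow_neg ha, inv_pow, rpow_half_sq ha]

theorem two_rpow_five_halves_sq : ((2 : ℝ) ^ ((5 : ℝ) / 2)) ^ 2 = 32 := by
  rw [← Real.rpow_natCast, ← Real.rpow_mul (by norm_num)]
  norm_num

theorem three_rpow_three_quarters_sq : ((3 : ℝ) ^ ((3 : ℝ) / 4)) ^ 2 = 3 * Real.sqrt 3 := by
  rw [← Real.rpow_natCast, ← Real.rpow_mul (by norm_num), Real.sqrt_eq_rpow]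
  rw [← Real.rpow_one_add' (by norm_num) (by norm_num)]
  norm_num

theorem exists_countSet_four : ∃ C : ℝ, 0 < C ∧ ∀ x : ℝ, Real.exp 2 ≤ x →
    |(countSet (primeSet fun p => p % 4 = 1) x : ℝ) - 2 / 3 * H4 *
      (x * Real.log x ^ (-(1 / 2) : ℝ))| ≤ C * (x * Real.log x ^ (-(3 / 4) : ℝ)) := by
  obtain ⟨c, hc, hcsq, hC⟩ := exists_countSet_asymptotic_of_natCast (by norm_num) chiFour_natCast
  obtain ⟨hpos, -⟩ := norm_LSeries_primeInd_two fun p => p % 4 = 3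
  suffices h : 2 / 3 * H4 = c by rw [h]; exact hC
  rw [H4, tprod_sqrt_primeInd fun p => p % 4 = 3]
  refine eq_of_sq_eq (by positivity) hc.le ?_
  have hpf : Nat.primeFactors 4 = {2} := by
    rw [show 4 = 2 ^ 2 by norm_num, Nat.primeFactors_prime_pow two_ne_zero Nat.prime_two]
  have h43 : ‖LSeries (primeInd fun p => p % 4 = 4 - 1) 2‖ =
    ‖LSeries (primeInd fun p => p % 4 = 3) 2‖ := rfl
  rw [hcsq, hpf, Finset.prod_singleton, h43]
  push_cast
  rw [cot_pi_div_four, mul_pow, mul_pow, div_pow, div_pow, two_rpow_five_halves_sq,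
    rpow_neg_half_sq hpos.le]
  field_simp
  norm_num

theorem exists_countSet_three : ∃ C : ℝ, 0 < C ∧ ∀ x : ℝ, Real.exp 2 ≤ x →
    |(countSet (primeSet fun p => p % 3 = 1) x : ℝ) - 4 / 7 * H6 *
      (x * Real.log x ^ (-(1 / 2) : ℝ))| ≤ C * (x * Real.log x ^ (-(3 / 4) : ℝ)) := by
  obtain ⟨c, hc, hcsq, hC⟩ := exists_countSet_asymptotic_of_natCast (by norm_num) chiThree_natCast
  obtain ⟨hpos, -⟩ := norm_LSeries_primeInd_two fun p => p % 3 = 2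
  obtain ⟨hpos', -⟩ := norm_LSeries_primeInd_two fun p => p % 6 = 5
  suffices h : 4 / 7 * H6 = c by rw [h]; exact hC
  rw [H6, tprod_sqrt_primeInd fun p => p % 6 = 5]
  refine eq_of_sq_eq (by positivity) hc.le ?_
  have hrel := congrArg (· ^ 2) norm_rpow_two_mod_three
  simp only [mul_pow] at hrel
  rw [rpow_neg_half_sq hpos.le, rpow_neg_half_sq hpos'.le, rpow_half_sq (by norm_num)] at hrel
  have hpf : Nat.primeFactors 3 = {3} := Nat.prime_three.primeFactors
  have h32 : ‖LSeries (primeInd fun p => p % 3 = 3 - 1) 2‖ =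
    ‖LSeries (primeInd fun p => p % 3 = 2) 2‖ := rfl
  rw [hcsq, hpf, Finset.prod_singleton, h32, div_eq_mul_inv _ ‖_‖, hrel]
  push_cast
  rw [cot_pi_div_three, mul_pow, mul_pow, div_pow, div_pow, mul_pow, two_rpow_five_halves_sq,
    three_rpow_three_quarters_sq, rpow_neg_half_sq hpos'.le]
  have : 0 < Real.sqrt 3 := by positivity
  field_simp
  norm_num

end

section

open MeasureTheory Set Filter DirichletCharacter Topology

theorem sum_Ioc_sum_divisorsAntidiagonal (F : ℕ → ℕ → ℝ) (N : ℕ) :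
    ∑ m ∈ Finset.Ioc 0 N, ∑ x ∈ m.divisorsAntidiagonal, F x.1 x.2 =
      ∑ r ∈ Finset.Ioc 0 N, ∑ d ∈ Finset.Ioc 0 (N / r), F d r := by
  rw [Finset.sum_sigma', Finset.sum_sigma']
  refine Finset.sum_bij' (fun a _ => ⟨a.2.2, a.2.1⟩) (fun b _ => ⟨b.2 * b.1, (b.2, b.1)⟩)
    ?_ ?_ ?_ ?_ ?_
  · rintro ⟨m, d, r⟩ h
    simp only [Finset.mem_sigma, Finset.mem_Ioc, Nat.mem_divisorsAntidiagonal] at h ⊢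
    obtain ⟨⟨h1, h2⟩, rfl, h4⟩ := h
    have hr : 0 < r := Nat.pos_of_ne_zero (right_ne_zero_of_mul h4)
    have hd : 0 < d := Nat.pos_of_ne_zero (left_ne_zero_of_mul h4)
    refine ⟨⟨hr, le_trans (Nat.le_mul_of_pos_left r hd) h2⟩, hd, ?_⟩
    rwa [Nat.le_div_iff_mul_le hr]
  · rintro ⟨r, d⟩ h
    simp only [Finset.mem_sigma, Finset.mem_Ioc, Nat.mem_divisorsAntidiagonal] at h ⊢
    obtain ⟨⟨h1, h2⟩, h3, h4⟩ := h
    rw [Nat.le_div_iff_mul_le h1] at h4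
    have := Nat.mul_pos h3 h1
    exact ⟨⟨this, h4⟩, trivial, this.ne'⟩
  · rintro ⟨m, d, r⟩ h
    simp only [Finset.mem_sigma, Nat.mem_divisorsAntidiagonal] at h
    obtain ⟨_, rfl, _⟩ := h
    rfl
  · rintro ⟨r, d⟩ _
    rfl
  · rintro ⟨m, d, r⟩ _
    rfl

/-- The sum of the reciprocals of the elements of `S` in `[1, x]`. -/
def invSum (S : Set ℕ) (x : ℝ) : ℝ :=
  ∑ r ∈ Finset.Ioc 0 ⌊x⌋₊, S.indicator (fun r : ℕ => (r : ℝ)⁻¹) r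

theorem invSum_nonneg (S : Set ℕ) (x : ℝ) : 0 ≤ invSum S x :=
  Finset.sum_nonneg fun r _ => Set.indicator_nonneg (fun _ _ => by positivity) _

theorem countSet_eq_sum (S : Set ℕ) (x : ℝ) :
    (countSet S x : ℝ) = ∑ m ∈ Finset.Ioc 0 ⌊x⌋₊, S.indicator (fun _ => (1 : ℝ)) m := by
  classical
  rw [countSet_eq, Finset.card_filter]
  push_cast
  refine Finset.sum_congr (by ext; simp; lia) fun m _ => ?_
  simp [Set.indicator_apply]

theorem sum_indicator_log_eq (P : ℕ → Prop) (N : ℕ) :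
    ∑ m ∈ Finset.Ioc 0 N, (primeSet P).indicator (fun m : ℕ => Real.log m) m =
      ∑ r ∈ Finset.Ioc 0 N, ∑ d ∈ Finset.Ioc 0 (N / r),
        (primeSet P).indicator (fun _ => (1 : ℝ)) r *
          (primeSet P).indicator ArithmeticFunction.vonMangoldt d := by
  classical
  rw [← sum_Ioc_sum_divisorsAntidiagonal fun d r =>
        (primeSet P).indicator (fun _ => (1 : ℝ)) r *
          (primeSet P).indicator ArithmeticFunction.vonMangoldt d]
  refine Finset.sum_congr rfl fun m _ => ?_
  by_cases hm : m ∈ primeSet P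
  · rw [Set.indicator_of_mem hm, ← ArithmeticFunction.vonMangoldt_sum,
      ← Nat.sum_divisorsAntidiagonal (fun d _ => ArithmeticFunction.vonMangoldt d)]
    refine Finset.sum_congr rfl fun x hx => ?_
    obtain ⟨rfl, _⟩ := Nat.mem_divisorsAntidiagonal.mp hx
    rw [mul_mem_primeSet] at hm
    rw [Set.indicator_of_mem hm.1, Set.indicator_of_mem hm.2, one_mul]
  · rw [Set.indicator_of_notMem hm]
    refine (Finset.sum_eq_zero fun x hx => ?_).symm
    obtain ⟨rfl, _⟩ := Nat.mem_divisorsAntidiagonal.mp hx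
    rw [mul_mem_primeSet] at hm
    by_cases h1 : x.1 ∈ primeSet P
    · rw [Set.indicator_of_notMem (fun h => hm ⟨h1, h⟩), zero_mul]
    · rw [Set.indicator_of_notMem h1, mul_zero]

theorem log_le_two_mul_sum_properDivisors {m : ℕ} (hm : ¬ m.Prime) :
    Real.log m ≤ 2 * ∑ d ∈ m.properDivisors, ArithmeticFunction.vonMangoldt d := by
  rcases Nat.eq_zero_or_pos m with rfl | h0
  · simp
  have h1 : ArithmeticFunction.vonMangoldt m ≤
      ∑ d ∈ m.properDivisors, ArithmeticFunction.vonMangoldt d := by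
    by_cases hpp : IsPrimePow m
    · have h2 : ArithmeticFunction.vonMangoldt m = ArithmeticFunction.vonMangoldt m.minFac := by
        rw [ArithmeticFunction.vonMangoldt_apply, if_pos hpp,
          ArithmeticFunction.vonMangoldt_apply_prime (Nat.minFac_prime hpp.ne_one)]
      rw [h2]
      refine Finset.single_le_sum (f := fun d => ArithmeticFunction.vonMangoldt d)
        (fun _ _ => ArithmeticFunction.vonMangoldt_nonneg) ?_
      rw [Nat.mem_properDivisors]
      refine ⟨m.minFac_dvd, lt_of_le_of_ne (Nat.minFac_le h0) fun h => hm ?_⟩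
      rw [← h]
      exact Nat.minFac_prime hpp.ne_one
    · rw [ArithmeticFunction.vonMangoldt_apply, if_neg hpp]
      exact Finset.sum_nonneg fun _ _ => ArithmeticFunction.vonMangoldt_nonneg
  rw [← ArithmeticFunction.vonMangoldt_sum, 
    ← Nat.cons_self_properDivisors h0.ne', Finset.sum_cons]
  linarith

theorem sum_indicator_not_prime_log_le (P : ℕ → Prop) (N : ℕ) :
    ∑ m ∈ Finset.Ioc 0 N, (primeSet P ∩ {m | ¬ m.Prime}).indicator (fun m : ℕ => Real.log m) m ≤
      2 * ∑ r ∈ Finset.Ioc 1 N, (primeSet P).indicator (fun _ => (1 : ℝ)) r *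
        ∑ d ∈ Finset.Ioc 0 (N / r), (primeSet P).indicator ArithmeticFunction.vonMangoldt d := by
  classical
  have h0 : ∑ r ∈ Finset.Ioc 1 N, (primeSet P).indicator (fun _ => (1 : ℝ)) r *
        ∑ d ∈ Finset.Ioc 0 (N / r), (primeSet P).indicator ArithmeticFunction.vonMangoldt d =
      ∑ r ∈ Finset.Ioc 0 N, ∑ d ∈ Finset.Ioc 0 (N / r), if r = 1 then 0 else
        (primeSet P).indicator (fun _ => (1 : ℝ)) r *
          (primeSet P).indicator ArithmeticFunction.vonMangoldt d := by
    have : Finset.Ioc 1 N = (Finset.Ioc 0 N).filter (¬ · = 1) := by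
      ext r
      simp
      lia
    rw [this, Finset.sum_filter]
    refine Finset.sum_congr rfl fun r _ => ?_
    by_cases h : r = 1
    · simp [h]
    · simp [h, Finset.mul_sum]
  rw [h0, ← sum_Ioc_sum_divisorsAntidiagonal fun d r => if r = 1 then 0 else
        (primeSet P).indicator (fun _ => (1 : ℝ)) r *
          (primeSet P).indicator ArithmeticFunction.vonMangoldt d, Finset.mul_sum]
  refine Finset.sum_le_sum fun m _ => ?_
  have hnn : ∀ x ∈ m.divisorsAntidiagonal, 0 ≤ if x.2 = 1 then 0 else
        (primeSet P).indicator (fun _ => (1 : ℝ)) x.2 *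
          (primeSet P).indicator ArithmeticFunction.vonMangoldt x.1 := fun x _ => by
    split_ifs
    · exact le_rfl
    · exact mul_nonneg (Set.indicator_nonneg (fun _ _ => zero_le_one) _)
        (Set.indicator_nonneg (fun _ _ => ArithmeticFunction.vonMangoldt_nonneg) _)
  by_cases hm : m ∈ primeSet P ∩ {m | ¬ m.Prime}
  · rw [Set.indicator_of_mem hm]
    refine (log_le_two_mul_sum_properDivisors hm.2).trans ?_
    have hm0 : m ≠ 0 := hm.1.1
    have h1 : ∑ d ∈ m.properDivisors, ArithmeticFunction.vonMangoldt d =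
        ∑ d ∈ m.divisors, if d = m then 0 else ArithmeticFunction.vonMangoldt d := by
      rw [← Nat.cons_self_properDivisors hm0, Finset.sum_cons, if_pos rfl, zero_add]
      refine Finset.sum_congr rfl fun d hd => ?_
      rw [if_neg (Nat.mem_properDivisors.mp hd).2.ne]
    rw [h1, ← Nat.sum_divisorsAntidiagonal
      (fun d _ => if d = m then 0 else ArithmeticFunction.vonMangoldt d)]
    refine le_of_eq ?_
    congr 1
    refine Finset.sum_congr rfl fun x hx => ?_
    obtain ⟨rfl, _⟩ := Nat.mem_divisorsAntidiagonal.mp hx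
    have h2 := mul_mem_primeSet.mp hm.1
    rw [Set.indicator_of_mem h2.1, Set.indicator_of_mem h2.2, one_mul]
    have h3 : x.1 = x.1 * x.2 ↔ x.2 = 1 := by
      constructor
      · intro h
        exact (Nat.mul_eq_left (left_ne_zero_of_mul hm0)).mp h.symm
      · intro h
        rw [h, mul_one]
    simp only [h3]
  · rw [Set.indicator_of_notMem hm]
    exact mul_nonneg zero_le_two (Finset.sum_nonneg hnn)

theorem sum_Ioc_indicator_vonMangoldt_le (S : Set ℕ) (N : ℕ) :
    ∑ d ∈ Finset.Ioc 0 N, S.indicator ArithmeticFunction.vonMangoldt d ≤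
      (Real.log 4 + 4) * N := by
  refine le_trans ?_ (Chebyshev.psi_le_const_mul_self (Nat.cast_nonneg N))
  rw [Chebyshev.psi, Nat.floor_natCast]
  exact Finset.sum_le_sum fun d _ =>
    Set.indicator_le_self' (fun _ _ => ArithmeticFunction.vonMangoldt_nonneg) _

/-- An upper bound of Hall's type for sets of integers composed of prescribed primes. -/
theorem countSet_mul_log_le (P : ℕ → Prop) {x : ℝ} (hx : 1 ≤ x) :
    countSet (primeSet P) x * Real.log x ≤ (Real.log 4 + 5) * x * invSum (primeSet P) x := by
  have hx0 : 0 < x := by linarith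
  have h4 : 0 < Real.log 4 := Real.log_pos (by norm_num)
  have h1 : ∑ m ∈ Finset.Ioc 0 ⌊x⌋₊, (primeSet P).indicator (fun m : ℕ => Real.log m) m ≤
      (Real.log 4 + 4) * x * invSum (primeSet P) x := by
    rw [sum_indicator_log_eq, invSum, Finset.mul_sum]
    refine Finset.sum_le_sum fun r hr => ?_
    rw [← Finset.mul_sum]
    by_cases h : r ∈ primeSet P
    · rw [Set.indicator_of_mem h, Set.indicator_of_mem h, one_mul]
      refine (sum_Ioc_indicator_vonMangoldt_le _ _).trans ?_
      rw [mul_assoc]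
      refine mul_le_mul_of_nonneg_left ?_ (by positivity)
      refine Nat.cast_div_le.trans ?_
      rw [← div_eq_mul_inv]
      exact div_le_div_of_nonneg_right (Nat.floor_le hx0.le) (Nat.cast_nonneg r)
    · rw [Set.indicator_of_notMem h, Set.indicator_of_notMem h, zero_mul, mul_zero]
  have h2 : countSet (primeSet P) x * Real.log x ≤
      ∑ m ∈ Finset.Ioc 0 ⌊x⌋₊, (primeSet P).indicator (fun m : ℕ => Real.log m) m +
        x * invSum (primeSet P) x := by
    rw [countSet_eq_sum, invSum, Finset.mul_sum, Finset.sum_mul, ← Finset.sum_add_distrib]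
    refine Finset.sum_le_sum fun m hm => ?_
    have hm0 : (0 : ℝ) < m := by exact_mod_cast (Finset.mem_Ioc.mp hm).1
    by_cases h : m ∈ primeSet P
    · simp only [Set.indicator_of_mem h, one_mul]
      have h3 := Real.log_le_sub_one_of_pos (div_pos hx0 hm0)
      rw [Real.log_div hx0.ne' hm0.ne'] at h3
      rw [← div_eq_mul_inv]
      linarith
    · simp only [Set.indicator_of_notMem h]
      simp
  linarith

end

section

open MeasureTheory Set Filter DirichletCharacter Topology
open scoped ArithmeticFunction.vonMangoldt ArithmeticFunction.Moebius ArithmeticFunction.zeta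

/-- Selberg's function `Λ log + Λ * Λ`. -/
def selbergLambda : ArithmeticFunction ℝ :=
  ArithmeticFunction.pmul ArithmeticFunction.log Λ + Λ * Λ

theorem pmul_log_mul (f g : ArithmeticFunction ℝ) :
    ArithmeticFunction.pmul ArithmeticFunction.log (f * g) =
      ArithmeticFunction.pmul ArithmeticFunction.log f * g +
        f * ArithmeticFunction.pmul ArithmeticFunction.log g := by
  ext n
  simp only [ArithmeticFunction.pmul_apply, ArithmeticFunction.mul_apply,
    ArithmeticFunction.add_apply, Finset.mul_sum, ← Finset.sum_add_distrib,
    ArithmeticFunction.log_apply]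
  refine Finset.sum_congr rfl fun x hx => ?_
  obtain ⟨rfl, h⟩ := Nat.mem_divisorsAntidiagonal.mp hx
  have h1 : (x.1 : ℝ) ≠ 0 := by exact_mod_cast left_ne_zero_of_mul h
  have h2 : (x.2 : ℝ) ≠ 0 := by exact_mod_cast right_ne_zero_of_mul h
  rw [Nat.cast_mul, Real.log_mul h1 h2]
  ring

theorem selbergLambda_mul_zeta :
    selbergLambda * (ζ : ArithmeticFunction ℝ) =
      ArithmeticFunction.pmul ArithmeticFunction.log ArithmeticFunction.log := by
  have h : ArithmeticFunction.pmul ArithmeticFunction.log (ζ : ArithmeticFunction ℝ) =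
      ArithmeticFunction.log := by
    rw [ArithmeticFunction.pmul_zeta]
  calc selbergLambda * (ζ : ArithmeticFunction ℝ)
      = ArithmeticFunction.pmul ArithmeticFunction.log (Λ * (ζ : ArithmeticFunction ℝ)) := by
        rw [pmul_log_mul, h, selbergLambda, add_mul, mul_assoc Λ Λ,
          ArithmeticFunction.vonMangoldt_mul_zeta]
    _ = _ := by rw [ArithmeticFunction.vonMangoldt_mul_zeta]

theorem moebius_mul_log_sq : (μ : ArithmeticFunction ℝ) *
    ArithmeticFunction.pmul ArithmeticFunction.log ArithmeticFunction.log = selbergLambda := by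
  rw [← selbergLambda_mul_zeta, mul_comm, mul_assoc, ArithmeticFunction.coe_zeta_mul_coe_moebius,
    mul_one]

theorem selbergLambda_nonneg (n : ℕ) : 0 ≤ selbergLambda n := by
  rw [selbergLambda, ArithmeticFunction.add_apply, ArithmeticFunction.pmul_apply,
    ArithmeticFunction.mul_apply]
  exact add_nonneg (mul_nonneg (Real.log_natCast_nonneg n) ArithmeticFunction.vonMangoldt_nonneg)
    (Finset.sum_nonneg fun _ _ => mul_nonneg ArithmeticFunction.vonMangoldt_nonneg
      ArithmeticFunction.vonMangoldt_nonneg)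

theorem log_mul_vonMangoldt_le (n : ℕ) : Real.log n * Λ n ≤ selbergLambda n := by
  rw [selbergLambda, ArithmeticFunction.add_apply, ArithmeticFunction.pmul_apply,
    ArithmeticFunction.mul_apply]
  exact le_add_of_nonneg_right
    (Finset.sum_nonneg fun _ _ => mul_nonneg ArithmeticFunction.vonMangoldt_nonneg
      ArithmeticFunction.vonMangoldt_nonneg)

theorem abs_sum_mul_le_of_monotone {c g : ℕ → ℝ} (hg : ∀ k, 0 ≤ g k) (hm : Monotone g)
    (hc : ∀ j, |∑ k ∈ Finset.Ioc 0 j, c k| ≤ 1) (z : ℕ) :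
    |∑ k ∈ Finset.Ioc 0 z, c k * g k| ≤ 2 * g z := by
  have h : ∀ z, |∑ k ∈ Finset.Ioc 0 z, c k * g k - (∑ k ∈ Finset.Ioc 0 z, c k) * g z| ≤ g z := by
    intro z
    induction z with
    | zero => simpa using hg 0
    | succ z ih =>
      rw [Finset.sum_Ioc_succ_top (Nat.zero_le z), Finset.sum_Ioc_succ_top (Nat.zero_le z)]
      have h1 : ∑ k ∈ Finset.Ioc 0 z, c k * g k + c (z + 1) * g (z + 1) -
          (∑ k ∈ Finset.Ioc 0 z, c k + c (z + 1)) * g (z + 1) =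
          (∑ k ∈ Finset.Ioc 0 z, c k * g k - (∑ k ∈ Finset.Ioc 0 z, c k) * g z) -
            (∑ k ∈ Finset.Ioc 0 z, c k) * (g (z + 1) - g z) := by ring
      have h2 : 0 ≤ g (z + 1) - g z := sub_nonneg.mpr (hm (Nat.le_succ z))
      rw [h1]
      refine (abs_sub _ _).trans ?_
      rw [abs_mul, abs_of_nonneg h2]
      nlinarith [hc z]
  have h1 := h z
  have h2 : |(∑ k ∈ Finset.Ioc 0 z, c k) * g z| ≤ g z := by
    rw [abs_mul, abs_of_nonneg (hg z)]
    nlinarith [hc z, hg z]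
  have h3 := abs_add_le (∑ k ∈ Finset.Ioc 0 z, c k * g k - (∑ k ∈ Finset.Ioc 0 z, c k) * g z)
    ((∑ k ∈ Finset.Ioc 0 z, c k) * g z)
  rw [sub_add_cancel] at h3
  linarith

theorem abs_sum_residue_sub_le {q : ℕ} [NeZero q] (b b' : ZMod q) (j : ℕ) :
    |∑ k ∈ Finset.Ioc 0 j, ((if (k : ZMod q) = b then (1 : ℝ) else 0) -
      if (k : ZMod q) = b' then 1 else 0)| ≤ 1 := by
  have hq : 0 < q := NeZero.pos q
  have key : ∀ v : ZMod q, ∃ n : ℤ,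
      ∑ k ∈ Finset.Ioc 0 j, (if (k : ZMod q) = v then (1 : ℝ) else 0) = n ∧
        (j / q : ℚ) - 1 < n ∧ (n : ℚ) < j / q + 1 := by
    intro v
    have h1 := Nat.Ioc_filter_modEq_card 0 j hq v.val
    have h2 : (Finset.Ioc 0 j).filter (fun k : ℕ => (k : ZMod q) = v) =
        (Finset.Ioc 0 j).filter (· ≡ v.val [MOD q]) := by
      refine Finset.filter_congr fun k _ => ?_
      rw [← ZMod.natCast_eq_natCast_iff, ZMod.natCast_val, ZMod.cast_id]
    refine ⟨max (⌊((j : ℚ) - (v.val : ℕ)) / q⌋ - ⌊((0 : ℕ) - (v.val : ℕ) : ℚ) / q⌋) 0, ?_, ?_⟩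
    · rw [← h1, ← h2, Finset.card_filter]
      push_cast
      rfl
    · have hm : (⌊((0 : ℕ) - (v.val : ℕ) : ℚ) / q⌋) ≤ ⌊((j : ℚ) - (v.val : ℕ)) / q⌋ := by
        refine Int.floor_mono (div_le_div_of_nonneg_right ?_ (by positivity))
        simp
      rw [max_eq_left (sub_nonneg.mpr hm)]
      have e1 := Int.floor_le (((j : ℚ) - (v.val : ℕ)) / q)
      have e2 := Int.lt_floor_add_one (((j : ℚ) - (v.val : ℕ)) / q)
      have e3 := Int.floor_le (((0 : ℕ) - (v.val : ℕ) : ℚ) / q)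
      have e4 := Int.lt_floor_add_one (((0 : ℕ) - (v.val : ℕ) : ℚ) / q)
      rw [sub_div] at e1 e2 e3 e4
      push_cast at e1 e2 e3 e4 ⊢
      rw [zero_div] at e3 e4
      rw [sub_div, sub_div, zero_div]
      constructor <;> linarith
  obtain ⟨n, h1, h2, h3⟩ := key b
  obtain ⟨n', h1', h2', h3'⟩ := key b'
  rw [Finset.sum_sub_distrib, h1, h1']
  have a1 : n - n' < 2 := by
    have : ((n - n' : ℤ) : ℚ) < 2 := by push_cast; linarith
    exact_mod_cast this
  have a2 : n' - n < 2 := by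
    have : ((n' - n : ℤ) : ℚ) < 2 := by push_cast; linarith
    exact_mod_cast this
  have a3 : |n - n'| ≤ 1 := abs_le.mpr ⟨by linarith, by linarith⟩
  exact_mod_cast a3

theorem sum_Ioc_inv_sqrt_le (N : ℕ) :
    ∑ d ∈ Finset.Ioc 0 N, (√(d : ℝ))⁻¹ ≤ 2 * √(N : ℝ) := by
  induction N with
  | zero => simp
  | succ N ih =>
    rw [Finset.sum_Ioc_succ_top (Nat.zero_le N)]
    have h0 : 0 < √((N + 1 : ℕ) : ℝ) := Real.sqrt_pos.mpr (by positivity)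
    have h1 : √(N : ℝ) ≤ √((N + 1 : ℕ) : ℝ) := Real.sqrt_le_sqrt (by push_cast; linarith)
    have h2 := Real.sq_sqrt (Nat.cast_nonneg (α := ℝ) N)
    have h3 := Real.sq_sqrt (Nat.cast_nonneg (α := ℝ) (N + 1))
    have h4 : (√((N + 1 : ℕ) : ℝ))⁻¹ ≤ 2 * √((N + 1 : ℕ) : ℝ) - 2 * √(N : ℝ) := by
      rw [inv_le_iff_one_le_mul₀ h0]
      push_cast at h3 ⊢
      push_cast at h1
      nlinarith [Real.sqrt_nonneg (N : ℝ)]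
    linarith

theorem sum_Ioc_log_sq_div_le (N : ℕ) :
    ∑ d ∈ Finset.Ioc 0 N, Real.log (N / d : ℕ) ^ 2 ≤ 32 * N := by
  have h : ∀ d ∈ Finset.Ioc 0 N, Real.log (N / d : ℕ) ^ 2 ≤ 16 * √(N : ℝ) * (√(d : ℝ))⁻¹ := by
    intro d hd
    have h1 : Real.log (N / d : ℕ) ≤ (N / d : ℝ) ^ (1 / 4 : ℝ) / (1 / 4) :=
      (Real.log_le_rpow_div (ε := 1 / 4) (Nat.cast_nonneg _) (by norm_num)).trans (by
        gcongr
        exact Nat.cast_div_le)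
    have h2 : Real.log (N / d : ℕ) ^ 2 ≤ ((N / d : ℝ) ^ (1 / 4 : ℝ) / (1 / 4)) ^ 2 :=
      pow_le_pow_left₀ (Real.log_natCast_nonneg _) h1 2
    refine h2.trans (le_of_eq ?_)
    rw [mul_assoc, ← div_eq_mul_inv, ← Real.sqrt_div (Nat.cast_nonneg N), Real.sqrt_eq_rpow,
      div_pow, ← Real.rpow_natCast, ← Real.rpow_mul (by positivity)]
    norm_num
    ring
  refine (Finset.sum_le_sum h).trans ?_
  rw [← Finset.mul_sum]
  have h1 := Real.sq_sqrt (Nat.cast_nonneg (α := ℝ) N)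
  have h2 := mul_le_mul_of_nonneg_left (sum_Ioc_inv_sqrt_le N) (Real.sqrt_nonneg (N : ℝ))
  linarith

theorem sum_ite_selbergLambda {q : ℕ} (a : ZMod q) (N : ℕ) :
    ∑ n ∈ Finset.Ioc 0 N, (if (n : ZMod q) = a then selbergLambda n else 0) =
      ∑ d ∈ Finset.Ioc 0 N, (μ d : ℝ) * ∑ k ∈ Finset.Ioc 0 (N / d),
        (if (k * d : ZMod q) = a then Real.log k ^ 2 else 0) := by
  have h : ∀ n ∈ Finset.Ioc 0 N, (if (n : ZMod q) = a then selbergLambda n else 0) =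
      ∑ x ∈ n.divisorsAntidiagonal,
        (μ x.2 : ℝ) * if (x.1 * x.2 : ZMod q) = a then Real.log x.1 ^ 2 else 0 := by
    intro n _
    rw [← moebius_mul_log_sq, mul_comm, ArithmeticFunction.mul_apply]
    split_ifs with h
    · refine Finset.sum_congr rfl fun x hx => ?_
      obtain ⟨rfl, _⟩ := Nat.mem_divisorsAntidiagonal.mp hx
      rw [if_pos (by rw [← h]; push_cast; rfl)]
      simp only [ArithmeticFunction.pmul_apply, ArithmeticFunction.log_apply,
        ArithmeticFunction.intCoe_apply]
      ring
    · refine (Finset.sum_eq_zero fun x hx => ?_).symm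
      obtain ⟨rfl, _⟩ := Nat.mem_divisorsAntidiagonal.mp hx
      rw [if_neg (fun h' => h (by rw [← h']; push_cast; rfl)), mul_zero]
  rw [Finset.sum_congr rfl h, sum_Ioc_sum_divisorsAntidiagonal fun k d => (μ d : ℝ) *
    if (k * d : ZMod q) = a then Real.log k ^ 2 else 0]
  simp only [Finset.mul_sum]

theorem abs_sum_selbergLambda_sub_le {q : ℕ} [NeZero q] (a b : (ZMod q)ˣ) (N : ℕ) :
    |∑ n ∈ Finset.Ioc 0 N, (if (n : ZMod q) = a then selbergLambda n else 0) -
      ∑ n ∈ Finset.Ioc 0 N, (if (n : ZMod q) = b then selbergLambda n else 0)| ≤ 64 * N := by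
  rw [sum_ite_selbergLambda, sum_ite_selbergLambda, ← Finset.sum_sub_distrib]
  refine (Finset.abs_sum_le_sum_abs _ _).trans ?_
  have h : ∀ d ∈ Finset.Ioc 0 N, |(μ d : ℝ) * ∑ k ∈ Finset.Ioc 0 (N / d),
        (if (k * d : ZMod q) = a then Real.log k ^ 2 else 0) -
      (μ d : ℝ) * ∑ k ∈ Finset.Ioc 0 (N / d),
        (if (k * d : ZMod q) = b then Real.log k ^ 2 else 0)| ≤
      2 * Real.log (N / d : ℕ) ^ 2 := by
    intro d _
    have hμ : |(μ d : ℝ)| ≤ 1 := by exact_mod_cast ArithmeticFunction.abs_moebius_le_one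
    rw [← mul_sub, abs_mul]
    refine (mul_le_of_le_one_left (abs_nonneg _) hμ).trans ?_
    by_cases hd : IsUnit (d : ZMod q)
    · obtain ⟨u, hu⟩ := hd
      have h1 : ∀ (c : (ZMod q)ˣ) (k : ℕ),
          (if (k * d : ZMod q) = c then Real.log k ^ 2 else 0) =
            (if (k : ZMod q) = ((c * u⁻¹ : (ZMod q)ˣ) : ZMod q) then (1 : ℝ) else 0) *
              Real.log k ^ 2 := by
        intro c k
        have : (k * d : ZMod q) = c ↔ (k : ZMod q) = ((c * u⁻¹ : (ZMod q)ˣ) : ZMod q) := by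
          rw [← hu, Units.val_mul, Units.eq_mul_inv_iff_mul_eq]
        simp only [this, ite_mul, one_mul, zero_mul]
      simp only [h1, ← Finset.sum_sub_distrib, ← sub_mul]
      refine abs_sum_mul_le_of_monotone (g := fun k => Real.log k ^ 2) (fun k => sq_nonneg _)
        ?_ (fun j => abs_sum_residue_sub_le _ _ j) _
      intro k l hkl
      refine pow_le_pow_left₀ (Real.log_natCast_nonneg _) ?_ 2
      rcases Nat.eq_zero_or_pos k with rfl | hk
      · simpa using Real.log_natCast_nonneg l
      · exact Real.log_le_log (by exact_mod_cast hk) (by exact_mod_cast hkl)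
    · have h1 : ∀ (c : (ZMod q)ˣ) (k : ℕ), ¬ (k * d : ZMod q) = c := fun c k h =>
        hd (isUnit_of_mul_isUnit_right (h ▸ c.isUnit))
      simp only [h1, if_false, Finset.sum_const_zero, sub_zero, abs_zero]
      positivity
  refine (Finset.sum_le_sum h).trans ?_
  rw [← Finset.mul_sum]
  linarith [sum_Ioc_log_sq_div_le N]

theorem sum_Ioc_vonMangoldt_le (N : ℕ) : ∑ d ∈ Finset.Ioc 0 N, Λ d ≤ (Real.log 4 + 4) * N := by
  simpa using sum_Ioc_indicator_vonMangoldt_le Set.univ N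

theorem sum_Ioc_vonMangoldt_div_le {N : ℕ} (hN : 0 < N) :
    ∑ d ∈ Finset.Ioc 0 N, Λ d / d ≤ Real.log N + (Real.log 4 + 4) := by
  have hN' : (0 : ℝ) < N := by exact_mod_cast hN
  have h1 : ∑ n ∈ Finset.Ioc 0 N, Real.log n = ∑ d ∈ Finset.Ioc 0 N, Λ d * (N / d : ℕ) := by
    have h := ArithmeticFunction.sum_Ioc_mul_eq_sum_sum Λ (ζ : ArithmeticFunction ℝ) N
    rw [ArithmeticFunction.vonMangoldt_mul_zeta] at h
    simp only [ArithmeticFunction.log_apply] at h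
    rw [h]
    refine Finset.sum_congr rfl fun d _ => ?_
    congr 1
    rw [Finset.sum_congr rfl (g := fun _ => (1 : ℝ))]
    · simp
    · intro m hm
      simp [(Finset.mem_Ioc.mp hm).1.ne']
  have h2 : ∑ n ∈ Finset.Ioc 0 N, Real.log n ≤ N * Real.log N := by
    have := Finset.sum_le_card_nsmul (Finset.Ioc 0 N) (fun n : ℕ => Real.log n) (Real.log N)
      fun n hn => Real.log_le_log (by exact_mod_cast (Finset.mem_Ioc.mp hn).1)
        (by exact_mod_cast (Finset.mem_Ioc.mp hn).2)
    simpa using this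
  have h3 : N * ∑ d ∈ Finset.Ioc 0 N, Λ d / d ≤
      ∑ d ∈ Finset.Ioc 0 N, Λ d * (N / d : ℕ) + ∑ d ∈ Finset.Ioc 0 N, Λ d := by
    rw [Finset.mul_sum, ← Finset.sum_add_distrib]
    refine Finset.sum_le_sum fun d hd => ?_
    have hd0 : (0 : ℝ) < d := by exact_mod_cast (Finset.mem_Ioc.mp hd).1
    have h4 : (N / d : ℝ) ≤ (N / d : ℕ) + 1 := by
      rw [div_le_iff₀ hd0]
      have := Nat.lt_div_mul_add (a := N) (Finset.mem_Ioc.mp hd).1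
      have : (N : ℝ) < (N / d : ℕ) * d + d := by exact_mod_cast this
      linarith
    have := mul_le_mul_of_nonneg_left h4 (ArithmeticFunction.vonMangoldt_nonneg (n := d))
    calc N * (Λ d / d) = Λ d * (N / d) := by ring
      _ ≤ _ := by linarith
  have h4 := sum_Ioc_vonMangoldt_le N
  have h5 : N * ∑ d ∈ Finset.Ioc 0 N, Λ d / d ≤ N * (Real.log N + (Real.log 4 + 4)) := by
    linarith
  exact le_of_mul_le_mul_left h5 hN'

theorem sum_selbergLambda_le {N : ℕ} (hN : 0 < N) :
    ∑ n ∈ Finset.Ioc 0 N, selbergLambda n ≤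
      (Real.log 4 + 4) * N * (2 * Real.log N + (Real.log 4 + 4)) := by
  have h4 : 0 < Real.log 4 := Real.log_pos (by norm_num)
  simp only [selbergLambda, ArithmeticFunction.add_apply, Finset.sum_add_distrib]
  have h1 : ∑ n ∈ Finset.Ioc 0 N, ArithmeticFunction.pmul ArithmeticFunction.log Λ n ≤
      Real.log N * ((Real.log 4 + 4) * N) := by
    refine le_trans ?_ (mul_le_mul_of_nonneg_left (sum_Ioc_vonMangoldt_le N)
      (Real.log_natCast_nonneg N))
    rw [Finset.mul_sum]
    refine Finset.sum_le_sum fun n hn => ?_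
    rw [ArithmeticFunction.pmul_apply, ArithmeticFunction.log_apply]
    exact mul_le_mul_of_nonneg_right (Real.log_le_log
      (by exact_mod_cast (Finset.mem_Ioc.mp hn).1) (by exact_mod_cast (Finset.mem_Ioc.mp hn).2))
      ArithmeticFunction.vonMangoldt_nonneg
  have h2 : ∑ n ∈ Finset.Ioc 0 N, (Λ * Λ : ArithmeticFunction ℝ) n ≤
      (Real.log 4 + 4) * N * (Real.log N + (Real.log 4 + 4)) := by
    refine le_trans ?_ (mul_le_mul_of_nonneg_left (sum_Ioc_vonMangoldt_div_le hN)
      (by positivity))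
    rw [ArithmeticFunction.sum_Ioc_mul_eq_sum_sum, Finset.mul_sum]
    refine Finset.sum_le_sum fun d _ => ?_
    have h3 : ∑ m ∈ Finset.Ioc 0 (N / d), Λ m ≤ (Real.log 4 + 4) * (N / d) :=
      (sum_Ioc_vonMangoldt_le _).trans
        (mul_le_mul_of_nonneg_left Nat.cast_div_le (by positivity))
    refine (mul_le_mul_of_nonneg_left h3 ArithmeticFunction.vonMangoldt_nonneg).trans
      (le_of_eq (by ring))
  linarith

theorem sum_selbergLambda_residue_le {q : ℕ} [NeZero q] {N : ℕ} (hN : 0 < N) :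
    ∑ n ∈ Finset.Ioc 0 N, (if (n : ZMod q) = 1 then selbergLambda n else 0) ≤
      (Real.log 4 + 4) * N * (2 * Real.log N + (Real.log 4 + 4)) / q.totient + 64 * N := by
  classical
  have hφ : (0 : ℝ) < q.totient := by exact_mod_cast Nat.totient_pos.mpr (NeZero.pos q)
  have h1 : ∀ a : (ZMod q)ˣ,
      ∑ n ∈ Finset.Ioc 0 N, (if (n : ZMod q) = 1 then selbergLambda n else 0) ≤
      ∑ n ∈ Finset.Ioc 0 N, (if (n : ZMod q) = a then selbergLambda n else 0) + 64 * N := by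
    intro a
    have := (abs_le.mp (abs_sum_selbergLambda_sub_le (1 : (ZMod q)ˣ) a N)).2
    rw [Units.val_one] at this
    linarith
  have h2 : ∑ a : (ZMod q)ˣ, ∑ n ∈ Finset.Ioc 0 N,
      (if (n : ZMod q) = a then selbergLambda n else 0) ≤
      ∑ n ∈ Finset.Ioc 0 N, selbergLambda n := by
    rw [Finset.sum_comm]
    refine Finset.sum_le_sum fun n _ => ?_
    by_cases hn : IsUnit (n : ZMod q)
    · obtain ⟨u, hu⟩ := hn
      rw [← hu, Finset.sum_eq_single u]
      · simp
      · intro a _ ha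
        exact if_neg fun h => ha (Units.ext h).symm
      · simp
    · rw [Finset.sum_eq_zero]
      · exact selbergLambda_nonneg n
      · intro a _
        refine if_neg fun h => hn ?_
        rw [h]
        exact a.isUnit
  have h3 := Finset.sum_le_sum fun (a : (ZMod q)ˣ) (_ : a ∈ Finset.univ) => h1 a
  rw [Finset.sum_const, Finset.card_univ, ZMod.card_units_eq_totient, Finset.sum_add_distrib,
    Finset.sum_const, Finset.card_univ, ZMod.card_units_eq_totient, nsmul_eq_mul,
    nsmul_eq_mul] at h3
  have h4 := sum_selbergLambda_le hN
  rw [← sub_le_iff_le_add, le_div_iff₀ hφ]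
  linarith

/-- A Brun–Titchmarsh type upper bound. -/
theorem exists_sum_vonMangoldt_residue_le : ∃ C : ℝ, 0 < C ∧ ∀ (q : ℕ) [NeZero q] (N : ℕ), 0 < N →
    ∑ n ∈ Finset.Ioc 0 N, (if (n : ZMod q) = 1 then Λ n else 0) ≤
      C * (N / q.totient + N / (1 + Real.log N)) := by
  have h4 : 0 < Real.log 4 := Real.log_pos (by norm_num)
  obtain ⟨c, hc⟩ : ∃ c : ℝ, c = Real.log 4 + 4 := ⟨_, rfl⟩
  have hc0 : 0 < c := by rw [hc]; positivity
  refine ⟨4 * c + 2 * c ^ 2 + 128 + 3 * c, by positivity, fun q _ N hN => ?_⟩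
  have hN' : (1 : ℝ) ≤ N := by exact_mod_cast hN
  have hφ : (1 : ℝ) ≤ q.totient := by exact_mod_cast Nat.totient_pos.mpr (NeZero.pos q)
  have hlog : 0 ≤ Real.log N := Real.log_natCast_nonneg N
  set Y := ∑ n ∈ Finset.Ioc 0 N, (if (n : ZMod q) = 1 then Λ n else 0) with hY
  have hYN : Y ≤ c * N := by
    refine le_trans (Finset.sum_le_sum fun n _ => ?_) (hc ▸ sum_Ioc_vonMangoldt_le N)
    split_ifs
    · exact le_rfl
    · exact ArithmeticFunction.vonMangoldt_nonneg
  have h1 : Y * Real.log N ≤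
      2 * ∑ n ∈ Finset.Ioc 0 N, (if (n : ZMod q) = 1 then selbergLambda n else 0) +
        Real.log N * ∑ n ∈ Finset.Ioc 0 N.sqrt, Λ n := by
    have e1 : ∑ n ∈ Finset.Ioc 0 N.sqrt, Λ n =
        ∑ n ∈ Finset.Ioc 0 N, if n ≤ N.sqrt then Λ n else 0 := by
      rw [← Finset.sum_filter]
      refine Finset.sum_congr ?_ fun _ _ => rfl
      ext n
      have := Nat.sqrt_le_self N
      simp
      lia
    rw [hY, e1, Finset.sum_mul, Finset.mul_sum, Finset.mul_sum, ← Finset.sum_add_distrib]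
    refine Finset.sum_le_sum fun n hn => ?_
    have hΛ := ArithmeticFunction.vonMangoldt_nonneg (n := n)
    have hS := selbergLambda_nonneg n
    by_cases hq : (n : ZMod q) = 1
    · rw [if_pos hq, if_pos hq]
      split_ifs with hs
      · linarith
      · have e2 : (N : ℝ) ≤ (n : ℝ) ^ 2 := by
          rw [not_le, Nat.sqrt_lt'] at hs
          exact_mod_cast hs.le
        have e3 := Real.log_le_log (by linarith) e2
        rw [Real.log_pow] at e3
        push_cast at e3
        have e4 := log_mul_vonMangoldt_le n
        nlinarith
    · rw [if_neg hq, if_neg hq]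
      split_ifs
      · simp only [zero_mul, mul_zero, zero_add]
        positivity
      · simp
  have h2 : Real.log N * ∑ n ∈ Finset.Ioc 0 N.sqrt, Λ n ≤ 2 * c * N := by
    have e1 : (N.sqrt : ℝ) ≤ √N := Real.nat_sqrt_le_real_sqrt
    have e2 : Real.log N ≤ 2 * √N := by
      have := Real.log_le_rpow_div (ε := 1 / 2) (Nat.cast_nonneg N) (by norm_num)
      rw [← Real.sqrt_eq_rpow] at this
      linarith
    have e3 : ∑ n ∈ Finset.Ioc 0 N.sqrt, Λ n ≤ c * √N :=
      (hc ▸ sum_Ioc_vonMangoldt_le _).trans (mul_le_mul_of_nonneg_left e1 hc0.le)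
    have e4 := mul_le_mul e2 e3 (Finset.sum_nonneg fun _ _ => ArithmeticFunction.vonMangoldt_nonneg)
      (by positivity)
    have e5 := Real.mul_self_sqrt (Nat.cast_nonneg (α := ℝ) N)
    calc _ ≤ _ := e4
      _ = 2 * c * (√N * √N) := by ring
      _ = _ := by rw [e5]
  have h3 := sum_selbergLambda_residue_le (q := q) hN
  rw [← hc] at h3
  have h5 : Y * (1 + Real.log N) ≤
      2 * (c * N * (2 * Real.log N + c) / q.totient + 64 * N) + 3 * c * N := by linarith
  rw [← le_div_iff₀ (by linarith)] at h5
  refine h5.trans ?_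
  rw [div_le_iff₀ (by linarith), mul_assoc (_ + _ : ℝ), add_mul (_ / _),
    div_mul_cancel₀ _ (by linarith : 1 + Real.log (N : ℝ) ≠ 0)]
  set w := (N : ℝ) / q.totient with hw
  have hw0 : 0 ≤ w := by positivity
  have hwN : w ≤ N := div_le_self (by linarith) hφ
  have e : c * N * (2 * Real.log N + c) / q.totient = c * w * (2 * Real.log N + c) := by
    rw [hw]
    ring
  rw [e]
  have p1 : 0 ≤ c * w := by positivity
  have p2 : 0 ≤ c * w * Real.log N := by positivity
  have p3 : 0 ≤ w * Real.log N := by positivity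
  have p4 : c ^ 2 * w ≤ c ^ 2 * N := by gcongr
  have p5 : 0 ≤ c ^ 2 * w * Real.log N := by positivity
  have p6 : 0 ≤ c * (N : ℝ) := by positivity
  have p7 : 0 ≤ c ^ 2 * w := by positivity
  nlinarith

end

section

open MeasureTheory Set Filter DirichletCharacter Topology

theorem exp_tsum_log_eq_LSeries (f : ℕ →*₀ ℂ) {s : ℂ} (hs : 1 < s.re) (hf : LSeriesSummable f s) :
    Summable (fun p : Nat.Primes => -Complex.log (1 - f p * (p : ℂ) ^ (-s))) ∧
      Complex.exp (∑' p : Nat.Primes, -Complex.log (1 - f p * (p : ℂ) ^ (-s))) = LSeries f s := by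
  have hs0 : s ≠ 0 := by rintro rfl; simp at hs; linarith
  have h1 : Summable fun n => ‖(f * riemannZetaSummandHom hs0) n‖ := by
    rw [← LSeries_eq_tsum_hom f hs0]; exact hf.norm
  have h2 := EulerProduct.exp_tsum_primes_log_eq_tsum h1
  have h3 := h1.of_norm.clog_one_sub.neg.subtype Nat.Prime
  rw [LSeries, LSeries_eq_tsum_hom f hs0]
  exact ⟨h3, h2⟩

theorem re_sum_neg_log_ge {N : ℕ} [NeZero N] (hN : N ≠ 1) {p : ℕ} (hpp : p.Prime) {z : ℝ} (hz0 : 0 ≤ z)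
    (hz : z < 1) :
    N.totient * (-Complex.log (1 - primeInd (fun p => p % N = 1) p * z)).re ≤
      (∑ χ : DirichletCharacter ℂ N, -Complex.log (1 - χ.natHom hN p * z)).re := by
  classical
  have hnorm : ∀ c : ℂ, ‖c‖ ≤ 1 → ‖c * z‖ < 1 := fun c hc => by
    rw [norm_mul, Complex.norm_real, Real.norm_eq_abs, abs_of_nonneg hz0]
    nlinarith [norm_nonneg c]
  have h1 : ∀ χ : DirichletCharacter ℂ N,
      HasSum (fun n : ℕ => (χ.natHom hN p * z) ^ n / n) (-Complex.log (1 - χ.natHom hN p * z)) :=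
    fun χ => Complex.hasSum_taylorSeries_neg_log (hnorm _ (χ.norm_le_one _))
  have h2 := hasSum_sum (s := Finset.univ) fun χ _ => h1 χ
  have h3 : ∀ n : ℕ, ∑ χ : DirichletCharacter ℂ N, (χ.natHom hN p * z) ^ n / n =
      ((if ((p ^ n : ℕ) : ZMod N) = 1 then (N.totient : ℝ) else 0) * (z ^ n / n) : ℝ) := by
    intro n
    have e := DirichletCharacter.sum_characters_eq ℂ ((p ^ n : ℕ) : ZMod N)
    have e1 : ∀ χ : DirichletCharacter ℂ N, (χ.natHom hN p * z) ^ n / n =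
        χ ((p ^ n : ℕ) : ZMod N) * ((z ^ n / n : ℝ) : ℂ) := by
      intro χ
      have : χ ((p ^ n : ℕ) : ZMod N) = χ.natHom hN p ^ n := by
        push_cast
        rw [map_pow]
        rfl
      rw [this, mul_pow]
      push_cast
      ring
    rw [Finset.sum_congr rfl fun χ _ => e1 χ, ← Finset.sum_mul, e]
    split_ifs <;> push_cast <;> ring
  rw [funext h3] at h2
  have h4 := Complex.hasSum_re h2
  simp only [Complex.ofReal_re] at h4
  by_cases hp : p ∈ primeSet (fun p => p % N = 1)
  · have hp1 : (p : ZMod N) = 1 := by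
      rw [hpp.mem_primeSet] at hp
      rw [← Nat.cast_one, ZMod.natCast_eq_natCast_iff']
      rw [hp, Nat.mod_eq_of_lt (by have := NeZero.ne N; lia)]
    have h5 := (Complex.hasSum_re (Complex.hasSum_taylorSeries_neg_log
      (hnorm 1 (by simp)))).mul_left (N.totient : ℝ)
    have h6 : (fun n : ℕ => (N.totient : ℝ) * ((1 * (z : ℂ)) ^ n / n).re) =
        fun n : ℕ => (if ((p ^ n : ℕ) : ZMod N) = 1 then (N.totient : ℝ) else 0) * (z ^ n / n) := by
      funext n
      have : ((1 * (z : ℂ)) ^ n / n) = ((z ^ n / n : ℝ) : ℂ) := by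
        push_cast
        ring
      rw [this, Complex.ofReal_re, if_pos]
      rw [Nat.cast_pow, hp1, one_pow]
    rw [h6] at h5
    rw [primeInd_apply, if_pos hp]
    exact (h5.unique h4).le
  · rw [primeInd_apply, if_neg hp]
    simp only [zero_mul, sub_zero, Complex.log_one, neg_zero, Complex.zero_re, mul_zero]
    exact h4.nonneg fun n => by positivity

theorem norm_sum_range_le {N : ℕ} [NeZero N] {χ : DirichletCharacter ℂ N} (hχ : χ ≠ 1) (n : ℕ) :
    ‖∑ k ∈ Finset.range n, χ (k : ZMod N)‖ ≤ N := by
  have h0 : ∑ k ∈ Finset.range N, χ (k : ZMod N) = 0 := by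
    rw [← MulChar.sum_eq_zero_of_ne_one hχ]
    obtain ⟨m, rfl⟩ := Nat.exists_eq_succ_of_ne_zero (NeZero.ne N)
    rw [← Fin.sum_univ_eq_sum_range (fun k => χ (k : ZMod (m + 1)))]
    exact Finset.sum_congr rfl fun i _ => congrArg χ (ZMod.natCast_zmod_val (n := m + 1) i)
  induction n using Nat.strong_induction_on with
  | _ n ih =>
    rcases lt_or_ge n N with h | h
    · refine (norm_sum_le_of_le _ fun k _ => χ.norm_le_one _).trans ?_
      simpa using h.le
    · obtain ⟨m, rfl⟩ := Nat.exists_eq_add_of_le h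
      rw [Finset.sum_range_add, h0, zero_add]
      have := ih m (by have := NeZero.pos N; lia)
      simpa using this

theorem norm_LSeries_le_of_ne_one {N : ℕ} [NeZero N] {χ : DirichletCharacter ℂ N} (hχ : χ ≠ 1)
    {s : ℝ} (hs : 1 < s) (hs2 : s ≤ 2) :
    ‖LSeries (fun n : ℕ => χ (n : ZMod N)) s‖ ≤ 5 + Real.log N := by
  have hN : (0 : ℝ) < N := by exact_mod_cast NeZero.pos N
  have h := norm_LSeries_le_of_abel_div (c := fun n : ℕ => χ (n : ZMod N)) (κ := 0) (K := N)
    (s := s) (X := N) (fun n => χ.norm_le_one _) ?_ (by simpa using hs) (NeZero.pos N)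
  · refine h.trans ?_
    rw [norm_zero, zero_mul, mul_div_cancel₀ _ hN.ne', Complex.norm_real, Real.norm_eq_abs,
      abs_of_pos (by linarith)]
    linarith
  · intro t _
    have : Finset.Icc 0 ⌊t⌋₊ = Finset.range (⌊t⌋₊ + 1) := by
      ext k
      simp
    rw [zero_mul, sub_zero, this]
    exact norm_sum_range_le hχ _

theorem norm_LSeries_le_of_norm_le_one {c : ℕ → ℂ} (hc : ∀ n, ‖c n‖ ≤ 1) {s : ℝ} (hs : 1 < s)
    (hs2 : s ≤ 2) : ‖LSeries c s‖ ≤ 7 / (s - 1) := by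
  have hs' : 1 < (s : ℂ).re := by simpa using hs
  have hsum1 : LSeriesSummable 1 (s : ℂ) :=
    LSeriesSummable_of_bounded_of_one_lt_re (m := 1) (fun n _ => by simp) hs'
  have h1 : ‖LSeries c s‖ ≤ ∑' n, ‖LSeries.term 1 (s : ℂ) n‖ := by
    refine tsum_of_norm_bounded hsum1.norm.hasSum fun n => ?_
    exact LSeries.norm_term_le _ (by simpa using hc n)
  have h2 : LSeries 1 (s : ℂ) = (∑' n, ‖LSeries.term 1 (s : ℂ) n‖ : ℝ) := by
    rw [Complex.ofReal_tsum, LSeries]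
    refine tsum_congr fun n => ?_
    rw [LSeries.norm_term_eq, LSeries.term_def]
    rcases eq_or_ne n 0 with rfl | hn
    · simp
    · rw [if_neg hn, if_neg hn]
      simp [Complex.ofReal_cpow (Nat.cast_nonneg n)]
  have h3 : ∑' n, ‖LSeries.term 1 (s : ℂ) n‖ = ‖LSeries 1 (s : ℂ)‖ := by
    rw [h2, Complex.norm_real, Real.norm_of_nonneg (tsum_nonneg fun _ => norm_nonneg _)]
  rw [h3] at h1
  refine h1.trans ?_
  have h := norm_LSeries_le_of_abel_div (c := 1) (κ := 1) (K := 1)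
    (s := s) (X := 1) (fun n => by simp) ?_ hs' one_pos
  · refine h.trans ?_
    have e : ‖(1 : ℂ) - s‖ = s - 1 := by
      rw [← Complex.ofReal_one, ← Complex.ofReal_sub, Complex.norm_real, Real.norm_eq_abs,
        abs_sub_comm, abs_of_pos (by linarith)]
    rw [e, norm_one, Complex.norm_real, Real.norm_eq_abs, abs_of_pos (by linarith)]
    have : 1 ≤ 1 / (s - 1) := by
      rw [le_div_iff₀ (by linarith)]
      linarith
    have e2 : 7 / (s - 1) = 7 * (1 / (s - 1)) := by ring
    have e3 : 2 / (s - 1) = 2 * (1 / (s - 1)) := by ring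
    rw [e2, e3]
    norm_num
    norm_num at this
    linarith
  · intro t ht
    have : ∑ k ∈ Finset.Icc 0 ⌊t⌋₊, (1 : ℕ → ℂ) k - 1 * t = ((⌊t⌋₊ + 1 - t : ℝ) : ℂ) := by
      simp
    rw [this, Complex.norm_real, Real.norm_eq_abs, abs_le]
    constructor <;> linarith [Nat.floor_le ht, Nat.lt_floor_add_one t]

theorem norm_LSeries_primeInd_pow_le {N : ℕ} [NeZero N] (hN : N ≠ 1) {s : ℝ} (hs : 1 < s) :
    ‖LSeries (primeInd fun p => p % N = 1) s‖ ^ N.totient ≤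
      ∏ χ : DirichletCharacter ℂ N, ‖LSeries (fun n : ℕ => χ (n : ZMod N)) s‖ := by
  have hs' : 1 < (s : ℂ).re := by simpa using hs
  obtain ⟨hF1, hF2⟩ := exp_tsum_log_eq_LSeries (primeInd fun p => p % N = 1) hs'
    (LSeriesSummable_primeInd _ hs')
  have hχ : ∀ χ : DirichletCharacter ℂ N,
      Summable (fun p : Nat.Primes => -Complex.log (1 - χ.natHom hN p * (p : ℂ) ^ (-(s : ℂ)))) ∧
      Complex.exp (∑' p : Nat.Primes, -Complex.log (1 - χ.natHom hN p * (p : ℂ) ^ (-(s : ℂ)))) =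
        LSeries (fun n : ℕ => χ (n : ZMod N)) s := fun χ =>
    exp_tsum_log_eq_LSeries (χ.natHom hN) hs'
      (LSeriesSummable_of_bounded_of_one_lt_re (m := 1) (fun n _ => χ.norm_le_one _) hs')
  rw [← hF2, Complex.norm_exp, ← Real.exp_nat_mul]
  have h1 : ∀ χ : DirichletCharacter ℂ N, ‖LSeries (fun n : ℕ => χ (n : ZMod N)) s‖ =
      Real.exp (∑' p : Nat.Primes,
        -Complex.log (1 - χ.natHom hN p * (p : ℂ) ^ (-(s : ℂ)))).re := fun χ => by
    rw [← (hχ χ).2, Complex.norm_exp]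
  rw [Finset.prod_congr rfl fun χ _ => h1 χ, ← Real.exp_sum, Real.exp_le_exp, ← Complex.re_sum,
    ← Summable.tsum_finsetSum fun χ _ => (hχ χ).1, Complex.re_tsum hF1,
    Complex.re_tsum (summable_sum fun χ _ => (hχ χ).1), ← tsum_mul_left]
  refine Summable.tsum_le_tsum (fun p => ?_)
    (((Complex.hasSum_re hF1.hasSum).summable).mul_left _)
    (Complex.hasSum_re (summable_sum fun χ _ => (hχ χ).1).hasSum).summable
  have hp0 : (0 : ℝ) < (p : ℕ) := by exact_mod_cast p.2.pos
  have hz : ((p : ℕ) : ℂ) ^ (-(s : ℂ)) = (((p : ℕ) : ℝ) ^ (-s) : ℝ) := by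
    rw [Complex.ofReal_cpow hp0.le]
    simp
  rw [hz]
  exact re_sum_neg_log_ge hN p.2 (by positivity)
    (Real.rpow_lt_one_of_one_lt_of_neg (by exact_mod_cast p.2.one_lt) (by linarith))

theorem norm_LSeries_primeInd_le {N : ℕ} [NeZero N] (hN : N ≠ 1) {s : ℝ} (hs : 1 < s)
    (hs2 : s ≤ 2) :
    ‖LSeries (primeInd fun p => p % N = 1) s‖ ≤
      7 * (1 / (s - 1)) ^ (1 / N.totient : ℝ) * (5 + Real.log N) := by
  classical
  have hφ : 0 < N.totient := Nat.totient_pos.mpr (NeZero.pos N)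
  have hlog : 0 ≤ Real.log N := Real.log_natCast_nonneg N
  have hs0 : 0 < 1 / (s - 1) := by
    have : 0 < s - 1 := by linarith
    positivity
  have hcard : (Finset.univ : Finset (DirichletCharacter ℂ N)).card = N.totient := by
    rw [Finset.card_univ, ← Nat.card_eq_fintype_card,
      DirichletCharacter.card_eq_totient_of_hasEnoughRootsOfUnity]
  have h1 : ∏ χ : DirichletCharacter ℂ N, ‖LSeries (fun n : ℕ => χ (n : ZMod N)) s‖ ≤
      7 / (s - 1) * (5 + Real.log N) ^ N.totient := by
    rw [← Finset.mul_prod_erase _ _ (Finset.mem_univ (1 : DirichletCharacter ℂ N))]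
    refine mul_le_mul (norm_LSeries_le_of_norm_le_one
      (fun n => DirichletCharacter.norm_le_one _ _) hs hs2) ?_
      (Finset.prod_nonneg fun _ _ => norm_nonneg _) ?_
    · refine (Finset.prod_le_prod (fun _ _ => norm_nonneg _) fun χ hχ =>
        norm_LSeries_le_of_ne_one (Finset.ne_of_mem_erase hχ) hs hs2).trans ?_
      rw [Finset.prod_const]
      exact pow_le_pow_right₀ (by linarith) (by rw [← hcard]; exact Finset.card_erase_le)
    · have : 0 < s - 1 := by linarith
      positivity
  have h2 := (norm_LSeries_primeInd_pow_le hN hs).trans h1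
  refine le_of_pow_le_pow_left₀ hφ.ne' (by positivity) (h2.trans ?_)
  rw [mul_pow, mul_pow, ← Real.rpow_natCast (_ ^ _), ← Real.rpow_mul hs0.le,
    one_div_mul_cancel (by exact_mod_cast hφ.ne'), Real.rpow_one, div_eq_mul_one_div]
  have : (7 : ℝ) ≤ 7 ^ N.totient := le_self_pow₀ (by norm_num) hφ.ne'
  gcongr

theorem invSum_le_norm_LSeries (P : ℕ → Prop) {x : ℝ} (hx : Real.exp 1 ≤ x) :
    invSum (primeSet P) x ≤
      Real.exp 1 * ‖LSeries (primeInd P) (1 + 1 / Real.log x : ℝ)‖ := by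
  classical
  have hx0 : 0 < x := (Real.exp_pos 1).trans_le hx
  have hL : 1 ≤ Real.log x := (Real.le_log_iff_exp_le hx0).mpr hx
  set s : ℝ := 1 + 1 / Real.log x with hs
  have hs1 : 1 < s := by
    have : 0 < 1 / Real.log x := by positivity
    linarith
  have hsum := (LSeriesSummable_primeInd P (s := (s : ℂ)) (by simpa using hs1)).norm
  have hterm : ∀ n, LSeries.term (primeInd P) (s : ℂ) n =
      ((primeSet P).indicator (fun n : ℕ => (n : ℝ) ^ (-s)) n : ℝ) := by
    intro n
    rw [LSeries.term_def, Set.indicator_apply]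
    rcases eq_or_ne n 0 with rfl | hn
    · simp [zero_notMem_primeSet]
    · rw [if_neg hn, primeInd_apply]
      split_ifs with h
      · rw [Real.rpow_neg (Nat.cast_nonneg n)]
        push_cast
        rw [Complex.ofReal_cpow (Nat.cast_nonneg n)]
        simp
      · simp
  have hnn : ∀ n, 0 ≤ (primeSet P).indicator (fun n : ℕ => (n : ℝ) ^ (-s)) n :=
    fun n => Set.indicator_nonneg (fun _ _ => by positivity) _
  have hsum' : Summable ((primeSet P).indicator (fun n : ℕ => (n : ℝ) ^ (-s))) := by
    refine hsum.congr fun n => ?_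
    rw [hterm, Complex.norm_real, Real.norm_of_nonneg (hnn n)]
  have hF : ‖LSeries (primeInd P) (s : ℂ)‖ =
      ∑' n, (primeSet P).indicator (fun n : ℕ => (n : ℝ) ^ (-s)) n := by
    rw [LSeries, tsum_congr hterm, ← Complex.ofReal_tsum, Complex.norm_real,
      Real.norm_of_nonneg (tsum_nonneg hnn)]
  rw [hF]
  refine le_trans ?_ (mul_le_mul_of_nonneg_left
    (hsum'.sum_le_tsum (Finset.Ioc 0 ⌊x⌋₊) fun n _ => hnn n) (Real.exp_pos 1).le)
  rw [invSum, Finset.mul_sum]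
  refine Finset.sum_le_sum fun n hn => ?_
  rw [Finset.mem_Ioc] at hn
  have hn0 : (0 : ℝ) < n := by exact_mod_cast hn.1
  have hnx : (n : ℝ) ≤ x := (Nat.le_floor_iff hx0.le).mp hn.2
  rw [Set.indicator_apply, Set.indicator_apply]
  split_ifs
  · have e1 : (n : ℝ)⁻¹ = (n : ℝ) ^ (1 / Real.log x) * (n : ℝ) ^ (-s) := by
      rw [← Real.rpow_add hn0, hs, ← Real.rpow_neg_one]
      congr 1
      ring
    rw [e1]
    refine mul_le_mul_of_nonneg_right ?_ (by positivity)
    rw [Real.rpow_def_of_pos hn0, Real.exp_le_exp, mul_one_div, div_le_one (by linarith)]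
    exact Real.log_le_log hn0 hnx
  · simp

theorem exists_invSum_le : ∃ C : ℝ, 0 < C ∧ ∀ (N : ℕ) [NeZero N], N ≠ 1 → ∀ x : ℝ, Real.exp 1 ≤ x →
    invSum (primeSet fun p => p % N = 1) x ≤
      C * Real.log x ^ (1 / N.totient : ℝ) * (1 + Real.log N) := by
  refine ⟨Real.exp 1 * 35, by positivity, fun N _ hN x hx => ?_⟩
  have hx0 : 0 < x := (Real.exp_pos 1).trans_le hx
  have hL : 1 ≤ Real.log x := (Real.le_log_iff_exp_le hx0).mpr hx
  have hlog : 0 ≤ Real.log N := Real.log_natCast_nonneg N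
  have h1 : 0 < 1 / Real.log x := by positivity
  have h2 : 1 / Real.log x ≤ 1 := by rw [div_le_one (by linarith)]; exact hL
  have h := norm_LSeries_primeInd_le hN (s := 1 + 1 / Real.log x) (by linarith) (by linarith)
  rw [add_sub_cancel_left, one_div_one_div] at h
  have h3 := mul_le_mul_of_nonneg_left h (Real.exp_pos 1).le
  refine (invSum_le_norm_LSeries _ hx).trans (h3.trans ?_)
  have h4 : 0 ≤ Real.exp 1 * Real.log x ^ (1 / N.totient : ℝ) := by positivity
  have h5 : 5 + Real.log N ≤ 5 * (1 + Real.log N) := by linarith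
  calc _ = Real.exp 1 * Real.log x ^ (1 / N.totient : ℝ) * 7 * (5 + Real.log N) := by ring
    _ ≤ Real.exp 1 * Real.log x ^ (1 / N.totient : ℝ) * 7 * (5 * (1 + Real.log N)) := by gcongr
    _ = _ := by ring

end

section

open MeasureTheory Set Filter DirichletCharacter Topology

theorem countSet_le_countSet {S T : Set ℕ} {x : ℝ}
    (h : ∀ n ∈ S, 0 < n → (n : ℝ) ≤ x → n ∈ T) : countSet S x ≤ countSet T x := by
  classical
  rw [countSet_eq, countSet_eq]
  refine Finset.card_le_card fun n hn => ?_
  simp only [Finset.mem_filter, Finset.mem_Icc] at hn ⊢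
  exact ⟨hn.1, h n hn.2 hn.1.1 ((Nat.le_floor_iff' (by lia)).mp hn.1.2)⟩

theorem countSet_union_le (S T : Set ℕ) (x : ℝ) :
    countSet (S ∪ T) x ≤ countSet S x + countSet T x := by
  classical
  rw [countSet_eq, countSet_eq, countSet_eq]
  refine le_trans (Finset.card_le_card fun n hn => ?_) (Finset.card_union_le _ _)
  simp only [Finset.mem_filter, Finset.mem_union, Set.mem_union] at hn ⊢
  tauto

theorem countSet_union_of_disjoint {S T : Set ℕ} (h : Disjoint S T) (x : ℝ) :
    countSet (S ∪ T) x = countSet S x + countSet T x := by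
  classical
  rw [countSet_eq, countSet_eq, countSet_eq, ← Finset.card_union_of_disjoint]
  · congr 1
    ext n
    simp only [Finset.mem_filter, Finset.mem_union, Set.mem_union]
    tauto
  · rw [Finset.disjoint_filter]
    exact fun n _ h1 h2 => Set.disjoint_left.mp h h1 h2

theorem countSet_biUnion_le {ι : Type*} (s : Finset ι) (S : ι → Set ℕ) (x : ℝ) :
    countSet (⋃ i ∈ s, S i) x ≤ ∑ i ∈ s, countSet (S i) x := by
  classical
  induction s using Finset.induction_on with
  | empty => simp [countSet_eq]
  | insert i s hi ih =>
    rw [Finset.sum_insert hi, Finset.set_biUnion_insert]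
    exact (countSet_union_le _ _ _).trans (Nat.add_le_add_left ih _)

theorem countSet_image_mul {k : ℕ} (hk : 0 < k) (S : Set ℕ) (x : ℝ) :
    countSet ((k * ·) '' S) x = countSet S (x / k) := by
  classical
  rw [countSet_eq, countSet_eq]
  refine (Finset.card_nbij (k * ·) ?_ ?_ ?_).symm
  · intro m hm
    simp only [Finset.mem_filter, Finset.mem_Icc, Nat.floor_div_natCast,
      Nat.le_div_iff_mul_le hk, Finset.mem_coe] at hm ⊢
    exact ⟨⟨Nat.mul_pos hk hm.1.1, by rw [mul_comm]; exact hm.1.2⟩, m, hm.2, rfl⟩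
  · intro a _ b _ hab
    exact Nat.eq_of_mul_eq_mul_left hk hab
  · intro n hn
    simp only [Finset.coe_filter, Finset.mem_Icc, Set.mem_ofPred_eq] at hn
    obtain ⟨hn, m, hm, rfl⟩ := hn
    refine ⟨m, ?_, rfl⟩
    simp only [Finset.coe_filter, Finset.mem_Icc, Set.mem_ofPred_eq, Nat.floor_div_natCast,
      Nat.le_div_iff_mul_le hk]
    exact ⟨⟨Nat.pos_of_mul_pos_left hn.1, by rw [mul_comm]; exact hn.2⟩, hm⟩

theorem invSum_mono (S : Set ℕ) {x y : ℝ} (hxy : x ≤ y) : invSum S x ≤ invSum S y :=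
  Finset.sum_le_sum_of_subset_of_nonneg
    (Finset.Ioc_subset_Ioc_right (Nat.floor_mono hxy))
    fun _ _ _ => Set.indicator_nonneg (fun _ _ => by positivity) _

theorem invSum_or_eq_le (P : ℕ → Prop) {q : ℕ} (hq : q.Prime) (x : ℝ) :
    invSum (primeSet fun p => p = q ∨ P p) x ≤ 2 * invSum (primeSet P) x := by
  classical
  set S := primeSet fun p => p = q ∨ P p with hS
  have hq2 : (2 : ℝ) ≤ q := by exact_mod_cast hq.two_le
  have h1 : invSum S x ≤ invSum (primeSet P) x + (q : ℝ)⁻¹ * invSum S x := by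
    have e1 : invSum S x = ∑ n ∈ (Finset.Ioc 0 ⌊x⌋₊).filter (¬ q ∣ ·),
          S.indicator (fun r : ℕ => (r : ℝ)⁻¹) n +
        ∑ n ∈ (Finset.Ioc 0 ⌊x⌋₊).filter (q ∣ ·), S.indicator (fun r : ℕ => (r : ℝ)⁻¹) n := by
      rw [add_comm, invSum, Finset.sum_filter_add_sum_filter_not]
    refine e1.le.trans (add_le_add ?_ ?_)
    · refine (Finset.sum_le_sum fun n hn => ?_).trans
        (Finset.sum_le_sum_of_subset_of_nonneg (Finset.filter_subset _ _)
          fun _ _ _ => Set.indicator_nonneg (fun _ _ => by positivity) _)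
      rw [Set.indicator_apply, Set.indicator_apply]
      split_ifs with h h'
      · exact le_rfl
      · refine absurd ⟨h.1, fun p hp hpn => ?_⟩ h'
        refine (h.2 p hp hpn).resolve_left ?_
        rintro rfl
        exact (Finset.mem_filter.mp hn).2 hpn
      · positivity
      · exact le_rfl
    · have e2 : (Finset.Ioc 0 ⌊x⌋₊).filter (q ∣ ·) ⊆ (Finset.Ioc 0 ⌊x⌋₊).image (q * ·) := by
        intro n hn
        simp only [Finset.mem_filter, Finset.mem_Ioc, Finset.mem_image] at hn ⊢
        obtain ⟨hn, m, rfl⟩ := hn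
        exact ⟨m, ⟨Nat.pos_of_mul_pos_left hn.1,
          (Nat.le_mul_of_pos_left m hq.pos).trans hn.2⟩, rfl⟩
      refine (Finset.sum_le_sum_of_subset_of_nonneg e2
        fun _ _ _ => Set.indicator_nonneg (fun _ _ => by positivity) _).trans ?_
      rw [Finset.sum_image fun a _ b _ hab => Nat.eq_of_mul_eq_mul_left hq.pos hab, invSum,
        Finset.mul_sum]
      refine Finset.sum_le_sum fun m _ => ?_
      rw [Set.indicator_apply, Set.indicator_apply]
      split_ifs with h h'
      · rw [Nat.cast_mul, mul_inv]
      · exact absurd (mul_mem_primeSet.mp h).2 h'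
      · positivity
      · simp
  have h2 : (q : ℝ)⁻¹ ≤ 2⁻¹ := inv_anti₀ two_pos hq2
  have h3 := invSum_nonneg S x
  nlinarith

/-- The multiples of `q ^ 2` whose cofactor is composed of `2`, `q` and primes `≡ 1` mod `q`. -/
def squareMultiples (q : ℕ) : Set ℕ :=
  (q ^ 2 * ·) '' primeSet fun p => p = 2 ∨ p = q ∨ p % q = 1

theorem countSet_squareMultiples_le_div {q : ℕ} (hq : 0 < q) {x : ℝ} (hx : 0 ≤ x) :
    (countSet (squareMultiples q) x : ℝ) ≤ x / q ^ 2 := by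
  rw [squareMultiples, countSet_image_mul (by positivity), Nat.cast_pow]
  exact countSet_le _ (by positivity)

theorem countSet_squareMultiples_le {q : ℕ} (hq : q.Prime) {x : ℝ} (hx : 1 < x)
    (hqx : (q : ℝ) ^ 2 ≤ √x) :
    (countSet (squareMultiples q) x : ℝ) ≤
      8 * (Real.log 4 + 5) * (x / (Real.log x * q)) * invSum (primeSet fun p => p % q = 1) x := by
  have hq2 : (1 : ℝ) ≤ q := by exact_mod_cast hq.one_le
  have hx0 : 0 < x := by linarith
  have hsq := Real.sq_sqrt hx0.le
  have hs1 : 1 < √x := by rw [Real.lt_sqrt zero_le_one]; linarith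
  have hL : 0 < Real.log x := Real.log_pos hx
  have h4 : 0 < Real.log 4 := Real.log_pos (by norm_num)
  rw [squareMultiples, countSet_image_mul (pow_pos hq.pos 2), Nat.cast_pow]
  set y := x / (q : ℝ) ^ 2 with hy
  have hys : √x ≤ y := by
    rw [hy, le_div_iff₀ (by positivity)]
    nlinarith
  have hy1 : 1 ≤ y := by linarith
  have hlog : Real.log x / 2 ≤ Real.log y := by
    rw [← Real.log_sqrt hx0.le]
    exact Real.log_le_log (by linarith) hys
  have h1 := countSet_mul_log_le (fun p => p = 2 ∨ p = q ∨ p % q = 1) hy1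
  have hA := invSum_nonneg (primeSet fun p => p % q = 1) x
  have h2 : invSum (primeSet fun p => p = 2 ∨ p = q ∨ p % q = 1) y ≤
      4 * invSum (primeSet fun p => p % q = 1) x := by
    have e1 := invSum_or_eq_le (fun p => p = q ∨ p % q = 1) Nat.prime_two y
    have e2 := invSum_or_eq_le (fun p => p % q = 1) hq y
    have e3 := invSum_mono (primeSet fun p => p % q = 1) (x := y) (y := x)
      (div_le_self hx0.le (one_le_pow₀ hq2))
    linarith
  have hyx : y ≤ x / q := by
    rw [hy]
    refine div_le_div_of_nonneg_left hx0.le (by linarith) ?_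
    nlinarith
  set c := (countSet (primeSet fun p => p = 2 ∨ p = q ∨ p % q = 1) y : ℝ) with hc
  have hc0 : 0 ≤ c := Nat.cast_nonneg _
  have h3 : c * (Real.log x / 2) ≤ (Real.log 4 + 5) * (x / q) *
      (4 * invSum (primeSet fun p => p % q = 1) x) := by
    refine (mul_le_mul_of_nonneg_left hlog hc0).trans (h1.trans ?_)
    refine mul_le_mul ?_ h2 (invSum_nonneg _ _) (by positivity)
    gcongr
  rw [← le_div_iff₀ (by linarith)] at h3
  refine h3.trans (le_of_eq ?_)
  field_simp
  ring

end

section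

open MeasureTheory Set Filter DirichletCharacter Topology

theorem modEq_one_of_mem_primeSet {q n : ℕ} (h : n ∈ primeSet fun p => p % q = 1) :
    n ≡ 1 [MOD q] := by
  induction n using Nat.recOnMul with
  | zero => exact absurd h (zero_notMem_primeSet _)
  | one => rfl
  | prime p hp =>
    have := hp.mem_primeSet.mp h
    rcases eq_or_ne q 1 with rfl | hq
    · exact Nat.modEq_one
    · rw [Nat.ModEq, this]
      rcases q with _ | _ | q
      · rfl
      · exact absurd rfl hq
      · exact (Nat.mod_eq_of_lt (by lia)).symm
  | mul a b ha hb =>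
    rw [mul_mem_primeSet] at h
    exact (ha h.1).mul (hb h.2)

/-- An integer `> 1` composed of primes `≡ 1` mod `q` has the form `1 + j * q` with `j > 0`. -/
theorem exists_eq_one_add_mul {q n : ℕ} (h : n ∈ primeSet fun p => p % q = 1) (hn : n ≠ 1) :
    ∃ j, 0 < j ∧ n = 1 + j * q := by
  have h0 : 0 < n := Nat.pos_of_ne_zero h.1
  obtain ⟨j, hj⟩ := (Nat.modEq_iff_dvd' h0).mp (modEq_one_of_mem_primeSet h).symm
  refine ⟨j, Nat.pos_of_ne_zero ?_, by rw [mul_comm]; lia⟩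
  rintro rfl
  lia

/-- Composite integers all of whose prime factors are `≡ 1` mod `q`. -/
def compositeSet (q : ℕ) : Set ℕ :=
  (primeSet fun p => p % q = 1) ∩ {m | ¬ m.Prime ∧ m ≠ 1}

theorem countSet_compositeSet_le {q : ℕ} (hq : 0 < q) {x : ℝ} (hx : 1 ≤ x) :
    (countSet (compositeSet q) x : ℝ) ≤ x / q ^ 2 * (1 + Real.log x) := by
  classical
  have hq1 : (1 : ℝ) ≤ q := by exact_mod_cast hq
  have hL : 0 ≤ Real.log x := Real.log_nonneg hx
  set K := ⌊x / (q : ℝ) ^ 2⌋₊ with hK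
  have hKx : (K : ℝ) ≤ x / q ^ 2 := Nat.floor_le (by positivity)
  have h1 : countSet (compositeSet q) x ≤
      ((Finset.Ioc 0 K).sigma fun i => Finset.Ioc 0 (K / i)).card := by
    rw [countSet_eq]
    refine (Finset.card_le_card (t := ((Finset.Ioc 0 K).sigma fun i => Finset.Ioc 0 (K / i)).image
      fun s => (1 + s.1 * q) * (1 + s.2 * q)) fun m hm => ?_).trans Finset.card_image_le
    simp only [Finset.mem_filter, Finset.mem_Icc] at hm
    obtain ⟨⟨hm0, hmx⟩, hmS, hmp, hm1⟩ := hm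
    obtain ⟨a, b, ha, hb, rfl⟩ := (Nat.not_prime_iff_exists_mul_eq (by lia)).mp hmp
    rw [mul_mem_primeSet] at hmS
    obtain ⟨i, hi, rfl⟩ := exists_eq_one_add_mul hmS.1 (by rintro rfl; lia)
    obtain ⟨j, hj, rfl⟩ := exists_eq_one_add_mul hmS.2 (by rintro rfl; lia)
    refine Finset.mem_image.mpr ⟨⟨i, j⟩, ?_, rfl⟩
    have hij : j * i ≤ K := by
      refine Nat.le_floor ?_
      rw [le_div_iff₀ (by positivity)]
      refine le_trans ?_ ((Nat.cast_le.mpr hmx).trans (Nat.floor_le (by linarith)))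
      push_cast
      have : (0 : ℝ) ≤ i * q := by positivity
      have : (0 : ℝ) ≤ j * q := by positivity
      nlinarith
    simp only [Finset.mem_sigma, Finset.mem_Ioc, Nat.le_div_iff_mul_le hi]
    exact ⟨⟨hi, (Nat.le_mul_of_pos_left i hj).trans hij⟩, hj, hij⟩
  have h2 : (countSet (compositeSet q) x : ℝ) ≤ ∑ i ∈ Finset.Ioc 0 K, (K : ℝ) * (i : ℝ)⁻¹ := by
    refine (Nat.cast_le.mpr h1).trans ?_
    rw [Finset.card_sigma, Nat.cast_sum]
    refine Finset.sum_le_sum fun i _ => ?_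
    rw [Nat.card_Ioc, Nat.sub_zero, ← div_eq_mul_inv]
    exact Nat.cast_div_le
  refine h2.trans ?_
  rw [← Finset.mul_sum]
  rcases Nat.eq_zero_or_pos K with h0 | h0
  · rw [h0, Nat.cast_zero, zero_mul]
    positivity
  · refine mul_le_mul hKx ((sum_Ioc_inv_le K).trans ?_)
      (Finset.sum_nonneg fun _ _ => by positivity) (by positivity)
    have : Real.log K ≤ Real.log x := Real.log_le_log (by exact_mod_cast h0)
      (hKx.trans (div_le_self (by linarith) (one_le_pow₀ hq1)))
    linarith

theorem div_one_add_log_le {s t : ℝ} (hs : 1 ≤ s) (hst : s ≤ t) :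
    s / (1 + Real.log s) ≤ t / (1 + Real.log t) := by
  have hs0 : 0 < s := by linarith
  have ht0 : 0 < t := by linarith
  have h1 := Real.log_nonneg hs
  have h2 := Real.log_le_log hs0 hst
  rw [div_le_div_iff₀ (by linarith) (by linarith)]
  have h3 := Real.log_le_sub_one_of_pos (div_pos ht0 hs0)
  rw [Real.log_div ht0.ne' hs0.ne', le_sub_iff_add_le, le_div_iff₀ hs0] at h3
  nlinarith

/-- Telescoping bound for `∑ 1 / (j (1 + log (X / j)))`. -/
theorem sum_inv_mul_one_add_log_le {X : ℝ} {J : ℕ} (hJ : 0 < J) (hJX : (J : ℝ) ≤ X) :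
    ∑ j ∈ Finset.Ioc 0 J, ((j : ℝ) * (1 + Real.log (X / j)))⁻¹ ≤
      1 + 2 * (Real.log (1 + Real.log X) - Real.log (1 + Real.log (X / J))) := by
  induction J, hJ using Nat.le_induction with
  | base =>
    have : 0 ≤ Real.log X := Real.log_nonneg (by simpa using hJX)
    rw [Finset.sum_Ioc_succ_top le_rfl, Finset.Ioc_self, Finset.sum_empty]
    simp only [Nat.succ_eq_add_one, zero_add, Nat.cast_one, one_mul, div_one, sub_self, mul_zero,
      add_zero]
    exact inv_le_one_of_one_le₀ (by linarith)
  | succ J hJ ih =>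
    have hJ0 : (1 : ℝ) ≤ J := by exact_mod_cast hJ
    push_cast at hJX
    have hX : 0 < X := by linarith
    rw [Finset.sum_Ioc_succ_top (Nat.zero_le J)]
    refine (add_le_add_left (ih (by linarith)) _).trans ?_
    push_cast
    set a := 1 + Real.log (X / (J + 1)) with ha
    have ha1 : 1 ≤ a := by
      have : 0 ≤ Real.log (X / (J + 1)) :=
        Real.log_nonneg ((one_le_div (by linarith)).mpr hJX)
      linarith
    have hb : a + ((J : ℝ) + 1)⁻¹ ≤ 1 + Real.log (X / J) := by
      have e := Real.one_sub_inv_le_log_of_pos (x := ((J : ℝ) + 1) / J) (by positivity)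
      have e2 : Real.log (((J : ℝ) + 1) / J) = Real.log (X / J) - Real.log (X / (J + 1)) := by
        rw [Real.log_div (by positivity) (by positivity), Real.log_div hX.ne' (by positivity),
          Real.log_div hX.ne' (by positivity)]
        ring
      have e3 : 1 - (((J : ℝ) + 1) / J)⁻¹ = ((J : ℝ) + 1)⁻¹ := by field_simp; ring
      rw [e2, e3] at e
      linarith
    set t := (((J : ℝ) + 1) * a)⁻¹ with ht
    have ht0 : 0 < t := by positivity
    have ht1 : t ≤ 1 := inv_le_one_of_one_le₀ (by nlinarith)
    have hlog : Real.log a + t / 2 ≤ Real.log (1 + Real.log (X / J)) := by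
      have e1 : a * (1 + t) ≤ 1 + Real.log (X / J) := by
        refine le_trans (le_of_eq ?_) hb
        rw [ht]
        field_simp
      have e2 := Real.log_le_log (by positivity) e1
      rw [Real.log_mul (by positivity) (by positivity)] at e2
      have e3 := Real.one_sub_inv_le_log_of_pos (x := 1 + t) (by positivity)
      have e4 : t / 2 ≤ 1 - (1 + t)⁻¹ := by
        have : 1 - (1 + t)⁻¹ = t / (1 + t) := by field_simp; ring
        rw [this]
        exact div_le_div_of_nonneg_left ht0.le (by positivity) (by linarith)
      linarith
    linarith

theorem sum_indicator_inv_div_log_le {q : ℕ} (hq : 0 < q) {x : ℝ} (hx : 1 ≤ x) :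
    ∑ r ∈ Finset.Ioc 1 ⌊x⌋₊, (primeSet fun p => p % q = 1).indicator
      (fun r : ℕ => ((r : ℝ) * (1 + Real.log (x / r)))⁻¹) r ≤
      4 / q * (1 + 2 * Real.log (1 + Real.log x)) := by
  classical
  set S := primeSet fun p => p % q = 1
  have hq1 : (1 : ℝ) ≤ q := by exact_mod_cast hq
  have hx0 : 0 < x := by linarith
  have hL : 0 ≤ Real.log x := Real.log_nonneg hx
  have hLL : 0 ≤ Real.log (1 + Real.log x) := Real.log_nonneg (by linarith)
  set X := x / q with hX
  set J := ⌊X⌋₊ with hJ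
  have hX0 : 0 ≤ X := by positivity
  have hlog : ∀ j : ℕ, 0 < j → (j : ℝ) ≤ X → 0 ≤ Real.log (X / j) := fun j hj hjX =>
    Real.log_nonneg ((one_le_div (by exact_mod_cast hj)).mpr hjX)
  rw [Finset.sum_indicator_eq_sum_filter]
  have e2 : (Finset.Ioc 1 ⌊x⌋₊).filter (· ∈ S) ⊆
      ((Finset.Ioc 0 J).filter fun j => 1 + j * q ≤ ⌊x⌋₊).image (1 + · * q) := by
    intro n hn
    simp only [Finset.mem_filter, Finset.mem_Ioc, Finset.mem_image] at hn ⊢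
    obtain ⟨j, hj, rfl⟩ := exists_eq_one_add_mul hn.2 (by lia)
    refine ⟨j, ⟨⟨hj, ?_⟩, hn.1.2⟩, rfl⟩
    rw [hJ, hX, Nat.floor_div_natCast, Nat.le_div_iff_mul_le hq]
    lia
  have hpos : ∀ j : ℕ, 0 < j → 1 + j * q ≤ ⌊x⌋₊ →
      (((1 + j * q : ℕ) : ℝ) * (1 + Real.log (x / (1 + j * q : ℕ))))⁻¹ ≤
        4 / q * ((j : ℝ) * (1 + Real.log (X / j)))⁻¹ ∧
      0 ≤ (((1 + j * q : ℕ) : ℝ) * (1 + Real.log (x / (1 + j * q : ℕ))))⁻¹ := by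
    intro j hj hjx
    have hj1 : (1 : ℝ) ≤ j := by exact_mod_cast hj
    have hjq : ((1 + j * q : ℕ) : ℝ) ≤ x := (Nat.cast_le.mpr hjx).trans (Nat.floor_le hx0.le)
    push_cast at hjq ⊢
    have hjq1 : 1 ≤ (j : ℝ) * q := by nlinarith
    have hjX : (j : ℝ) ≤ X := by rw [hX, le_div_iff₀ (by linarith)]; linarith
    have h0 := hlog j hj hjX
    have hX1 : 0 < X := by linarith
    have h1 : Real.log (X / j) - Real.log 2 ≤ Real.log (x / (1 + j * q)) := by
      rw [← Real.log_div (by positivity) two_ne_zero]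
      refine Real.log_le_log (by positivity) ?_
      rw [hX, div_div, div_div]
      exact div_le_div_of_nonneg_left hx0.le (by positivity) (by linarith)
    have h2 : 0 ≤ Real.log (x / (1 + j * q)) :=
      Real.log_nonneg ((one_le_div (by positivity)).mpr hjq)
    refine ⟨?_, by positivity⟩
    have h3 := Real.log_two_lt_d9
    have h4 : (q : ℝ) / 4 * (j * (1 + Real.log (X / j))) ≤
        (1 + j * q) * (1 + Real.log (x / (1 + j * q))) := by
      have : (1 + Real.log (X / j)) / 4 ≤ 1 + Real.log (x / (1 + j * q)) := by linarith
      calc (q : ℝ) / 4 * (j * (1 + Real.log (X / j))) = (j * q) * ((1 + Real.log (X / j)) / 4) := by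
            ring
        _ ≤ _ := mul_le_mul (by linarith) this (by positivity) (by positivity)
    refine (inv_anti₀ (by positivity) h4).trans (le_of_eq ?_)
    rw [mul_inv, inv_div]
  refine (Finset.sum_le_sum_of_subset_of_nonneg e2 fun n hn _ => ?_).trans ?_
  · obtain ⟨j, hj, rfl⟩ := Finset.mem_image.mp hn
    rw [Finset.mem_filter, Finset.mem_Ioc] at hj
    exact (hpos j hj.1.1 hj.2).2
  rw [Finset.sum_image fun a _ b _ hab => Nat.eq_of_mul_eq_mul_right hq (Nat.add_left_cancel hab)]
  calc _ ≤ ∑ j ∈ (Finset.Ioc 0 J).filter (fun j => 1 + j * q ≤ ⌊x⌋₊),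
        4 / (q : ℝ) * ((j : ℝ) * (1 + Real.log (X / j)))⁻¹ := by
        refine Finset.sum_le_sum fun j hj => ?_
        rw [Finset.mem_filter, Finset.mem_Ioc] at hj
        exact (hpos j hj.1.1 hj.2).1
    _ ≤ ∑ j ∈ Finset.Ioc 0 J, 4 / (q : ℝ) * ((j : ℝ) * (1 + Real.log (X / j)))⁻¹ := by
        refine Finset.sum_le_sum_of_subset_of_nonneg (Finset.filter_subset _ _) fun j hj _ => ?_
        rw [Finset.mem_Ioc] at hj
        have := hlog j hj.1 ((Nat.cast_le.mpr hj.2).trans (Nat.floor_le hX0))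
        positivity
    _ ≤ _ := by
        rw [← Finset.mul_sum]
        refine mul_le_mul_of_nonneg_left ?_ (by positivity)
        rcases Nat.eq_zero_or_pos J with h0 | h0
        · rw [h0, Finset.Ioc_self, Finset.sum_empty]
          positivity
        · have hJX : (J : ℝ) ≤ X := Nat.floor_le hX0
          have hX1 : 1 ≤ X := le_trans (by exact_mod_cast h0) hJX
          refine (sum_inv_mul_one_add_log_le h0 hJX).trans ?_
          have h1 := hlog J h0 hJX
          have h2 : 0 ≤ Real.log (1 + Real.log (X / J)) := Real.log_nonneg (by linarith)
          have h3 : Real.log (1 + Real.log X) ≤ Real.log (1 + Real.log x) := by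
            have := Real.log_le_log (by linarith) (div_le_self hx0.le hq1 : X ≤ x)
            have := Real.log_nonneg hX1
            exact Real.log_le_log (by linarith) (by linarith)
          linarith

theorem exists_countSet_compositeSet_mul_log_le : ∃ C : ℝ, 0 < C ∧ ∀ q : ℕ, q.Prime →
    ∀ x : ℝ, 1 ≤ x → countSet (compositeSet q) x * Real.log x ≤ √x * Real.log x +
      C * (x / q) * (invSum (primeSet fun p => p % q = 1) x + 1 + Real.log (1 + Real.log x)) := by
  classical
  obtain ⟨C, hC, hBT⟩ := exists_sum_vonMangoldt_residue_le
  refine ⟨32 * C, by positivity, fun q hq x hx => ?_⟩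
  have : NeZero q := ⟨hq.ne_zero⟩
  have hq1 : (2 : ℝ) ≤ q := by exact_mod_cast hq.two_le
  have hx0 : 0 < x := by linarith
  have hL : 0 ≤ Real.log x := Real.log_nonneg hx
  have hLL : 0 ≤ Real.log (1 + Real.log x) := Real.log_nonneg (by linarith)
  have hA := invSum_nonneg (primeSet fun p => p % q = 1) x
  set N := ⌊x⌋₊ with hN
  set P : ℕ → Prop := fun p => p % q = 1 with hP
  have h1 : countSet (compositeSet q) x * Real.log x ≤ √x * Real.log x +
      2 * ∑ m ∈ Finset.Ioc 0 N,
        (primeSet P ∩ {m | ¬ m.Prime}).indicator (fun m : ℕ => Real.log m) m := by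
    have e1 : ∑ m ∈ Finset.Ioc 0 N, (if (m : ℝ) ≤ √x then Real.log x else 0) ≤
        √x * Real.log x := by
      rw [← Finset.sum_filter, Finset.sum_const, nsmul_eq_mul]
      refine mul_le_mul_of_nonneg_right ?_ hL
      refine le_trans (Nat.cast_le.mpr ?_) (Nat.floor_le (Real.sqrt_nonneg x))
      rw [← Nat.sub_zero ⌊√x⌋₊, ← Nat.card_Ioc]
      refine Finset.card_le_card fun m hm => ?_
      rw [Finset.mem_filter, Finset.mem_Ioc] at hm
      exact Finset.mem_Ioc.mpr ⟨hm.1.1, Nat.le_floor hm.2⟩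
    refine le_trans ?_ (add_le_add_left e1 _)
    rw [countSet_eq_sum, Finset.sum_mul, Finset.mul_sum, ← Finset.sum_add_distrib]
    refine Finset.sum_le_sum fun m hm => ?_
    have hm1 : (1 : ℝ) ≤ m := by exact_mod_cast (Finset.mem_Ioc.mp hm).1
    have hm2 := Real.log_nonneg hm1
    by_cases h : m ∈ compositeSet q
    · have h' : m ∈ primeSet P ∩ {m | ¬ m.Prime} := ⟨h.1, h.2.1⟩
      rw [Set.indicator_of_mem h, Set.indicator_of_mem h', one_mul]
      split_ifs with hmx
      · linarith
      · have := Real.log_le_log (Real.sqrt_pos.mpr hx0) (not_le.mp hmx).le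
        rw [Real.log_sqrt hx0.le] at this
        linarith
    · rw [Set.indicator_of_notMem h, zero_mul]
      have := Set.indicator_nonneg (s := primeSet P ∩ {m | ¬ m.Prime})
        (f := fun m : ℕ => Real.log m) (fun n _ => Real.log_natCast_nonneg n) m
      split_ifs <;> linarith
  have hφ : (q : ℝ) / 2 ≤ q.totient := by
    rw [Nat.totient_prime hq, Nat.cast_sub hq.one_le, Nat.cast_one]
    linarith
  have h2 : ∀ r ∈ Finset.Ioc 1 N, (primeSet P).indicator (fun _ => (1 : ℝ)) r *
      ∑ d ∈ Finset.Ioc 0 (N / r), (primeSet P).indicator ArithmeticFunction.vonMangoldt d ≤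
      2 * C * (x / q) * (primeSet P).indicator (fun r : ℕ => (r : ℝ)⁻¹) r +
      C * x * (primeSet P).indicator (fun r : ℕ => ((r : ℝ) * (1 + Real.log (x / r)))⁻¹) r := by
    intro r hr
    rw [Finset.mem_Ioc] at hr
    have hr0 : (0 : ℝ) < r := by exact_mod_cast (by lia : 0 < r)
    by_cases h : r ∈ primeSet P
    · simp only [Set.indicator_of_mem h, one_mul]
      have hM : 0 < N / r := Nat.div_pos hr.2 (by lia)
      have hM1 : (1 : ℝ) ≤ (N / r : ℕ) := by exact_mod_cast hM
      have hMx : ((N / r : ℕ) : ℝ) ≤ x / r := Nat.cast_div_le.trans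
        (div_le_div_of_nonneg_right (Nat.floor_le hx0.le) hr0.le)
      have e1 : ∑ d ∈ Finset.Ioc 0 (N / r),
          (primeSet P).indicator ArithmeticFunction.vonMangoldt d ≤
          ∑ n ∈ Finset.Ioc 0 (N / r),
            (if (n : ZMod q) = 1 then ArithmeticFunction.vonMangoldt n else 0) := by
        refine Finset.sum_le_sum fun d _ => ?_
        rw [Set.indicator_apply]
        split_ifs with h1 h2
        · exact le_rfl
        · refine absurd ?_ h2
          have := (ZMod.natCast_eq_natCast_iff _ _ _).mpr (modEq_one_of_mem_primeSet h1)
          simpa using this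
        · exact ArithmeticFunction.vonMangoldt_nonneg
        · exact le_rfl
      refine e1.trans ((hBT q (N / r) hM).trans ?_)
      have e2 : ((N / r : ℕ) : ℝ) / q.totient ≤ x / r / (q / 2) :=
        div_le_div₀ (by positivity) hMx (by positivity) hφ
      have e3 := div_one_add_log_le hM1 hMx
      refine (mul_le_mul_of_nonneg_left (add_le_add e2 e3) hC.le).trans (le_of_eq ?_)
      rw [mul_inv]
      field_simp
    · simp only [Set.indicator_of_notMem h]
      simp
  have h3 := (sum_indicator_not_prime_log_le P N).trans
    (mul_le_mul_of_nonneg_left (Finset.sum_le_sum h2) zero_le_two)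
  rw [Finset.sum_add_distrib, ← Finset.mul_sum, ← Finset.mul_sum] at h3
  have h4 : ∑ r ∈ Finset.Ioc 1 N, (primeSet P).indicator (fun r : ℕ => (r : ℝ)⁻¹) r ≤
      invSum (primeSet P) x :=
    Finset.sum_le_sum_of_subset_of_nonneg (Finset.Ioc_subset_Ioc_left zero_le_one)
      fun _ _ _ => Set.indicator_nonneg (fun _ _ => by positivity) _
  have h5 := sum_indicator_inv_div_log_le hq.pos hx
  have h6 := mul_le_mul_of_nonneg_left h4 (by positivity : 0 ≤ 2 * C * (x / q))
  have h7 := mul_le_mul_of_nonneg_left h5 (by positivity : 0 ≤ C * x)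
  have h8 : C * x * (4 / q * (1 + 2 * Real.log (1 + Real.log x))) =
      4 * (C * (x / q)) * (1 + 2 * Real.log (1 + Real.log x)) := by ring
  rw [h8] at h7
  have h9 : 0 ≤ C * (x / q) := by positivity
  have h10 := mul_nonneg h9 hA
  have h11 := mul_nonneg h9 hLL
  nlinarith

end

section

open MeasureTheory Set Filter DirichletCharacter Topology

theorem log_rpow_pow {L : ℝ} (hL : 0 ≤ L) (n : ℕ) :
    (L ^ (1 / 24 : ℝ)) ^ n = L ^ (n / 24 : ℝ) := by
  rw [← Real.rpow_natCast, ← Real.rpow_mul hL]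
  congr 1
  ring

theorem one_add_two_mul_log_le {L : ℝ} (hL : 1 ≤ L) :
    1 + 2 * Real.log L ≤ 49 * L ^ (1 / 24 : ℝ) := by
  have h1 := Real.log_le_rpow_div (x := L) (ε := 1 / 24) (by linarith) (by norm_num)
  have h2 : 1 ≤ L ^ (1 / 24 : ℝ) := Real.one_le_rpow hL (by norm_num)
  linarith

theorem log_one_add_le {L : ℝ} (hL : 1 ≤ L) :
    Real.log (1 + L) ≤ 49 * L ^ (1 / 24 : ℝ) := by
  refine le_trans ?_ (one_add_two_mul_log_le hL)
  have h1 : Real.log (1 + L) ≤ Real.log (2 * L) := Real.log_le_log (by linarith) (by linarith)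
  rw [Real.log_mul two_ne_zero (by linarith)] at h1
  have h2 := Real.log_two_lt_d9
  have h3 := Real.log_nonneg hL
  linarith

theorem exists_invSum_add_log_le : ∃ K : ℝ, 0 < K ∧ ∀ q : ℕ, q.Prime → 5 ≤ q → ∀ x : ℝ,
    Real.exp 1 ≤ x → (q : ℝ) ≤ Real.log x ^ 2 →
    invSum (primeSet fun p => p % q = 1) x + 1 + Real.log (1 + Real.log x) ≤
      K * (5 * (Real.log x ^ (1 / 24 : ℝ)) ^ 6 / q + (Real.log x ^ (1 / 24 : ℝ)) ^ 5) := by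
  obtain ⟨C, hC, hA⟩ := exists_invSum_le
  refine ⟨49 * C + 50, by positivity, fun q hq hq5 x hx hqx => ?_⟩
  have : NeZero q := ⟨hq.ne_zero⟩
  have hx0 : 0 < x := (Real.exp_pos 1).trans_le hx
  have hL : 1 ≤ Real.log x := by rwa [Real.le_log_iff_exp_le hx0]
  have hq0 : (5 : ℝ) ≤ q := by exact_mod_cast hq5
  have hA' := hA q hq.ne_one x hx
  have hlog := one_add_two_mul_log_le hL
  have hlog' := log_one_add_le hL
  have hp := log_rpow_pow (by linarith : 0 ≤ Real.log x)
  set L := Real.log x with hLdef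
  set E := L ^ (1 / 24 : ℝ) with hE
  have hE1 : 1 ≤ E := Real.one_le_rpow hL (by norm_num)
  have hE6 : 1 ≤ E ^ 6 := one_le_pow₀ hE1
  have hEE5 : E ≤ E ^ 5 := le_self_pow₀ hE1 (by norm_num)
  have hEE6 : E ≤ E ^ 6 := le_self_pow₀ hE1 (by norm_num)
  rw [Nat.totient_prime hq, Nat.cast_sub hq.one_le, Nat.cast_one] at hA'
  rcases eq_or_ne q 5 with rfl | hne
  · have e1 : L ^ (1 / (((5 : ℕ) : ℝ) - 1)) = E ^ 6 := by
      rw [hp]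
      norm_num
    have e2 : Real.log (5 : ℕ) ≤ 3 := by
      have := Real.log_le_sub_one_of_pos (x := 5 / 2) (by norm_num)
      rw [Real.log_div (by norm_num) (by norm_num)] at this
      have := Real.log_two_lt_d9
      push_cast
      linarith
    rw [e1] at hA'
    have e3 : 5 * E ^ 6 / (5 : ℕ) = E ^ 6 := by push_cast; ring
    rw [e3]
    have e4 : C * E ^ 6 * (1 + Real.log (5 : ℕ)) ≤ C * E ^ 6 * 4 :=
      mul_le_mul_of_nonneg_left (by linarith) (by positivity)
    have e5 : 0 ≤ (49 * C + 50) * E ^ 5 := by positivity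
    have e6 : 0 ≤ C * E ^ 6 := by positivity
    rw [mul_add]
    linarith
  · have hq7 : 7 ≤ q := by
      by_contra h
      have : q = 6 := by lia
      rw [this] at hq
      exact absurd hq (by norm_num)
    have hq7' : (7 : ℝ) ≤ q := by exact_mod_cast hq7
    have e1 : L ^ (1 / ((q : ℝ) - 1)) ≤ E ^ 4 := by
      rw [hp]
      refine Real.rpow_le_rpow_of_exponent_le hL ?_
      rw [div_le_div_iff₀ (by linarith) (by norm_num)]
      push_cast
      linarith
    have e2 : 1 + Real.log q ≤ 49 * E := by
      refine le_trans ?_ hlog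
      have := Real.log_le_log (by linarith) hqx
      rw [Real.log_pow] at this
      push_cast at this
      linarith
    have e3 : 0 ≤ 1 + Real.log q := by
      have := Real.log_nonneg (by linarith : (1 : ℝ) ≤ q)
      linarith
    have e4 : C * L ^ (1 / ((q : ℝ) - 1)) * (1 + Real.log q) ≤ C * E ^ 4 * (49 * E) :=
      mul_le_mul (mul_le_mul_of_nonneg_left e1 hC.le) e2 e3 (by positivity)
    have e5 : 0 ≤ (49 * C + 50) * (5 * E ^ 6 / q) := by positivity
    have e6 : C * E ^ 4 * (49 * E) = 49 * C * E ^ 5 := by ring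
    rw [mul_add]
    linarith

theorem exists_countSet_prime_modulus_le : ∃ K : ℝ, 0 < K ∧ ∀ q : ℕ, q.Prime → 5 ≤ q → ∀ x : ℝ,
    Real.exp 1 ≤ x → (q : ℝ) ≤ Real.log x ^ 2 → Real.log x ^ 4 ≤ √x →
    2 * (countSet (compositeSet q) x : ℝ) + countSet (squareMultiples q) x ≤ 2 * √x +
      K * (x / Real.log x) * (5 * (Real.log x ^ (1 / 24 : ℝ)) ^ 6 * ((q : ℝ) ^ 2)⁻¹ +
        (Real.log x ^ (1 / 24 : ℝ)) ^ 5 * (q : ℝ)⁻¹) := by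
  obtain ⟨K, hK, hW⟩ := exists_invSum_add_log_le
  obtain ⟨C, hC, hcomp⟩ := exists_countSet_compositeSet_mul_log_le
  have h4 : 0 < Real.log 4 := Real.log_pos (by norm_num)
  obtain ⟨c, hc⟩ : ∃ c : ℝ, c = 8 * (Real.log 4 + 5) := ⟨_, rfl⟩
  have hc0 : 0 < c := by rw [hc]; positivity
  refine ⟨(2 * C + c) * K, by positivity, fun q hq hq5 x hx hqx hLx => ?_⟩
  have hx0 : 0 < x := (Real.exp_pos 1).trans_le hx
  have hx1 : 1 < x := lt_of_lt_of_le (by rw [Real.one_lt_exp_iff]; norm_num) hx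
  have hL : 1 ≤ Real.log x := by rwa [Real.le_log_iff_exp_le hx0]
  have hq0 : (0 : ℝ) < q := by exact_mod_cast hq.pos
  have h1 := hcomp q hq x hx1.le
  have h2 := countSet_squareMultiples_le hq hx1 (le_trans (by
    calc (q : ℝ) ^ 2 ≤ (Real.log x ^ 2) ^ 2 := pow_le_pow_left₀ hq0.le hqx 2
      _ = _ := by ring) hLx)
  have h3 := hW q hq hq5 x hx hqx
  rw [← hc] at h2
  set L := Real.log x with hLdef
  set A := invSum (primeSet fun p => p % q = 1) x with hAdef
  have hA : 0 ≤ A := invSum_nonneg _ _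
  have hLL : 0 ≤ Real.log (1 + L) := Real.log_nonneg (by linarith)
  set W := A + 1 + Real.log (1 + L) with hWdef
  have hL0 : 0 < L := by linarith
  have e1 : (countSet (compositeSet q) x : ℝ) ≤ √x + C * (x / (L * q)) * W := by
    rw [← le_div_iff₀ hL0] at h1
    refine h1.trans (le_of_eq ?_)
    field_simp
  have e2 : c * (x / (L * q)) * A ≤ c * (x / (L * q)) * W :=
    mul_le_mul_of_nonneg_left (by linarith) (by positivity)
  have e3 : (2 * C + c) * (x / (L * q)) * W ≤ (2 * C + c) * (x / (L * q)) *
      (K * (5 * (L ^ (1 / 24 : ℝ)) ^ 6 / q + (L ^ (1 / 24 : ℝ)) ^ 5)) :=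
    mul_le_mul_of_nonneg_left h3 (by positivity)
  have e4 : (2 * C + c) * (x / (L * q)) *
      (K * (5 * (L ^ (1 / 24 : ℝ)) ^ 6 / q + (L ^ (1 / 24 : ℝ)) ^ 5)) =
      (2 * C + c) * K * (x / L) * (5 * (L ^ (1 / 24 : ℝ)) ^ 6 * ((q : ℝ) ^ 2)⁻¹ +
        (L ^ (1 / 24 : ℝ)) ^ 5 * (q : ℝ)⁻¹) := by
    field_simp
  rw [e4] at e3
  linarith

theorem sum_Ioc_inv_sq_le_two_div (k n : ℕ) :
    ∑ i ∈ Finset.Ioc k n, ((i : ℝ) ^ 2)⁻¹ ≤ 2 / (k + 1) := by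
  refine le_trans (le_of_eq (Finset.sum_congr ?_ fun _ _ => rfl)) (sum_Ioo_inv_sq_le k (n + 1))
  ext i
  simp only [Finset.mem_Ioc, Finset.mem_Ioo]
  lia

theorem exists_sum_countSet_prime_modulus_le : ∃ K : ℝ, 0 < K ∧ ∀ᶠ x : ℝ in atTop,
    ∑ q ∈ (Finset.Icc 5 ⌊x⌋₊).filter Nat.Prime,
      (2 * (countSet (compositeSet q) x : ℝ) + countSet (squareMultiples q) x) ≤
      K * (x * Real.log x ^ (-(3 / 4) : ℝ)) := by
  obtain ⟨K, hK, hsmall⟩ := exists_countSet_prime_modulus_le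
  refine ⟨2 + 60 * K + 10, by positivity, ?_⟩
  have ho := (Real.isLittleO_pow_log_id_atTop (n := 8)).bound (one_pos)
  filter_upwards [ho, eventually_ge_atTop (Real.exp 1)] with x hox hx
  have hx0 : 0 < x := (Real.exp_pos 1).trans_le hx
  have hx1 : 1 < x := lt_of_lt_of_le (by rw [Real.one_lt_exp_iff]; norm_num) hx
  have hL : 1 ≤ Real.log x := by rwa [Real.le_log_iff_exp_le hx0]
  have hsm := fun q hq hq5 => hsmall q hq hq5 x hx
  have hlarge : ∀ q : ℕ, 0 < q → (countSet (compositeSet q) x : ℝ) ≤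
      x / q ^ 2 * (1 + Real.log x) := fun q hq => countSet_compositeSet_le hq hx1.le
  have hlog := one_add_two_mul_log_le hL
  have hp := log_rpow_pow (by linarith : 0 ≤ Real.log x)
  set L := Real.log x with hLdef
  set E := L ^ (1 / 24 : ℝ) with hE
  have hL0 : 0 < L := by linarith
  have hE1 : 1 ≤ E := Real.one_le_rpow hL (by norm_num)
  have hE6 : 1 ≤ E ^ 6 := one_le_pow₀ hE1
  have hLx : L ^ 4 ≤ √x := by
    refine Real.le_sqrt_of_sq_le ?_
    rw [one_mul, id, Real.norm_of_nonneg (by positivity), Real.norm_of_nonneg hx0.le] at hox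
    calc (L ^ 4) ^ 2 = L ^ 8 := by ring
      _ ≤ x := hox
  have hgoal : L ^ (-(3 / 4) : ℝ) = E ^ 6 / L := by
    rw [hp, ← Real.rpow_sub_one hL0.ne']
    norm_num
  set Z := ⌊L ^ 2⌋₊ with hZ
  set f : ℕ → ℝ := fun q => 2 * √x + K * (x / L) * (5 * E ^ 6 * ((q : ℝ) ^ 2)⁻¹ +
    E ^ 5 * (q : ℝ)⁻¹) with hf
  set g : ℕ → ℝ := fun q => 5 * (x * L) * ((q : ℝ) ^ 2)⁻¹ with hg
  have hf0 : ∀ q, 0 ≤ f q := fun q => by positivity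
  have hg0 : ∀ q, 0 ≤ g q := fun q => by positivity
  have h1 : ∑ q ∈ (Finset.Icc 5 ⌊x⌋₊).filter Nat.Prime,
      (2 * (countSet (compositeSet q) x : ℝ) + countSet (squareMultiples q) x) ≤
      ∑ q ∈ Finset.Ioc 0 Z, f q + ∑ q ∈ Finset.Ioc Z ⌊x⌋₊, g q := by
    rw [← Finset.sum_filter_add_sum_filter_not ((Finset.Icc 5 ⌊x⌋₊).filter Nat.Prime) (· ≤ Z)]
    refine add_le_add ?_ ?_
    · refine (Finset.sum_le_sum fun q hq => ?_).trans
        (Finset.sum_le_sum_of_subset_of_nonneg ?_ fun q _ _ => hf0 q)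
      · simp only [Finset.mem_filter, Finset.mem_Icc] at hq
        exact hsm q hq.1.2 hq.1.1.1
          ((Nat.cast_le.mpr hq.2).trans (Nat.floor_le (by positivity))) hLx
      · intro q hq
        simp only [Finset.mem_filter, Finset.mem_Icc, Finset.mem_Ioc] at hq ⊢
        lia
    · refine (Finset.sum_le_sum fun q hq => ?_).trans
        (Finset.sum_le_sum_of_subset_of_nonneg ?_ fun q _ _ => hg0 q)
      · simp only [Finset.mem_filter, Finset.mem_Icc] at hq
        have hq0 : 0 < q := by lia
        have e1 := hlarge q hq0
        have e2 := countSet_squareMultiples_le_div hq0 hx0.le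
        have e3 : g q = x / q ^ 2 * (5 * L) := by rw [hg]; ring
        rw [e3]
        have e4 : x / (q : ℝ) ^ 2 * 1 ≤ x / q ^ 2 * L :=
          mul_le_mul_of_nonneg_left hL (by positivity)
        linarith
      · intro q hq
        simp only [Finset.mem_filter, Finset.mem_Icc, Finset.mem_Ioc] at hq ⊢
        lia
  refine h1.trans ?_
  have hZL : (Z : ℝ) ≤ L ^ 2 := Nat.floor_le (by positivity)
  have h2 : ∑ q ∈ Finset.Ioc Z ⌊x⌋₊, g q ≤ 10 * (x / L) := by
    rw [hg, ← Finset.mul_sum]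
    have e1 : (2 : ℝ) / (Z + 1) ≤ 2 / L ^ 2 :=
      div_le_div_of_nonneg_left zero_le_two (by positivity) (Nat.lt_floor_add_one _).le
    refine (mul_le_mul_of_nonneg_left ((sum_Ioc_inv_sq_le_two_div _ _).trans e1)
      (by positivity)).trans (le_of_eq ?_)
    field_simp
    ring
  have h3 : ∑ q ∈ Finset.Ioc 0 Z, f q ≤ 2 * (x / L) + K * (x / L) * (60 * E ^ 6) := by
    rw [hf, Finset.sum_add_distrib, Finset.sum_const, Nat.card_Ioc, Nat.sub_zero, nsmul_eq_mul,
      ← Finset.mul_sum, Finset.sum_add_distrib, ← Finset.mul_sum, ← Finset.mul_sum]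
    refine add_le_add ?_ (mul_le_mul_of_nonneg_left ?_ (by positivity))
    · have e1 : L ^ 3 ≤ √x := le_trans (pow_le_pow_right₀ hL (by norm_num)) hLx
      have e2 : L ^ 2 * √x ≤ x / L := by
        rw [le_div_iff₀ hL0]
        have := Real.mul_self_sqrt hx0.le
        nlinarith [Real.sqrt_nonneg x]
      have e3 := mul_le_mul_of_nonneg_right hZL (Real.sqrt_nonneg x)
      linarith
    · have e1 := sum_Ioc_inv_sq_le_two_div 0 Z
      rw [Nat.cast_zero, zero_add, div_one] at e1
      have e2 : ∑ q ∈ Finset.Ioc 0 Z, (q : ℝ)⁻¹ ≤ 49 * E := by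
        refine (sum_Ioc_inv_le Z).trans (le_trans ?_ hlog)
        rcases Nat.eq_zero_or_pos Z with h0 | h0
        · rw [h0, Nat.cast_zero, Real.log_zero]
          have := Real.log_nonneg hL
          linarith
        · have := Real.log_le_log (by exact_mod_cast h0) hZL
          rw [Real.log_pow] at this
          push_cast at this
          linarith
      have e3 := mul_le_mul_of_nonneg_left e1 (by positivity : 0 ≤ 5 * E ^ 6)
      have e4 := mul_le_mul_of_nonneg_left e2 (by positivity : 0 ≤ E ^ 5)
      have e5 : E ^ 5 * (49 * E) = 49 * E ^ 6 := by ring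
      linarith
  rw [hgoal]
  have h4 : x / L ≤ x / L * E ^ 6 := le_mul_of_one_le_right (by positivity) hE6
  have h5 : (2 + 60 * K + 10) * (x * (E ^ 6 / L)) =
    12 * (x / L * E ^ 6) + K * (x / L) * (60 * E ^ 6) := by ring
  rw [h5]
  linarith

/-- `1` together with the primes. -/
def oneOrPrime : Set ℕ := {m | m = 1 ∨ m.Prime}

theorem mem_oneOrPrime_or_mem_compositeSet {q m : ℕ} (h : m ∈ primeSet fun p => p % q = 1) :
    m ∈ oneOrPrime ∨ (m ∈ compositeSet q ∧ q ≤ m) := by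
  by_cases h1 : m = 1
  · exact Or.inl (Or.inl h1)
  by_cases hp : m.Prime
  · exact Or.inl (Or.inr hp)
  refine Or.inr ⟨⟨h, hp, h1⟩, ?_⟩
  obtain ⟨j, hj, rfl⟩ := exists_eq_one_add_mul h h1
  nlinarith

/-- Integers lying in some `InB q` with `q ≥ 5` prime. -/
def largeModulusSet : Set ℕ := {n | ∃ q, q.Prime ∧ 5 ≤ q ∧ InB q n}

theorem mem_cover_of_mem_largeModulusSet {n : ℕ} (h : n ∈ largeModulusSet) (hn : 0 < n) {x : ℝ}
    (hx : (n : ℝ) ≤ x) :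
    n ∈ oneOrPrime ∪ (2 * ·) '' oneOrPrime ∪ ⋃ q ∈ (Finset.Icc 5 ⌊x⌋₊).filter Nat.Prime,
      (compositeSet q ∪ (2 * ·) '' compositeSet q ∪ squareMultiples q) := by
  obtain ⟨q, hq, hq5, h4, hB⟩ := h
  have hcover : ∀ m, q ≤ m → m ≤ n → q ∈ (Finset.Icc 5 ⌊x⌋₊).filter Nat.Prime := fun m h1 h2 =>
    Finset.mem_filter.mpr ⟨Finset.mem_Icc.mpr ⟨hq5, (h1.trans h2).trans (Nat.le_floor hx)⟩, hq⟩
  by_cases hqn : q ∣ n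
  · refine Or.inr (Set.mem_biUnion (hcover q le_rfl (Nat.le_of_dvd hn hqn)) (Or.inr ?_))
    have hsq : q ^ 2 ∣ n := by
      rcases hB q hq hqn (by lia) with h | h
      · simp at h
      · exact h.2
    obtain ⟨k, rfl⟩ := hsq
    refine ⟨k, ⟨fun h0 => by simp [h0] at hn, fun p hp hpk => ?_⟩, rfl⟩
    by_cases hp2 : p = 2
    · exact Or.inl hp2
    · rcases hB p hp (Dvd.dvd.mul_left hpk _) hp2 with h | h
      · exact Or.inr (Or.inr h)
      · exact Or.inr (Or.inl h.1)
  · have hB' : ∀ p, p.Prime → p ∣ n → p ≠ 2 → p % q = 1 := fun p hp hpn hp2 =>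
      (hB p hp hpn hp2).resolve_right fun h => hqn (h.1 ▸ hpn)
    by_cases h2 : 2 ∣ n
    · obtain ⟨m, rfl⟩ := h2
      have hm : m ∈ primeSet fun p => p % q = 1 := by
        refine ⟨by lia, fun p hp hpm => hB' p hp (Dvd.dvd.mul_left hpm _) ?_⟩
        rintro rfl
        exact h4 (by obtain ⟨k, rfl⟩ := hpm; exact ⟨k, by ring⟩)
      rcases mem_oneOrPrime_or_mem_compositeSet hm with h | h
      · exact Or.inl (Or.inr ⟨m, h, rfl⟩)
      · exact Or.inr (Set.mem_biUnion (hcover m h.2 (by lia)) (Or.inl (Or.inr ⟨m, h.1, rfl⟩)))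
    · have hm : n ∈ primeSet fun p => p % q = 1 :=
        ⟨hn.ne', fun p hp hpn => hB' p hp hpn (by rintro rfl; exact h2 hpn)⟩
      rcases mem_oneOrPrime_or_mem_compositeSet hm with h | h
      · exact Or.inl (Or.inl h)
      · exact Or.inr (Set.mem_biUnion (hcover n h.2 le_rfl) (Or.inl (Or.inl h.1)))

theorem countSet_image_two_le (S : Set ℕ) {x : ℝ} (hx : 0 ≤ x) :
    countSet ((2 * ·) '' S) x ≤ countSet S x := by
  rw [countSet_image_mul two_pos]
  exact countSet_mono S (div_le_self hx (by norm_num))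

theorem countSet_oneOrPrime_le (x : ℝ) :
    countSet oneOrPrime x ≤ 1 + Nat.primeCounting ⌊x⌋₊ := by
  classical
  rw [countSet_eq, Nat.primeCounting, Nat.primeCounting', Nat.count_eq_card_filter_range]
  refine (Finset.card_le_card (t := {1} ∪ (Finset.range (⌊x⌋₊ + 1)).filter Nat.Prime)
    fun n hn => ?_).trans ((Finset.card_union_le _ _).trans (by simp))
  simp only [Finset.mem_filter, Finset.mem_Icc, Finset.mem_union, Finset.mem_singleton,
    Finset.mem_range] at hn ⊢
  rcases hn.2 with h | h
  · exact Or.inl h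
  · exact Or.inr ⟨by lia, h⟩

theorem exists_countSet_oneOrPrime_le : ∃ K : ℝ, 0 < K ∧ ∀ᶠ x : ℝ in atTop,
    (countSet oneOrPrime x : ℝ) ≤ K * (x * Real.log x ^ (-(3 / 4) : ℝ)) := by
  have h4 : 0 < Real.log 4 := Real.log_pos (by norm_num)
  refine ⟨2 + 2 * Real.log 4, by positivity, ?_⟩
  have ho := (Real.isLittleO_pow_log_id_atTop (n := 2)).bound (one_pos)
  filter_upwards [ho, eventually_ge_atTop (Real.exp 1)] with x hox hx
  have hx0 : 0 < x := (Real.exp_pos 1).trans_le hx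
  have hx1 : 1 < x := lt_of_lt_of_le (by rw [Real.one_lt_exp_iff]; norm_num) hx
  have hL : 1 ≤ Real.log x := by rwa [Real.le_log_iff_exp_le hx0]
  have h1 := Chebyshev.pi_le_log4_mul_div hx1
  rw [Real.log_sqrt hx0.le] at h1
  have h2 : (countSet oneOrPrime x : ℝ) ≤ 1 + Nat.primeCounting ⌊x⌋₊ := by
    exact_mod_cast countSet_oneOrPrime_le x
  set L := Real.log x with hLdef
  have hL0 : 0 < L := by linarith
  have h3 : √x ≤ x / L := by
    rw [le_div_iff₀ hL0]
    rw [one_mul, id, Real.norm_of_nonneg (by positivity), Real.norm_of_nonneg hx0.le] at hox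
    have := Real.le_sqrt_of_sq_le hox
    have := Real.mul_self_sqrt hx0.le
    nlinarith [Real.sqrt_nonneg x]
  have h5 : 1 ≤ √x := by rw [Real.one_le_sqrt]; exact hx1.le
  have h6 : x / L ≤ x * L ^ (-(3 / 4) : ℝ) := by
    rw [div_eq_mul_inv, ← Real.rpow_neg_one]
    exact mul_le_mul_of_nonneg_left
      (Real.rpow_le_rpow_of_exponent_le hL (by norm_num)) hx0.le
  have h7 : Real.log 4 * x / (L / 2) = 2 * Real.log 4 * (x / L) := by field_simp
  rw [h7] at h1
  have h8 := mul_le_mul_of_nonneg_left h6 (by positivity : 0 ≤ 2 + 2 * Real.log 4)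
  linarith

theorem exists_countSet_largeModulusSet_le : ∃ K : ℝ, 0 < K ∧ ∀ᶠ x : ℝ in atTop,
    (countSet largeModulusSet x : ℝ) ≤ K * (x * Real.log x ^ (-(3 / 4) : ℝ)) := by
  obtain ⟨K₁, hK₁, h₁⟩ := exists_countSet_oneOrPrime_le
  obtain ⟨K₂, hK₂, h₂⟩ := exists_sum_countSet_prime_modulus_le
  refine ⟨2 * K₁ + K₂, by positivity, ?_⟩
  filter_upwards [h₁, h₂, eventually_ge_atTop 0] with x h₁ h₂ hx
  have e1 := countSet_le_countSet fun n h hn hx =>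
    mem_cover_of_mem_largeModulusSet (n := n) (x := x) h hn hx
  have e2 := e1.trans ((countSet_union_le _ _ _).trans
    (Nat.add_le_add (countSet_union_le _ _ _) (countSet_biUnion_le _ _ _)))
  have e3 : ∀ q, countSet (compositeSet q ∪ (2 * ·) '' compositeSet q ∪ squareMultiples q) x ≤
      2 * countSet (compositeSet q) x + countSet (squareMultiples q) x := by
    intro q
    have a1 := countSet_union_le (compositeSet q ∪ (2 * ·) '' compositeSet q) (squareMultiples q) x
    have a2 := countSet_union_le (compositeSet q) ((2 * ·) '' compositeSet q) x
    have a3 := countSet_image_two_le (compositeSet q) hx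
    lia
  have e4 := countSet_image_two_le oneOrPrime hx
  have e5 := Finset.sum_le_sum fun q (_ : q ∈ (Finset.Icc 5 ⌊x⌋₊).filter Nat.Prime) => e3 q
  have e6 : (countSet largeModulusSet x : ℝ) ≤ 2 * countSet oneOrPrime x +
      ∑ q ∈ (Finset.Icc 5 ⌊x⌋₊).filter Nat.Prime,
        (2 * (countSet (compositeSet q) x : ℝ) + countSet (squareMultiples q) x) := by
    have : countSet largeModulusSet x ≤ 2 * countSet oneOrPrime x +
      ∑ q ∈ (Finset.Icc 5 ⌊x⌋₊).filter Nat.Prime,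
        (2 * countSet (compositeSet q) x + countSet (squareMultiples q) x) := by lia
    exact_mod_cast this
  linarith

end

section

open MeasureTheory Set Filter DirichletCharacter Topology

/-- `S` has `c * x / √(log x) + O(x / (log x) ^ (3/4))` elements up to `x`. -/
def HasSqrtLogDensity (S : Set ℕ) (c : ℝ) : Prop :=
  ∃ C : ℝ, 0 < C ∧ ∀ᶠ x : ℝ in atTop, |(countSet S x : ℝ) - c * (x * Real.log x ^ (-(1 / 2) : ℝ))| ≤
    C * (x * Real.log x ^ (-(3 / 4) : ℝ))

theorem abs_rpow_neg_half_sub_le {L M : ℝ} (hL : 1 ≤ L) (hM : L / 2 ≤ M) (hML : M ≤ L) :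
    |M ^ (-(1 / 2) : ℝ) - L ^ (-(1 / 2) : ℝ)| ≤ 2 * (L - M) * L ^ (-(3 / 4) : ℝ) := by
  have hL0 : 0 < L := by linarith
  have hM0 : 0 < M := by linarith
  have h1 : M ^ (-(1 / 2) : ℝ) = (√M)⁻¹ := by rw [Real.rpow_neg hM0.le, Real.sqrt_eq_rpow]
  have h2 : L ^ (-(1 / 2) : ℝ) = (√L)⁻¹ := by rw [Real.rpow_neg hL0.le, Real.sqrt_eq_rpow]
  have h3 : L⁻¹ ≤ L ^ (-(3 / 4) : ℝ) := by
    rw [← Real.rpow_neg_one]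
    exact Real.rpow_le_rpow_of_exponent_le hL (by norm_num)
  refine le_trans ?_ (mul_le_mul_of_nonneg_left h3 (by linarith))
  have hsL := Real.sq_sqrt hL0.le
  have hsM := Real.sq_sqrt hM0.le
  have hsL1 : 1 ≤ √L := Real.one_le_sqrt.mpr hL
  have hsM0 : 0 < √M := Real.sqrt_pos.mpr hM0
  have hss : √M ≤ √L := Real.sqrt_le_sqrt hML
  rw [h1, h2, abs_of_nonneg (sub_nonneg.mpr (inv_anti₀ hsM0 hss))]
  set a := √L
  set b := √M
  rw [← hsL, ← hsM, inv_sub_inv hsM0.ne' (by positivity), ← div_eq_mul_inv,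
    div_le_div_iff₀ (by positivity) (by positivity)]
  have h4 : a ≤ 2 * b := by nlinarith
  have h5 : a * a ≤ 2 * (a + b) * (b * a) := by
    have : a ≤ 2 * (a + b) * b := by nlinarith
    nlinarith
  have h6 := mul_le_mul_of_nonneg_left h5 (sub_nonneg.mpr hss)
  nlinarith

theorem HasSqrtLogDensity.uniform {S : Set ℕ} {c : ℝ} (h : HasSqrtLogDensity S c) :
    ∃ C : ℝ, 0 < C ∧ ∀ᶠ x : ℝ in atTop, ∀ k : ℝ, 1 ≤ k →
      |(countSet S (x / k) : ℝ) - c * (x / k * Real.log x ^ (-(1 / 2) : ℝ))| ≤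
        C * ((1 + Real.log k) / k * (x * Real.log x ^ (-(3 / 4) : ℝ))) := by
  obtain ⟨C, hC, h⟩ := h
  obtain ⟨X, hX⟩ := eventually_atTop.mp h
  refine ⟨2 * C + 2 * (1 + |c|), by positivity, ?_⟩
  filter_upwards [eventually_ge_atTop (Real.exp 1),
    eventually_ge_atTop (Real.exp (2 * Real.log (max X 1)))] with x hx hxX k hk
  have hx0 : 0 < x := (Real.exp_pos 1).trans_le hx
  have hL : 1 ≤ Real.log x := by rwa [Real.le_log_iff_exp_le hx0]
  rw [← Real.le_log_iff_exp_le hx0] at hxX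
  have hk0 : 0 < k := by linarith
  have hlk := Real.log_nonneg hk
  have hy0 : 0 < x / k := by positivity
  have hlogy : Real.log (x / k) = Real.log x - Real.log k := Real.log_div hx0.ne' hk0.ne'
  set L := Real.log x with hLdef
  set y := x / k with hy
  have hL0 : 0 < L := by linarith
  have hL34 : 0 < L ^ (-(3 / 4) : ℝ) := Real.rpow_pos_of_pos hL0 _
  have hrhs : ((1 + Real.log k) / k * (x * L ^ (-(3 / 4) : ℝ))) =
      (1 + Real.log k) * (y * L ^ (-(3 / 4) : ℝ)) := by rw [hy]; ring
  rw [hrhs]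
  have hyL : 0 < y * L ^ (-(3 / 4) : ℝ) := by positivity
  rcases le_or_gt (Real.log k) (L / 2) with hkL | hkL
  · have hM : L / 2 ≤ Real.log y := by linarith
    have hXy : X ≤ y := by
      refine (le_max_left X 1).trans ?_
      rw [← Real.log_le_log_iff (by positivity) hy0]
      linarith
    have h1 := hX y hXy
    have h2 := abs_rpow_neg_half_sub_le hL hM (by linarith)
    have h3 : Real.log y ^ (-(3 / 4) : ℝ) ≤ 2 * L ^ (-(3 / 4) : ℝ) := by
      have e1 : Real.log y ^ (-(3 / 4) : ℝ) ≤ (L / 2) ^ (-(3 / 4) : ℝ) :=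
        Real.rpow_le_rpow_of_nonpos (by positivity) hM (by norm_num)
      have e2 : (L / 2) ^ (-(3 / 4) : ℝ) = 2 ^ (3 / 4 : ℝ) * L ^ (-(3 / 4) : ℝ) := by
        rw [Real.div_rpow hL0.le zero_le_two, Real.rpow_neg zero_le_two, div_inv_eq_mul, mul_comm]
      have e3 : (2 : ℝ) ^ (3 / 4 : ℝ) ≤ 2 ^ (1 : ℝ) :=
        Real.rpow_le_rpow_of_exponent_le one_le_two (by norm_num)
      rw [Real.rpow_one] at e3
      rw [e2] at e1
      exact e1.trans (mul_le_mul_of_nonneg_right e3 hL34.le)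
    have h4 : C * (y * Real.log y ^ (-(3 / 4) : ℝ)) ≤ 2 * C * (y * L ^ (-(3 / 4) : ℝ)) := by
      calc C * (y * Real.log y ^ (-(3 / 4) : ℝ)) ≤ C * (y * (2 * L ^ (-(3 / 4) : ℝ))) := by gcongr
        _ = _ := by ring
    have h5 : |c * (y * Real.log y ^ (-(1 / 2) : ℝ)) - c * (y * L ^ (-(1 / 2) : ℝ))| ≤
        |c| * (2 * Real.log k * (y * L ^ (-(3 / 4) : ℝ))) := by
      rw [← mul_sub, ← mul_sub, abs_mul, abs_mul, abs_of_pos hy0]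
      refine mul_le_mul_of_nonneg_left ?_ (abs_nonneg c)
      calc y * |Real.log y ^ (-(1 / 2) : ℝ) - L ^ (-(1 / 2) : ℝ)| ≤
          y * (2 * (L - Real.log y) * L ^ (-(3 / 4) : ℝ)) := mul_le_mul_of_nonneg_left h2 hy0.le
        _ = _ := by rw [hlogy]; ring
    refine (abs_sub_le _ (c * (y * Real.log y ^ (-(1 / 2) : ℝ))) _).trans ?_
    have h6 : 0 ≤ C * (Real.log k * (y * L ^ (-(3 / 4) : ℝ))) := by positivity
    have h7 : 0 ≤ |c| * (y * L ^ (-(3 / 4) : ℝ)) := by positivity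
    have h8 : 0 ≤ Real.log k * (y * L ^ (-(3 / 4) : ℝ)) := by positivity
    nlinarith
  · have h1 := countSet_le S hy0.le
    have h0 : (0 : ℝ) ≤ countSet S y := Nat.cast_nonneg _
    have h2 : L ^ (-(1 / 2) : ℝ) ≤ 1 := Real.rpow_le_one_of_one_le_of_nonpos hL (by norm_num)
    have h2' : 0 < L ^ (-(1 / 2) : ℝ) := Real.rpow_pos_of_pos hL0 _
    have h3 : |(countSet S y : ℝ) - c * (y * L ^ (-(1 / 2) : ℝ))| ≤ (1 + |c|) * y := by
      refine (abs_sub _ _).trans ?_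
      rw [abs_of_nonneg h0, abs_mul,
        abs_of_nonneg (by positivity : 0 ≤ y * L ^ (-(1 / 2) : ℝ))]
      have : |c| * (y * L ^ (-(1 / 2) : ℝ)) ≤ |c| * (y * 1) := by gcongr
      linarith
    have h4 : L⁻¹ ≤ L ^ (-(3 / 4) : ℝ) := by
      rw [← Real.rpow_neg_one]
      exact Real.rpow_le_rpow_of_exponent_le hL (by norm_num)
    have h5 : 1 ≤ 2 * Real.log k * L ^ (-(3 / 4) : ℝ) := by
      refine le_trans ?_ (mul_le_mul_of_nonneg_left h4 (by positivity))
      rw [← div_eq_mul_inv, one_le_div hL0]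
      linarith
    have h6 : (1 + |c|) * y * 1 ≤ (1 + |c|) * y * (2 * Real.log k * L ^ (-(3 / 4) : ℝ)) :=
      mul_le_mul_of_nonneg_left h5 (by positivity)
    have h7 : (1 + |c|) * y * (2 * Real.log k * L ^ (-(3 / 4) : ℝ)) =
      2 * (1 + |c|) * (Real.log k * (y * L ^ (-(3 / 4) : ℝ))) := by ring
    have h8 : 0 ≤ C * (Real.log k * (y * L ^ (-(3 / 4) : ℝ))) := by positivity
    have h9 : 0 ≤ |c| * (y * L ^ (-(3 / 4) : ℝ)) := by positivity
    have h10 := mul_pos hC hyL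
    nlinarith

theorem HasSqrtLogDensity.image_mul {S : Set ℕ} {c : ℝ} (h : HasSqrtLogDensity S c) {k : ℕ}
    (hk : 0 < k) : HasSqrtLogDensity ((k * ·) '' S) (c / k) := by
  obtain ⟨C, hC, h⟩ := h.uniform
  have hk1 : (1 : ℝ) ≤ k := by exact_mod_cast hk
  have hlk := Real.log_nonneg hk1
  refine ⟨C * ((1 + Real.log k) / k), by positivity, ?_⟩
  filter_upwards [h] with x hx
  rw [countSet_image_mul hk]
  have := hx k hk1
  rw [← mul_assoc C] at this
  refine le_trans (le_of_eq ?_) this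
  congr 2
  ring

theorem HasSqrtLogDensity.union {S T : Set ℕ} {c d : ℝ} (hS : HasSqrtLogDensity S c)
    (hT : HasSqrtLogDensity T d) (hST : Disjoint S T) : HasSqrtLogDensity (S ∪ T) (c + d) := by
  obtain ⟨C, hC, hS⟩ := hS
  obtain ⟨D, hD, hT⟩ := hT
  refine ⟨C + D, by positivity, ?_⟩
  filter_upwards [hS, hT] with x hSx hTx
  rw [countSet_union_of_disjoint hST, Nat.cast_add, add_mul c, add_mul C, add_sub_add_comm]
  exact (abs_add_le _ _).trans (add_le_add hSx hTx)

theorem countSet_primeSet_three (x : ℝ) :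
    countSet (primeSet fun p => p = 3 ∨ p % 3 = 1) x =
      countSet (primeSet fun p => p % 3 = 1) x +
        countSet (primeSet fun p => p = 3 ∨ p % 3 = 1) (x / 3) := by
  have h1 : (primeSet fun p => p = 3 ∨ p % 3 = 1) = (primeSet fun p => p % 3 = 1) ∪
      (3 * ·) '' (primeSet fun p => p = 3 ∨ p % 3 = 1) := by
    ext n
    constructor
    · intro h
      by_cases h3 : 3 ∣ n
      · obtain ⟨m, rfl⟩ := h3
        exact Or.inr ⟨m, (mul_mem_primeSet.mp h).2, rfl⟩
      · refine Or.inl ⟨h.1, fun p hp hpn => (h.2 p hp hpn).resolve_left ?_⟩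
        rintro rfl
        exact h3 hpn
    · rintro (h | ⟨m, hm, rfl⟩)
      · exact ⟨h.1, fun p hp hpn => Or.inr (h.2 p hp hpn)⟩
      · exact mul_mem_primeSet.mpr ⟨Nat.prime_three.mem_primeSet.mpr (Or.inl rfl), hm⟩
  have h2 : Disjoint (primeSet fun p => p % 3 = 1)
      ((3 * ·) '' (primeSet fun p => p = 3 ∨ p % 3 = 1)) := by
    rw [Set.disjoint_left]
    rintro _ h ⟨m, _, rfl⟩
    have := h.2 3 Nat.prime_three (dvd_mul_right 3 m)
    simp at this
  conv_lhs => rw [h1]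
  rw [countSet_union_of_disjoint h2, countSet_image_mul three_pos]
  rfl

theorem log_three_pow_le (j : ℕ) : Real.log (3 ^ j) ≤ 2 * j := by
  rw [Real.log_pow]
  have := Real.log_le_sub_one_of_pos (x := 3) (by norm_num)
  have hj : (0 : ℝ) ≤ j := Nat.cast_nonneg j
  nlinarith

theorem HasSqrtLogDensity.primeSet_three {c : ℝ}
    (h : HasSqrtLogDensity (primeSet fun p => p % 3 = 1) c) :
    HasSqrtLogDensity (primeSet fun p => p = 3 ∨ p % 3 = 1) (3 / 2 * c) := by
  obtain ⟨C, hC, h⟩ := h.uniform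
  refine ⟨3 * C, by positivity, ?_⟩
  filter_upwards [h, eventually_ge_atTop 1] with x hx hx1
  have hx0 : 0 < x := by linarith
  have hLL := Real.log_nonneg hx1
  set A := x * Real.log x ^ (-(1 / 2) : ℝ) with hA
  set B := x * Real.log x ^ (-(3 / 4) : ℝ) with hB
  have hB0 : 0 ≤ B := by positivity
  set U := primeSet fun p => p % 3 = 1
  set T := primeSet fun p => p = 3 ∨ p % 3 = 1
  have key : ∀ J : ℕ, |(countSet T x : ℝ) - countSet T (x / 3 ^ J) -
      3 / 2 * c * (1 - (1 / 3) ^ J) * A| ≤ C * B * (3 - (3 * J + 3) * (1 / 3) ^ J) := by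
    intro J
    induction J with
    | zero => simp
    | succ J ih =>
      have e1 : countSet T (x / 3 ^ J) = countSet U (x / 3 ^ J) + countSet T (x / 3 ^ (J + 1)) := by
        rw [pow_succ, ← div_div]
        exact countSet_primeSet_three _
      have e2 := hx (3 ^ J) (one_le_pow₀ (by norm_num))
      have e3 : C * ((1 + Real.log (3 ^ J)) / 3 ^ J * B) ≤
          C * B * ((1 + 2 * J) * (1 / 3) ^ J) := by
        calc C * ((1 + Real.log (3 ^ J)) / 3 ^ J * B) ≤ C * ((1 + 2 * J) / 3 ^ J * B) := by
              gcongr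
              exact log_three_pow_le J
          _ = _ := by rw [one_div, inv_pow]; ring
      have e4 : (countSet T x : ℝ) - countSet T (x / 3 ^ (J + 1)) -
          3 / 2 * c * (1 - (1 / 3) ^ (J + 1)) * A =
          ((countSet T x : ℝ) - countSet T (x / 3 ^ J) - 3 / 2 * c * (1 - (1 / 3) ^ J) * A) +
          ((countSet U (x / 3 ^ J) : ℝ) - c * (x / 3 ^ J * Real.log x ^ (-(1 / 2) : ℝ))) := by
        have hu : x / 3 ^ J * Real.log x ^ (-(1 / 2) : ℝ) = A * (1 / 3) ^ J := by
          rw [hA, one_div_pow]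
          ring
        rw [e1, hu, pow_succ (1 / 3 : ℝ)]
        push_cast
        ring
      rw [e4]
      refine (abs_add_le _ _).trans ((add_le_add ih (e2.trans e3)).trans (le_of_eq ?_))
      push_cast
      ring
  have key2 : ∀ J : ℕ, |(countSet T x : ℝ) - 3 / 2 * c * A| ≤
      3 * C * B + (x + |3 / 2 * c * A|) * (1 / 3) ^ J := by
    intro J
    have e1 := key J
    have e2 := countSet_le T (by positivity : 0 ≤ x / 3 ^ J)
    have e3 : (0 : ℝ) ≤ countSet T (x / 3 ^ J) := Nat.cast_nonneg _
    have e4 : (countSet T x : ℝ) - 3 / 2 * c * A =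
        ((countSet T x : ℝ) - countSet T (x / 3 ^ J) - 3 / 2 * c * (1 - (1 / 3) ^ J) * A) +
        (countSet T (x / 3 ^ J) - 3 / 2 * c * A * (1 / 3) ^ J) := by ring
    have e5 : |(countSet T (x / 3 ^ J) : ℝ) - 3 / 2 * c * A * (1 / 3) ^ J| ≤
        (x + |3 / 2 * c * A|) * (1 / 3) ^ J := by
      refine (abs_sub _ _).trans ?_
      rw [abs_of_nonneg e3, abs_mul _ ((1 / 3 : ℝ) ^ J), abs_of_nonneg (by positivity : (0 : ℝ) ≤ (1 / 3) ^ J),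
        add_mul]
      refine add_le_add_left (e2.trans (le_of_eq ?_)) _
      rw [one_div, inv_pow, div_eq_mul_inv]
    have e6 : 0 ≤ C * B * ((3 * J + 3) * (1 / 3) ^ J) := by positivity
    rw [e4]
    refine (abs_add_le _ _).trans ((add_le_add e1 e5).trans ?_)
    rw [mul_sub]
    linarith
  have hlim : Tendsto (fun J : ℕ => 3 * C * B + (x + |3 / 2 * c * A|) * (1 / 3 : ℝ) ^ J) atTop
      (𝓝 (3 * C * B)) := by
    have := ((tendsto_pow_atTop_nhds_zero_of_lt_one (by norm_num : (0 : ℝ) ≤ 1 / 3)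
      (by norm_num)).const_mul (x + |3 / 2 * c * A|)).const_add (3 * C * B)
    simpa using this
  exact ge_of_tendsto' hlim key2

theorem disjoint_image_two {S : Set ℕ} (hS : ∀ n ∈ S, ¬ 2 ∣ n) : Disjoint S ((2 * ·) '' S) := by
  rw [Set.disjoint_left]
  rintro _ h ⟨m, _, rfl⟩
  exact hS _ h (dvd_mul_right 2 m)

theorem setOf_InA_eq : {n : ℕ | n ≠ 0 ∧ InA n} =
    (primeSet fun p => p % 4 = 1) ∪ (2 * ·) '' (primeSet fun p => p % 4 = 1) := by
  ext n
  constructor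
  · rintro ⟨hn, h4, hA⟩
    by_cases h2 : 2 ∣ n
    · obtain ⟨m, rfl⟩ := h2
      refine Or.inr ⟨m, ⟨by lia, fun p hp hpm => hA p hp (Dvd.dvd.mul_left hpm _) ?_⟩, rfl⟩
      rintro rfl
      lia
    · exact Or.inl ⟨hn, fun p hp hpn => hA p hp hpn (by rintro rfl; exact h2 hpn)⟩
  · have hodd : ∀ m ∈ primeSet fun p => p % 4 = 1, ¬ 2 ∣ m := fun m hm h2 => by
      simpa using hm.2 2 Nat.prime_two h2
    rintro (h | ⟨m, hm, rfl⟩)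
    · exact ⟨h.1, fun h4 => hodd n h (by lia), fun p hp hpn _ => h.2 p hp hpn⟩
    · refine ⟨by have := hm.1; lia, fun h4 => hodd m hm (by lia), fun p hp hpn hp2 => ?_⟩
      refine hm.2 p hp (((Nat.Prime.dvd_mul hp).mp hpn).resolve_left fun h => hp2 ?_)
      exact (Nat.prime_dvd_prime_iff_eq hp Nat.prime_two).mp h

/-- The odd part of the set of `n` with `InB 3 n`. -/
def oddThreeSet : Set ℕ :=
  (primeSet fun p => p % 3 = 1) ∪ (9 * ·) '' (primeSet fun p => p = 3 ∨ p % 3 = 1)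

theorem mem_oddThreeSet_iff {n : ℕ} : n ∈ oddThreeSet ↔
    n ≠ 0 ∧ ∀ p, p.Prime → p ∣ n → p % 3 = 1 ∨ (p = 3 ∧ 3 ^ 2 ∣ n) := by
  constructor
  · rintro (h | ⟨m, hm, rfl⟩)
    · exact ⟨h.1, fun p hp hpn => Or.inl (h.2 p hp hpn)⟩
    · refine ⟨by have := hm.1; lia, fun p hp hpn => ?_⟩
      have h9 : 3 ^ 2 ∣ 9 * m := ⟨m, by ring⟩
      rcases (Nat.Prime.dvd_mul hp).mp hpn with h | h
      · rw [show 9 = 3 ^ 2 by norm_num] at h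
        exact Or.inr ⟨(Nat.prime_dvd_prime_iff_eq hp Nat.prime_three).mp (hp.dvd_of_dvd_pow h), h9⟩
      · exact (hm.2 p hp h).symm.imp id fun h => ⟨h, h9⟩
  · rintro ⟨hn, h⟩
    by_cases h3 : 3 ∣ n
    · have h9 : 3 ^ 2 ∣ n := by
        rcases h 3 Nat.prime_three h3 with h | h
        · simp at h
        · exact h.2
      obtain ⟨m, rfl⟩ := h9
      refine Or.inr ⟨m, ⟨fun h0 => hn (by simp [h0]), fun p hp hpm => ?_⟩, by norm_num⟩
      exact ((h p hp (Dvd.dvd.mul_left hpm _)).imp id And.left).symm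
    · refine Or.inl ⟨hn, fun p hp hpn => (h p hp hpn).resolve_right fun h' => h3 (h'.1 ▸ hpn)⟩

theorem not_two_dvd_of_mem_oddThreeSet {n : ℕ} (h : n ∈ oddThreeSet) : ¬ 2 ∣ n := fun h2 => by
  simpa using (mem_oddThreeSet_iff.mp h).2 2 Nat.prime_two h2

theorem setOf_InB_three_eq : {n : ℕ | n ≠ 0 ∧ InB 3 n} = oddThreeSet ∪ (2 * ·) '' oddThreeSet := by
  ext n
  constructor
  · rintro ⟨hn, h4, hB⟩
    by_cases h2 : 2 ∣ n
    · obtain ⟨m, rfl⟩ := h2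
      refine Or.inr ⟨m, mem_oddThreeSet_iff.mpr ⟨by lia, fun p hp hpm => ?_⟩, rfl⟩
      refine (hB p hp (Dvd.dvd.mul_left hpm _) ?_).imp id fun h => ⟨h.1, ?_⟩
      · rintro rfl
        lia
      · exact Nat.Coprime.dvd_of_dvd_mul_left (by norm_num) h.2
    · exact Or.inl (mem_oddThreeSet_iff.mpr
        ⟨hn, fun p hp hpn => hB p hp hpn (by rintro rfl; exact h2 hpn)⟩)
  · rintro (h | ⟨m, hm, rfl⟩)
    · have h' := mem_oddThreeSet_iff.mp h
      exact ⟨h'.1, fun h4 => not_two_dvd_of_mem_oddThreeSet h (by lia),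
        fun p hp hpn _ => h'.2 p hp hpn⟩
    · have h' := mem_oddThreeSet_iff.mp hm
      refine ⟨by have := h'.1; lia, fun h4 => not_two_dvd_of_mem_oddThreeSet hm (by lia),
        fun p hp hpn hp2 => ?_⟩
      refine (h'.2 p hp (((Nat.Prime.dvd_mul hp).mp hpn).resolve_left fun h => hp2 ?_)).imp id
        fun h => ⟨h.1, h.2.mul_left 2⟩
      exact (Nat.prime_dvd_prime_iff_eq hp Nat.prime_two).mp h

theorem hasSqrtLogDensity_InA : HasSqrtLogDensity {n : ℕ | n ≠ 0 ∧ InA n} H4 := by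
  obtain ⟨C, hC, h⟩ := exists_countSet_four
  have h1 : HasSqrtLogDensity (primeSet fun p => p % 4 = 1) (2 / 3 * H4) :=
    ⟨C, hC, (eventually_ge_atTop (Real.exp 2)).mono h⟩
  have h2 := h1.union (h1.image_mul two_pos) (disjoint_image_two fun m hm h2 => by
      simpa using hm.2 2 Nat.prime_two h2)
  rw [setOf_InA_eq]
  convert h2 using 1
  push_cast
  ring

theorem hasSqrtLogDensity_InB_three : HasSqrtLogDensity {n : ℕ | n ≠ 0 ∧ InB 3 n} H6 := by
  obtain ⟨C, hC, h⟩ := exists_countSet_three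
  have h1 : HasSqrtLogDensity (primeSet fun p => p % 3 = 1) (4 / 7 * H6) :=
    ⟨C, hC, (eventually_ge_atTop (Real.exp 2)).mono h⟩
  have hdisj : Disjoint (primeSet fun p => p % 3 = 1)
      ((9 * ·) '' (primeSet fun p => p = 3 ∨ p % 3 = 1)) := by
    rw [Set.disjoint_left]
    rintro _ h ⟨m, _, rfl⟩
    have := h.2 3 Nat.prime_three ⟨3 * m, by ring⟩
    simp at this
  have h2 : HasSqrtLogDensity oddThreeSet _ :=
    h1.union (h1.primeSet_three.image_mul (k := 9) (by norm_num)) hdisj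
  have h3 := h2.union (h2.image_mul two_pos)
    (disjoint_image_two fun _ => not_two_dvd_of_mem_oddThreeSet)
  rw [setOf_InB_three_eq]
  convert h3 using 1
  push_cast
  ring

theorem exists_countSet_inter_le : ∃ K : ℝ, 0 < K ∧ ∀ᶠ x : ℝ in atTop,
    (countSet ({n : ℕ | n ≠ 0 ∧ InA n} ∩ {n : ℕ | n ≠ 0 ∧ InB 3 n}) x : ℝ) ≤
      K * (x * Real.log x ^ (-(3 / 4) : ℝ)) := by
  obtain ⟨C, hC, hA⟩ := exists_invSum_le
  have h4 : 0 < Real.log 4 := Real.log_pos (by norm_num)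
  have h12 : 0 < Real.log (12 : ℕ) := Real.log_pos (by norm_num)
  refine ⟨2 * ((Real.log 4 + 5) * (C * (1 + Real.log (12 : ℕ)))), by positivity, ?_⟩
  filter_upwards [eventually_ge_atTop (Real.exp 1)] with x hx
  have hx0 : 0 < x := (Real.exp_pos 1).trans_le hx
  have hx1 : 1 ≤ x := le_trans (by rw [Real.one_le_exp_iff]; norm_num) hx
  have hL : 1 ≤ Real.log x := by rwa [Real.le_log_iff_exp_le hx0]
  have hL0 : 0 < Real.log x := by linarith
  set U := primeSet fun p => p % 12 = 1 with hU
  have h1 : countSet ({n : ℕ | n ≠ 0 ∧ InA n} ∩ {n : ℕ | n ≠ 0 ∧ InB 3 n}) x ≤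
      countSet (U ∪ (2 * ·) '' U) x := by
    refine countSet_le_countSet fun n hn hn0 _ => ?_
    obtain ⟨⟨_, h4, hA⟩, _, _, hB⟩ := hn
    have hp : ∀ p, p.Prime → p ∣ n → p ≠ 2 → p % 12 = 1 := by
      intro p hp hpn hp2
      have e1 := hA p hp hpn hp2
      rcases hB p hp hpn hp2 with e2 | e2 <;> lia
    by_cases h2 : 2 ∣ n
    · obtain ⟨m, rfl⟩ := h2
      refine Or.inr ⟨m, ⟨by lia, fun p hpp hpm => hp p hpp (Dvd.dvd.mul_left hpm _) ?_⟩, rfl⟩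
      rintro rfl
      lia
    · exact Or.inl ⟨hn0.ne', fun p hpp hpn => hp p hpp hpn (by rintro rfl; exact h2 hpn)⟩
  have h2 : countSet (U ∪ (2 * ·) '' U) x ≤ 2 * countSet U x := by
    have e1 := countSet_union_le U ((2 * ·) '' U) x
    have e2 := countSet_image_two_le U hx0.le
    lia
  have h3 : (countSet ({n : ℕ | n ≠ 0 ∧ InA n} ∩ {n : ℕ | n ≠ 0 ∧ InB 3 n}) x : ℝ) ≤
      2 * countSet U x := by exact_mod_cast h1.trans h2
  have h5 := countSet_mul_log_le (fun p => p % 12 = 1) hx1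
  have h6 := hA 12 (by norm_num) x hx
  rw [show Nat.totient 12 = 4 by decide] at h6
  rw [← le_div_iff₀ hL0] at h5
  have h7 : (Real.log 4 + 5) * x * invSum U x / Real.log x ≤
      (Real.log 4 + 5) * (C * (1 + Real.log (12 : ℕ))) * (x * Real.log x ^ (-(3 / 4) : ℝ)) := by
    have e1 : Real.log x ^ (-(3 / 4) : ℝ) =
        Real.log x ^ (1 / (4 : ℕ) : ℝ) / Real.log x := by
      rw [← Real.rpow_sub_one hL0.ne']
      norm_num
    rw [e1, div_le_iff₀ hL0]
    calc (Real.log 4 + 5) * x * invSum U x ≤ (Real.log 4 + 5) * x *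
          (C * Real.log x ^ (1 / (4 : ℕ) : ℝ) * (1 + Real.log (12 : ℕ))) :=
          mul_le_mul_of_nonneg_left h6 (by positivity)
      _ = _ := by field_simp
  linarith

theorem Tcount_eq_countSet (x : ℝ) : Tcount x = countSet
    ({n : ℕ | n ≠ 0 ∧ InA n} ∪ {n : ℕ | n ≠ 0 ∧ InB 3 n} ∪ (largeModulusSet \ {0})) x := by
  classical
  rw [Tcount, countSet_eq, ← Set.ncard_coe_finset]
  congr 1
  ext n
  simp only [Finset.coe_filter, Finset.mem_Icc, Set.mem_ofPred_eq]
  constructor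
  · rintro ⟨hn, hnx, h⟩
    refine ⟨⟨hn, Nat.le_floor hnx⟩, ?_⟩
    rcases (lambda1_ne_two_iff n hn.ne').mp h with h | ⟨q, hq, hq2, h⟩
    · exact Or.inl (Or.inl ⟨hn.ne', h⟩)
    · rcases eq_or_ne q 3 with rfl | hq3
      · exact Or.inl (Or.inr ⟨hn.ne', h⟩)
      · refine Or.inr ⟨⟨q, hq, ?_, h⟩, hn.ne'⟩
        have := hq.two_le
        by_contra hlt
        have : q = 4 := by lia
        rw [this] at hq
        exact absurd hq (by norm_num)
  · rintro ⟨⟨hn, hnx⟩, h⟩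
    refine ⟨hn, (Nat.le_floor_iff' (by lia)).mp hnx, (lambda1_ne_two_iff n (by lia)).mpr ?_⟩
    rcases h with (h | h) | ⟨⟨q, hq, hq5, h⟩, _⟩
    · exact Or.inl h.2
    · exact Or.inr ⟨3, Nat.prime_three, by norm_num, h.2⟩
    · exact Or.inr ⟨q, hq, by lia, h⟩

theorem countSet_add_countSet (S T : Set ℕ) (x : ℝ) :
    countSet S x + countSet T x = countSet (S ∪ T) x + countSet (S ∩ T) x := by
  classical
  rw [countSet_eq, countSet_eq, countSet_eq, countSet_eq, ← Finset.card_union_add_card_inter]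
  congr 2
  · ext n
    simp only [Finset.mem_filter, Finset.mem_union, Set.mem_union]
    tauto
  · ext n
    simp only [Finset.mem_filter, Finset.mem_inter, Set.mem_inter_iff]
    tauto

theorem exists_Tcount_eventually : ∃ C : ℝ, 0 < C ∧ ∀ᶠ x : ℝ in atTop,
    |(Tcount x : ℝ) - (H4 + H6) * (x * Real.log x ^ (-(1 / 2) : ℝ))| ≤
      C * (x * Real.log x ^ (-(3 / 4) : ℝ)) := by
  obtain ⟨C₁, hC₁, h₁⟩ := hasSqrtLogDensity_InA
  obtain ⟨C₂, hC₂, h₂⟩ := hasSqrtLogDensity_InB_three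
  obtain ⟨C₃, hC₃, h₃⟩ := exists_countSet_inter_le
  obtain ⟨C₄, hC₄, h₄⟩ := exists_countSet_largeModulusSet_le
  refine ⟨C₁ + C₂ + C₃ + C₄, by positivity, ?_⟩
  filter_upwards [h₁, h₂, h₃, h₄] with x h₁ h₂ h₃ h₄
  rw [Tcount_eq_countSet]
  set A : Set ℕ := {n : ℕ | n ≠ 0 ∧ InA n}
  set B : Set ℕ := {n : ℕ | n ≠ 0 ∧ InB 3 n}
  have e1 : (countSet A x : ℝ) + countSet B x = countSet (A ∪ B) x + countSet (A ∩ B) x := by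
    exact_mod_cast countSet_add_countSet A B x
  have e2 : (countSet (A ∪ B ∪ (largeModulusSet \ {0})) x : ℝ) ≤
      countSet (A ∪ B) x + countSet largeModulusSet x := by
    have a1 := countSet_union_le (A ∪ B) (largeModulusSet \ {0}) x
    have a2 : countSet (largeModulusSet \ {0}) x ≤ countSet largeModulusSet x :=
      countSet_le_countSet fun n hn _ _ => hn.1
    exact_mod_cast a1.trans (Nat.add_le_add_left a2 _)
  have e3 : (countSet (A ∪ B) x : ℝ) ≤ countSet (A ∪ B ∪ (largeModulusSet \ {0})) x := by
    exact_mod_cast countSet_le_countSet fun n hn _ _ => Or.inl hn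
  have e4 : (0 : ℝ) ≤ countSet (A ∩ B) x := Nat.cast_nonneg _
  have e5 : (0 : ℝ) ≤ countSet largeModulusSet x := Nat.cast_nonneg _
  rw [abs_le] at h₁ h₂ ⊢
  constructor <;> linarith [h₁.1, h₁.2, h₂.1, h₂.2]

theorem stmt0 : ∃ C : ℝ, 0 < C ∧ ∀ x : ℝ, 2 ≤ x →
    |(Tcount x : ℝ) - (H4 + H6) * x / Real.sqrt (Real.log x)| ≤
      C * x / Real.log x ^ ((3 : ℝ) / 4) := by
  obtain ⟨C, hC, h⟩ := exists_Tcount_eventually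
  obtain ⟨X, hX⟩ := eventually_atTop.mp h
  set M := Real.log (max X 2) with hM
  have hM0 : 0 < M := Real.log_pos (lt_of_lt_of_le one_lt_two (le_max_right _ _))
  refine ⟨C + (M ^ (3 / 4 : ℝ) + |H4 + H6| * M ^ (1 / 4 : ℝ)), by positivity, fun x hx => ?_⟩
  have hx0 : 0 < x := by linarith
  have hL0 : 0 < Real.log x := Real.log_pos (by linarith)
  have e1 : (H4 + H6) * x / Real.sqrt (Real.log x) =
      (H4 + H6) * (x * Real.log x ^ (-(1 / 2) : ℝ)) := by
    rw [Real.rpow_neg hL0.le, ← Real.sqrt_eq_rpow]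
    ring
  have e2 : ∀ D : ℝ, D * x / Real.log x ^ ((3 : ℝ) / 4) =
      D * (x * Real.log x ^ (-(3 / 4) : ℝ)) := fun D => by
    rw [Real.rpow_neg hL0.le]
    ring
  rw [e1, e2]
  have hpos : 0 < Real.log x ^ (-(3 / 4) : ℝ) := Real.rpow_pos_of_pos hL0 _
  rcases le_or_gt X x with hxX | hxX
  · refine (hX x hxX).trans (mul_le_mul_of_nonneg_right ?_ (by positivity))
    have : 0 ≤ M ^ (3 / 4 : ℝ) + |H4 + H6| * M ^ (1 / 4 : ℝ) := by positivity
    linarith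
  · have hLM : Real.log x ≤ M := Real.log_le_log hx0 (hxX.le.trans (le_max_left _ _))
    have e3 : (Tcount x : ℝ) ≤ x := by rw [Tcount_eq_countSet]; exact countSet_le _ hx0.le
    have e4 : (1 : ℝ) = Real.log x ^ (3 / 4 : ℝ) * Real.log x ^ (-(3 / 4) : ℝ) := by
      rw [← Real.rpow_add hL0]
      norm_num
    have e5 : Real.log x ^ (-(1 / 2) : ℝ) =
        Real.log x ^ (1 / 4 : ℝ) * Real.log x ^ (-(3 / 4) : ℝ) := by
      rw [← Real.rpow_add hL0]
      norm_num
    have e6 : Real.log x ^ (3 / 4 : ℝ) ≤ M ^ (3 / 4 : ℝ) :=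
      Real.rpow_le_rpow hL0.le hLM (by norm_num)
    have e7 : Real.log x ^ (1 / 4 : ℝ) ≤ M ^ (1 / 4 : ℝ) :=
      Real.rpow_le_rpow hL0.le hLM (by norm_num)
    calc |(Tcount x : ℝ) - (H4 + H6) * (x * Real.log x ^ (-(1 / 2) : ℝ))| ≤
        x * 1 + |H4 + H6| * (x * Real.log x ^ (-(1 / 2) : ℝ)) := by
          refine (abs_sub _ _).trans ?_
          rw [abs_of_nonneg (Nat.cast_nonneg _), abs_mul,
            abs_of_nonneg (by positivity : 0 ≤ x * Real.log x ^ (-(1 / 2) : ℝ))]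
          linarith
      _ = (Real.log x ^ (3 / 4 : ℝ) + |H4 + H6| * Real.log x ^ (1 / 4 : ℝ)) *
          (x * Real.log x ^ (-(3 / 4) : ℝ)) := by
          rw [e5, e4]
          ring
      _ ≤ _ := by
          refine mul_le_mul_of_nonneg_right ?_ (by positivity)
          have := mul_le_mul_of_nonneg_left e7 (abs_nonneg (H4 + H6))
          linarith

end
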